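/- arXiv:1302.3773 — 5 statements merged into one kernel-verified Lean document; each statement's English description precedes it below -/
import Mathlib

section
/- Let I be an open interval of ℝ, x₀ ∈ I, and let (κₙ)_{n≥0} and κ be nonzero positive Radon measures on I such that κₙ → κ vaguely, i.e. ∫ φ dκₙ → ∫ φ dκ for every continuous compactly supported φ : I → ℝ. For each n, let uₙ be a solution of (1/2)u″ = uκₙ on I that is positive on I, non-increasing, satisfies uₙ(x₀) = 1, and is minimal on the right in the sense that every solution v of (1/2)u″ = uκₙ with v(x₀) = 1 that is positive on I ∩ [x₀, +∞) satisfies v ≥ uₙ on I ∩ [x₀, +∞); let u be the analogous solution for κ. Then uₙ converges to u uniformly on compact subsets of I. The symmetric statement holds for the solutions that are positive, non-decreasing, equal to 1 at x₀ and minimal on I ∩ (−∞, x₀]. -/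
open MeasureTheory Set Filter

/-- `u` is a solution of `(1/2) u'' = u κ` on `I`, where `κ` is a positive Radon
measure, and `g` is the right-continuous right-derivative of `u`. -/
def IsSolKappa (I : Set ℝ) (κ : Measure ℝ) (u g : ℝ → ℝ) : Prop :=
  ContinuousOn u I ∧
  (∀ x ∈ I, ContinuousWithinAt g (Ici x) x) ∧
  (∀ x' ∈ I, ∀ x ∈ I, u x = u x' + ∫ t in x'..x, g t) ∧
  (∀ x' ∈ I, ∀ x ∈ I, x' ≤ x → g x - g x' = 2 * ∫ t in Ioc x' x, u t ∂κ)

/-- The piecewise linear function equal to `1` at `m`, vanishing at `a` and `b`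
and outside `[a, b]`. -/
noncomputable def tent (a m b s : ℝ) : ℝ := max 0 (min ((s - a) / (m - a)) ((b - s) / (b - m)))

lemma continuous_tent (a m b : ℝ) : Continuous (tent a m b) := by
  unfold tent; fun_prop

lemma tent_nonneg (a m b s : ℝ) : 0 ≤ tent a m b s := le_max_left _ _

lemma tent_of_le {a m b s : ℝ} (ham : a < m) (hmb : m < b) (has : a ≤ s) (hsm : s ≤ m) :
    tent a m b s = (s - a) / (m - a) := by
  have h1 : 0 < m - a := by linarith
  have h2 : 0 < b - m := by linarith
  have h3 : (s - a) / (m - a) ≤ 1 := by rw [div_le_one h1]; linarith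
  have h4 : 1 ≤ (b - s) / (b - m) := by rw [one_le_div h2]; linarith
  rw [tent, min_eq_left (h3.trans h4), max_eq_right (div_nonneg (by linarith) h1.le)]

lemma tent_of_ge {a m b s : ℝ} (ham : a < m) (hmb : m < b) (hms : m ≤ s) (hsb : s ≤ b) :
    tent a m b s = (b - s) / (b - m) := by
  have h1 : 0 < m - a := by linarith
  have h2 : 0 < b - m := by linarith
  have h3 : (b - s) / (b - m) ≤ 1 := by rw [div_le_one h2]; linarith
  have h4 : 1 ≤ (s - a) / (m - a) := by rw [one_le_div h1]; linarith
  rw [tent, min_eq_right (h3.trans h4), max_eq_right (div_nonneg (by linarith) h2.le)]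

lemma tent_of_notMem {a m b s : ℝ} (ham : a < m) (hmb : m < b) (hs : s ∉ Ioo a b) :
    tent a m b s = 0 := by
  have h1 : 0 < m - a := by linarith
  have h2 : 0 < b - m := by linarith
  rw [tent, max_eq_left]
  by_cases has : a < s
  · have hbs : b ≤ s := by
      by_contra! h
      exact hs ⟨has, h⟩
    exact (min_le_right _ _).trans (div_nonpos_of_nonpos_of_nonneg (by linarith) h2.le)
  · exact (min_le_left _ _).trans (div_nonpos_of_nonpos_of_nonneg (by linarith) h1.le)

lemma tent_le_one {a m b : ℝ} (ham : a < m) (hmb : m < b) (s : ℝ) : tent a m b s ≤ 1 := by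
  have h1 : 0 < m - a := by linarith
  have h2 : 0 < b - m := by linarith
  refine max_le zero_le_one ?_
  rcases le_total s m with h | h
  · exact (min_le_left _ _).trans (by rw [div_le_one h1]; linarith)
  · exact (min_le_right _ _).trans (by rw [div_le_one h2]; linarith)

lemma tent_neg (a m b s : ℝ) : tent (-b) (-m) (-a) (-s) = tent a m b s := by
  unfold tent
  rw [min_comm]
  ring_nf

/-- The product of a tent function with a function continuous on its support is continuous. -/
lemma continuous_tent_mul {a m b : ℝ} (ham : a < m) (hmb : m < b) {u : ℝ → ℝ}
    (hu : ContinuousOn u (Icc a b)) : Continuous (fun s => tent a m b s * u s) := by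
  have hab : a ≤ b := (ham.trans hmb).le
  have heq : (fun s => tent a m b s * u s) =
      fun s => tent a m b s * IccExtend hab ((Icc a b).domRestrict u) s := by
    funext s
    by_cases hs : s ∈ Ioo a b
    · rw [IccExtend_of_mem _ _ (Ioo_subset_Icc_self hs)]
      rfl
    · simp [tent_of_notMem ham hmb hs]
  rw [heq]
  exact (continuous_tent a m b).mul hu.domRestrict.Icc_extend'

lemma integral_tent_mul_eq_setIntegral {a m b : ℝ} (ham : a < m) (hmb : m < b) (κ : Measure ℝ)
    (u : ℝ → ℝ) :
    ∫ s, tent a m b s * u s ∂κ = ∫ s in Icc a b, tent a m b s * u s ∂κ := by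
  refine (setIntegral_eq_integral_of_forall_compl_eq_zero fun s hs => ?_).symm
  rw [tent_of_notMem ham hmb fun h => hs (Ioo_subset_Icc_self h), zero_mul]

lemma ContinuousOn.integrableOn_Icc_of_measure_lt_top {κ : Measure ℝ} {a b : ℝ} {f : ℝ → ℝ}
    (hf : ContinuousOn f (Icc a b)) (hκ : κ (Icc a b) < ⊤) : IntegrableOn f (Icc a b) κ := by
  obtain ⟨C, hC⟩ := isCompact_Icc.exists_bound_of_continuousOn hf
  refine ⟨hf.aestronglyMeasurable measurableSet_Icc, .restrict_of_bounded (C := C) hκ ?_⟩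
  exact (ae_restrict_mem measurableSet_Icc).mono hC

lemma integrable_tent_mul {a m b : ℝ} (ham : a < m) (hmb : m < b) {κ : Measure ℝ}
    (hκ : κ (Icc a b) < ⊤) {u : ℝ → ℝ} (hu : ContinuousOn u (Icc a b)) :
    Integrable (fun s => tent a m b s * u s) κ := by
  refine (integrableOn_iff_integrable_of_support_subset (s := Icc a b) fun s hs => ?_).1
    ((continuous_tent_mul ham hmb hu).continuousOn.integrableOn_Icc_of_measure_lt_top hκ)
  by_contra h
  exact hs (by simp [tent_of_notMem ham hmb fun h' => h (Ioo_subset_Icc_self h')])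

lemma abs_integral_tent_mul_le {a m b : ℝ} (ham : a < m) (hmb : m < b) {κ : Measure ℝ}
    (hκ : κ (Icc a b) < ⊤) {u : ℝ → ℝ} {M : ℝ} (hu : ∀ s ∈ Icc a b, |u s| ≤ M) :
    |∫ s, tent a m b s * u s ∂κ| ≤ M * κ.real (Icc a b) := by
  rw [integral_tent_mul_eq_setIntegral ham hmb]
  rw [← Real.norm_eq_abs]
  refine norm_setIntegral_le_of_norm_le_const hκ fun s hs => ?_
  rw [Real.norm_eq_abs, abs_mul, abs_of_nonneg (tent_nonneg _ _ _ _)]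
  exact (mul_le_of_le_one_left (abs_nonneg _) (tent_le_one ham hmb s)).trans (hu s hs)

/-- Weak solutions of `(1/2) u'' = u κ`: the equation tested against tent functions. -/
structure IsWeakSolKappa (I : Set ℝ) (κ : Measure ℝ) (u : ℝ → ℝ) : Prop where
  continuousOn : ContinuousOn u I
  slope_sub_slope : ∀ ⦃a⦄, a ∈ I → ∀ ⦃b⦄, b ∈ I → ∀ ⦃m⦄, a < m → m < b →
    (u b - u m) / (b - m) - (u m - u a) / (m - a) = 2 * ∫ s, tent a m b s * u s ∂κ

namespace IsWeakSolKappa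

variable {I : Set ℝ} {κ : Measure ℝ} {u v : ℝ → ℝ}

lemma slope_le_slope (hu : IsWeakSolKappa I κ u) {a m b : ℝ} (ha : a ∈ I) (hb : b ∈ I)
    (ham : a < m) (hmb : m < b) (hpos : ∀ s ∈ Icc a b, 0 ≤ u s) :
    (u m - u a) / (m - a) ≤ (u b - u m) / (b - m) := by
  have h := hu.slope_sub_slope ha hb ham hmb
  have h0 : 0 ≤ ∫ s, tent a m b s * u s ∂κ := by
    refine integral_nonneg fun s => ?_
    by_cases hs : s ∈ Ioo a b
    · exact mul_nonneg (tent_nonneg _ _ _ _) (hpos s (Ioo_subset_Icc_self hs))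
    · simp [tent_of_notMem ham hmb hs]
  linarith

lemma sub (hI : I.OrdConnected) (hκ : ∀ x ∈ I, ∀ y ∈ I, κ (Icc x y) < ⊤)
    (hu : IsWeakSolKappa I κ u) (hv : IsWeakSolKappa I κ v) :
    IsWeakSolKappa I κ (fun x => u x - v x) where
  continuousOn := hu.continuousOn.sub hv.continuousOn
  slope_sub_slope a ha b hb m ham hmb := by
    have hs := hI.out ha hb
    simp only [mul_sub]
    rw [integral_sub (integrable_tent_mul ham hmb (hκ a ha b hb) (hu.continuousOn.mono hs))
      (integrable_tent_mul ham hmb (hκ a ha b hb) (hv.continuousOn.mono hs)), mul_sub,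
      ← hu.slope_sub_slope ha hb ham hmb, ← hv.slope_sub_slope ha hb ham hmb]
    ring

/-- Reflection of weak solutions. -/
lemma comp_neg (hu : IsWeakSolKappa I κ u) :
    IsWeakSolKappa (Neg.neg ⁻¹' I) (κ.map Neg.neg) (fun x => u (-x)) where
  continuousOn := hu.continuousOn.comp continuous_neg.continuousOn fun _ hx => hx
  slope_sub_slope a ha b hb m ham hmb := by
    have h := hu.slope_sub_slope hb ha (neg_lt_neg hmb) (neg_lt_neg ham)
    have hi : ∫ s, tent a m b s * u (-s) ∂(κ.map Neg.neg) =
        ∫ s, tent (-b) (-m) (-a) s * u s ∂κ := by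
      have := integral_map_equiv (μ := κ) (MeasurableEquiv.neg ℝ) fun s => tent a m b s * u (-s)
      refine this.trans ?_
      refine integral_congr_ae (.of_forall fun s => ?_)
      change tent a m b (-s) * u (- -s) = _
      rw [← tent_neg a m b, neg_neg]
    rw [hi, ← h]
    have h1 : m - a ≠ 0 := by linarith
    have h2 : b - m ≠ 0 := by linarith
    have h3 : -a - -m = m - a := by ring
    have h4 : -m - -b = b - m := by ring
    rw [h3, h4]
    ring

end IsWeakSolKappa

/-- A maximum principle: a function which is midpoint-convex wherever it is positive, and
nonpositive at the endpoints of an interval, is nonpositive. -/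
lemma nonpos_of_slope_le_slope_of_pos {f : ℝ → ℝ} {p q : ℝ} (hf : ContinuousOn f (Icc p q))
    (hp : f p ≤ 0) (hq : f q ≤ 0)
    (hconv : ∀ a m b, p ≤ a → a < m → m < b → b ≤ q → (∀ s ∈ Icc a b, 0 < f s) →
      (f m - f a) / (m - a) ≤ (f b - f m) / (b - m)) :
    ∀ x ∈ Icc p q, f x ≤ 0 := by
  by_contra! h
  obtain ⟨x, hx, hfx⟩ := h
  obtain ⟨z, hz, hmax⟩ := isCompact_Icc.exists_isMaxOn ⟨x, hx⟩ hf
  have hZ : IsCompact (Icc p q ∩ f ⁻¹' {f z}) :=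
    isCompact_Icc.of_isClosed_subset
      (hf.preimage_isClosed_of_isClosed isClosed_Icc isClosed_singleton) inter_subset_left
  obtain ⟨m, ⟨hm, hfm⟩, hleast⟩ := hZ.exists_isLeast ⟨z, hz, rfl⟩
  have hfm : f m = f z := hfm
  have hpos : 0 < f m := by rw [hfm]; exact hfx.trans_le (hmax hx)
  have hpm : p < m := lt_of_le_of_ne hm.1 (by rintro rfl; linarith)
  have hmq : m < q := lt_of_le_of_ne hm.2 (by rintro rfl; linarith)
  have hcont : ContinuousAt f m := hf.continuousAt (Icc_mem_nhds hpm hmq)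
  obtain ⟨δ, hδ, hball⟩ := Metric.eventually_nhds_iff.1 (hcont.eventually (lt_mem_nhds hpos))
  obtain ⟨η, hη, hη'⟩ := exists_between (lt_min hδ (lt_min (sub_pos.2 hpm) (sub_pos.2 hmq)))
  simp only [lt_min_iff] at hη'
  obtain ⟨h1, h2, h3⟩ := hη'
  have ha : f (m - η) < f m := by
    refine lt_of_le_of_ne (by rw [hfm]; exact hmax ⟨by linarith, by linarith⟩) fun he => ?_
    have := hleast (a := m - η) ⟨⟨by linarith, by linarith⟩, he.trans hfm⟩
    linarith
  have hb : f (m + η) ≤ f m := by rw [hfm]; exact hmax ⟨by linarith, by linarith⟩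
  have := hconv (m - η) m (m + η) (by linarith) (by linarith) (by linarith) (by linarith)
    fun s hs => hball (by rw [Real.dist_eq, abs_lt]; constructor <;> linarith [hs.1, hs.2])
  have e1 : m - (m - η) = η := by ring
  have e2 : m + η - m = η := by ring
  rw [e1, e2, div_le_div_iff_of_pos_right hη] at this
  linarith

/-- Descending induction along an interval with steps of fixed length. -/
lemma descend_of_step {Q : ℝ → Prop} {x y h : ℝ} (hh : 0 < h) (hxy : x ≤ y) (h0 : Q y)
    (hstep : ∀ z, x < z → z ≤ y → Q z → Q (max x (z - h))) : Q x := by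
  have key : ∀ k : ℕ, Q (max x (y - k * h)) := by
    intro k
    induction k with
    | zero => simpa [hxy] using h0
    | succ k ih =>
      rcases le_or_gt (y - k * h) x with hle | hlt
      · rw [max_eq_left hle] at ih
        rwa [max_eq_left]
        push_cast
        linarith
      · rw [max_eq_right hlt.le] at ih
        convert! hstep _ hlt (by have : 0 ≤ (k : ℝ) * h := by positivity
                                 linarith) ih using 2
        push_cast
        ring
  obtain ⟨k, hk⟩ := exists_nat_ge ((y - x) / h)
  rw [div_le_iff₀ hh] at hk
  have := key k
  rwa [max_eq_left (by linarith)] at this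

lemma exists_step {C r : ℝ} (hC : 0 ≤ C) (hr : 0 < r) : ∃ h, 0 < h ∧ h ≤ r ∧ 2 * h * C ≤ 1 / 2 := by
  refine ⟨min r (1 / (4 * (C + 1))), by positivity, min_le_left _ _, ?_⟩
  have h1 := min_le_right r (1 / (4 * (C + 1)))
  have h2 : 1 / (4 * (C + 1)) * (4 * (C + 1)) = 1 := by field_simp
  nlinarith [mul_le_mul_of_nonneg_right h1 hC, show 0 < 1 / (4 * (C + 1)) by positivity]

lemma IsOpen.exists_gt_mem {I : Set ℝ} (hI : IsOpen I) {x : ℝ} (hx : x ∈ I) : ∃ y ∈ I, x < y := by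
  obtain ⟨u, hu, h⟩ := exists_Ico_subset_of_mem_nhds (hI.mem_nhds hx) (exists_gt x)
  obtain ⟨y, hy⟩ := exists_between hu
  exact ⟨y, h ⟨hy.1.le, hy.2⟩, hy.1⟩

lemma IsOpen.exists_lt_mem {I : Set ℝ} (hI : IsOpen I) {x : ℝ} (hx : x ∈ I) : ∃ y ∈ I, y < x := by
  obtain ⟨l, hl, h⟩ := exists_Ioc_subset_of_mem_nhds (hI.mem_nhds hx) (exists_lt x)
  obtain ⟨y, hy⟩ := exists_between hl
  exact ⟨y, h ⟨hy.1, hy.2.le⟩, hy.2⟩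

namespace IsWeakSolKappa

variable {I : Set ℝ} {κ : Measure ℝ} {u d : ℝ → ℝ}

/-- A weak solution which is nonpositive at `x₀` and grows sublinearly towards the right end of
the interval is nonpositive to the right of `x₀`. -/
lemma nonpos_right (hI : I.OrdConnected) (hd : IsWeakSolKappa I κ d) {x₀ : ℝ} (hx₀ : x₀ ∈ I)
    (h0 : d x₀ ≤ 0) (hlim : ∀ ε > 0, ∀ x ∈ I, ∃ y ∈ I, x ≤ y ∧ d y ≤ ε * (y - x₀)) :
    ∀ x ∈ I, x₀ ≤ x → d x ≤ 0 := by
  intro x hx hxx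
  have key : ∀ ε > 0, d x ≤ ε * (x - x₀) := by
    intro ε hε
    obtain ⟨y, hy, hxy, hdy⟩ := hlim ε hε x hx
    have hsub : Icc x₀ y ⊆ I := hI.out hx₀ hy
    have := nonpos_of_slope_le_slope_of_pos (f := fun s => d s - ε * (s - x₀)) (p := x₀) (q := y)
      ((hd.continuousOn.mono hsub).sub (by fun_prop)) (by simpa using h0) (by linarith)
      (fun a m b ha ham hmb hb hpos => by
        have h1 : (0 : ℝ) < m - a := by linarith
        have h2 : (0 : ℝ) < b - m := by linarith
        have h := hd.slope_le_slope (hsub ⟨ha, by linarith⟩) (hsub ⟨by linarith, hb⟩) ham hmb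
          fun s hs => by nlinarith [hpos s hs, mul_nonneg hε.le (sub_nonneg.2 (ha.trans hs.1))]
        have e1 : (d m - ε * (m - x₀) - (d a - ε * (a - x₀))) / (m - a) =
            (d m - d a) / (m - a) - ε := by field_simp; ring
        have e2 : (d b - ε * (b - x₀) - (d m - ε * (m - x₀))) / (b - m) =
            (d b - d m) / (b - m) - ε := by field_simp; ring
        rw [e1, e2]
        linarith) x ⟨hxx, hxy⟩
    linarith
  by_contra! h
  rcases hxx.eq_or_lt with rfl | hlt
  · linarith
  · have hp : 0 < x - x₀ := sub_pos.2 hlt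
    have := key (d x / (2 * (x - x₀))) (by positivity)
    rw [div_mul_eq_mul_div, mul_div_mul_right _ _ hp.ne'] at this
    linarith

/-- Backward uniqueness: a weak solution vanishing to the right of `x₀` vanishes. -/
lemma eq_zero_of_eq_zero_right (hIo : IsOpen I) (hI : I.OrdConnected)
    (hκ : ∀ x ∈ I, ∀ y ∈ I, κ (Icc x y) < ⊤) (hd : IsWeakSolKappa I κ d) {x₀ : ℝ} (hx₀ : x₀ ∈ I)
    (h0 : ∀ x ∈ I, x₀ ≤ x → d x = 0) : ∀ x ∈ I, d x = 0 := by
  intro x hx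
  rcases le_total x₀ x with hle | hle
  · exact h0 x hx hle
  obtain ⟨c, hc, hxc⟩ := hIo.exists_gt_mem hx₀
  have hsub : Icc x c ⊆ I := hI.out hx hc
  obtain ⟨h, hh, hhc, hhC⟩ := exists_step (C := κ.real (Icc x c)) measureReal_nonneg
    (sub_pos.2 hxc)
  refine descend_of_step (Q := fun z => ∀ y ∈ Icc z c, d y = 0) hh hle
    (fun y hy => h0 y (hsub ⟨hle.trans hy.1, hy.2⟩) hy.1) (fun z hxz hz hQ => ?_) x
    ⟨le_rfl, by linarith⟩
  have hzc : z + h ≤ c := by linarith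
  have hzero : ∀ y ∈ Icc (max x (z - h)) z, d y = 0 := by
    have hne : (Icc (max x (z - h)) z).Nonempty := ⟨z, by simp [hxz.le, hh.le], le_rfl⟩
    obtain ⟨y, hy, hmax⟩ := isCompact_Icc.exists_isMaxOn hne
      (hd.continuousOn.mono fun s hs =>
        hsub ⟨(le_max_left _ _).trans hs.1, by linarith [hs.2]⟩).abs
    have hxy : x ≤ y := (le_max_left _ _).trans hy.1
    have hzy : z - h ≤ y := (le_max_right _ _).trans hy.1
    suffices hdy : |d y| ≤ 0 by
      intro s hs
      exact abs_nonpos_iff.1 ((hmax hs).trans hdy)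
    rcases hy.2.eq_or_lt with rfl | hyz
    · simp [hQ y ⟨le_rfl, by linarith⟩]
    have hzh : z < z + h := by linarith
    have heq := hd.slope_sub_slope (hsub ⟨hxy, by linarith⟩) (hsub ⟨by linarith, hzc⟩) hyz hzh
    have hfin : κ (Icc x c) < ⊤ := hκ x hx c hc
    have hle' : Icc y (z + h) ⊆ Icc x c := Icc_subset_Icc hxy hzc
    have hbd := abs_integral_tent_mul_le (u := d) (M := |d y|) hyz hzh
      ((measure_mono hle').trans_lt hfin) fun s hs => by
        rcases le_total s z with hsz | hsz
        · exact hmax ⟨hy.1.trans hs.1, hsz⟩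
        · simp [hQ s ⟨hsz, hs.2.trans hzc⟩]
    have hreal : κ.real (Icc y (z + h)) ≤ κ.real (Icc x c) := measureReal_mono hle' hfin.ne
    rw [hQ z ⟨le_rfl, by linarith⟩, hQ (z + h) ⟨hzh.le, hzc⟩] at heq
    have hp : 0 < z - y := by linarith
    have hdy : d y = (z - y) * (2 * ∫ s, tent y z (z + h) s * d s ∂κ) := by
      rw [← heq]; field_simp; ring
    have habs : |d y| = (z - y) * (2 * |∫ s, tent y z (z + h) s * d s ∂κ|) := by
      conv_lhs => rw [hdy]
      rw [abs_mul, abs_mul, abs_of_pos hp, abs_two]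
    have h1 : |d y| ≤ h * (2 * (|d y| * κ.real (Icc x c))) := by
      conv_lhs => rw [habs]
      have := hbd.trans (mul_le_mul_of_nonneg_left hreal (abs_nonneg _))
      gcongr
      linarith
    nlinarith [abs_nonneg (d y)]
  intro y hy
  rcases le_total y z with hyz | hyz
  · exact hzero y ⟨hy.1, hyz⟩
  · exact hQ y ⟨hyz, hy.2⟩

/-- A bound for a nonnegative nonincreasing weak solution on a short interval. -/
lemma le_four_mul (hI : I.OrdConnected) (hκ : ∀ x ∈ I, ∀ y ∈ I, κ (Icc x y) < ⊤)
    (hu : IsWeakSolKappa I κ u) (hpos : ∀ x ∈ I, 0 ≤ u x) (hanti : AntitoneOn u I)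
    {y z h C : ℝ} (hy : y ∈ I) (hb : z + h ∈ I) (hyz : y < z) (hzy : z - y ≤ h)
    (hC : κ.real (Icc y (z + h)) ≤ C) (hhC : 2 * h * C ≤ 1 / 2) : u y ≤ 4 * u z := by
  have hzh : z < z + h := by linarith
  have hsub : Icc y (z + h) ⊆ I := hI.out hy hb
  have hz : z ∈ I := hsub ⟨hyz.le, hzh.le⟩
  have heq := hu.slope_sub_slope hy hb hyz hzh
  have hbd := (le_abs_self _).trans (abs_integral_tent_mul_le (u := u) (M := u y) hyz hzh
    (hκ y hy _ hb) fun s hs => by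
      rw [abs_of_nonneg (hpos s (hsub hs))]
      exact hanti hy (hsub hs) hs.1)
  have hbd' := hbd.trans (mul_le_mul_of_nonneg_left hC (hpos y hy))
  have hp : 0 < z - y := by linarith
  have h0 : 0 < h := by linarith
  have hdiff : u y = u z + (z - y) * ((u z - u (z + h)) / h +
      2 * ∫ s, tent y z (z + h) s * u s ∂κ) := by
    rw [← heq, add_sub_cancel_left]; field_simp; ring
  have hJ : (u z - u (z + h)) / h ≤ u z / h := by
    gcongr
    linarith [hpos _ hb]
  have hpu := hpos y hy
  have hpz := hpos z hz
  have hC0 : 0 ≤ C := measureReal_nonneg.trans hC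
  have h1 : u y ≤ u z + h * (u z / h + 2 * (u y * C)) := by
    conv_lhs => rw [hdiff]
    have : (z - y) * ((u z - u (z + h)) / h + 2 * ∫ s, tent y z (z + h) s * u s ∂κ) ≤
        (z - y) * (u z / h + 2 * (u y * C)) := by
      gcongr
    have : (z - y) * (u z / h + 2 * (u y * C)) ≤ h * (u z / h + 2 * (u y * C)) := by
      gcongr
    linarith
  rw [mul_add, mul_div_cancel₀ _ h0.ne'] at h1
  nlinarith

/-- Positive weak solutions are Lipschitz. -/
lemma sub_le_mul (hI : I.OrdConnected) (hu : IsWeakSolKappa I κ u) (hpos : ∀ x ∈ I, 0 ≤ u x)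
    {a' a : ℝ} (ha' : a' ∈ I) (ha : a' < a) {x y : ℝ} (hy : y ∈ I)
    (hax : a ≤ x) (hxy : x ≤ y) : u x - u y ≤ u a' / (a - a') * (y - x) := by
  rcases hxy.eq_or_lt with rfl | hlt
  · simp
  have hsub : Icc a' y ⊆ I := hI.out ha' hy
  have hax' : a' < x := by linarith
  have hx : x ∈ I := hsub ⟨hax'.le, hxy⟩
  have h := hu.slope_le_slope ha' hy hax' hlt fun s hs => hpos s (hsub hs)
  have h1 : 0 < y - x := by linarith
  rw [le_div_iff₀ h1] at h
  have h2 : (u a' - u x) / (x - a') ≤ u a' / (a - a') := by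
    have := hpos x hx
    have := hpos a' ha'
    gcongr
    linarith
  have h3 : (u x - u a') / (x - a') = -((u a' - u x) / (x - a')) := by rw [← neg_div]; ring
  rw [h3] at h
  nlinarith

end IsWeakSolKappa

/-- Pointwise convergence of equi-Lipschitz functions is uniform on compact intervals. -/
lemma tendstoUniformlyOn_of_lipschitz_of_tendsto {ι : Type*} {l : Filter ι} {F : ι → ℝ → ℝ}
    {f : ℝ → ℝ} {K : Set ℝ} (hK : IsCompact K) {L : ℝ}
    (hF : ∀ n, ∀ x ∈ K, ∀ y ∈ K, |F n x - F n y| ≤ L * |x - y|)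
    (hf : ∀ x ∈ K, ∀ y ∈ K, |f x - f y| ≤ L * |x - y|)
    (hlim : ∀ x ∈ K, Tendsto (fun n => F n x) l (nhds (f x))) :
    TendstoUniformlyOn F f l K := by
  rw [← tendstoLocallyUniformlyOn_iff_tendstoUniformlyOn_of_compact hK,
    Metric.tendstoLocallyUniformlyOn_iff]
  intro ε hε x hx
  have hL : 0 < 4 * (|L| + 1) := by positivity
  refine ⟨K ∩ Metric.ball x (ε / (4 * (|L| + 1))),
    inter_mem_nhdsWithin K (Metric.ball_mem_nhds _ (by positivity)), ?_⟩
  filter_upwards [Metric.tendsto_nhds.1 (hlim x hx) (ε / 4) (by positivity)] with n hn y hy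
  have hy1 := hy.2
  rw [Metric.mem_ball, Real.dist_eq, lt_div_iff₀ hL] at hy1
  have hLy : L * |y - x| ≤ ε / 4 := by
    nlinarith [le_abs_self L, abs_nonneg (y - x), abs_nonneg L]
  have h1 := (hf y hy.1 x hx).trans hLy
  have h2 := (hF n y hy.1 x hx).trans hLy
  rw [Real.dist_eq] at hn ⊢
  rw [abs_le] at h1 h2
  rw [abs_lt] at hn ⊢
  constructor <;> linarith [h1.1, h1.2, h2.1, h2.2, hn.1, hn.2]

/-- Vaguely convergent sequences of measures are bounded on compact intervals. -/
lemma exists_forall_measureReal_Icc_le {I : Set ℝ} (hIo : IsOpen I) (hI : I.OrdConnected)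
    {κs : ℕ → Measure ℝ} {κ : Measure ℝ}
    (hκs : ∀ n, ∀ x ∈ I, ∀ y ∈ I, κs n (Icc x y) < ⊤)
    (hvague : ∀ φ : ℝ → ℝ, Continuous φ → HasCompactSupport φ → tsupport φ ⊆ I →
      Tendsto (fun n => ∫ x, φ x ∂(κs n)) atTop (nhds (∫ x, φ x ∂κ)))
    {a b : ℝ} (ha : a ∈ I) (hb : b ∈ I) : ∃ C, ∀ n, (κs n).real (Icc a b) ≤ C := by
  obtain ⟨a', ha', haa⟩ := hIo.exists_lt_mem ha
  obtain ⟨b', hb', hbb⟩ := hIo.exists_gt_mem hb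
  obtain ⟨f, hf1, hf0, hfc, hf⟩ := exists_continuous_one_zero_of_isCompact
    (isCompact_Icc (a := a) (b := b)) (isOpen_Ioo (a := a') (b := b')).isClosed_compl
    (disjoint_compl_right_iff_subset.2 (Icc_subset_Ioo haa hbb))
  have hsupp : Function.support f ⊆ Icc a' b' := fun x hx => by
    by_contra h
    exact hx (hf0 fun h' => h (Ioo_subset_Icc_self h'))
  have hts : tsupport f ⊆ I := (closure_minimal hsupp isClosed_Icc).trans (hI.out ha' hb')
  obtain ⟨C, hC⟩ := (hvague f f.continuous hfc hts).bddAbove_range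
  refine ⟨C, fun n => le_trans ?_ (hC ⟨n, rfl⟩)⟩
  have hint : Integrable f (κs n) :=
    (integrableOn_iff_integrable_of_support_subset hsupp).1
      (f.continuous.continuousOn.integrableOn_Icc_of_measure_lt_top (hκs n a' ha' b' hb'))
  calc (κs n).real (Icc a b) = ∫ x in Icc a b, f x ∂(κs n) := by
        rw [setIntegral_congr_fun measurableSet_Icc hf1]; simp
    _ ≤ ∫ x, f x ∂(κs n) := setIntegral_le_integral hint (.of_forall fun x => (hf x).1)

namespace IsWeakSolKappa

variable {I : Set ℝ} {κs : ℕ → Measure ℝ} {κ : Measure ℝ} {us : ℕ → ℝ → ℝ} {u v w : ℝ → ℝ}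

/-- Locally uniform limits of weak solutions along vaguely convergent measures are weak
solutions. -/
lemma of_tendsto (hIo : IsOpen I) (hI : I.OrdConnected) {l : Filter ℕ} [l.NeBot]
    (hκs : ∀ n, ∀ x ∈ I, ∀ y ∈ I, κs n (Icc x y) < ⊤)
    (hbdd : ∀ x ∈ I, ∀ y ∈ I, ∃ C, ∀ n, (κs n).real (Icc x y) ≤ C)
    (hvague : ∀ φ : ℝ → ℝ, Continuous φ → HasCompactSupport φ → tsupport φ ⊆ I →
      Tendsto (fun n => ∫ x, φ x ∂(κs n)) l (nhds (∫ x, φ x ∂κ)))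
    (hus : ∀ n, IsWeakSolKappa I (κs n) (us n))
    (hlim : ∀ x ∈ I, ∀ y ∈ I, TendstoUniformlyOn us w l (Icc x y)) : IsWeakSolKappa I κ w := by
  have hcont : ∀ a ∈ I, ∀ b ∈ I, ContinuousOn w (Icc a b) := fun a ha b hb =>
    (hlim a ha b hb).continuousOn
      (.of_forall fun n => (hus n).continuousOn.mono (hI.out ha hb))
  refine ⟨fun x hx => ?_, fun a ha b hb m ham hmb => ?_⟩
  · obtain ⟨a, ha, hax⟩ := hIo.exists_lt_mem hx
    obtain ⟨b, hb, hxb⟩ := hIo.exists_gt_mem hx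
    exact ((hcont a ha b hb).continuousAt (Icc_mem_nhds hax hxb)).continuousWithinAt
  have hw := hcont a ha b hb
  have hsub : Icc a b ⊆ I := hI.out ha hb
  have hpt : ∀ x ∈ Icc a b, Tendsto (fun n => us n x) l (nhds (w x)) :=
    fun x hx => (hlim a ha b hb).tendsto_at hx
  have hab : a ≤ b := by linarith
  have h1 : Tendsto (fun n => (us n b - us n m) / (b - m) - (us n m - us n a) / (m - a)) l
      (nhds ((w b - w m) / (b - m) - (w m - w a) / (m - a))) :=
    (((hpt b ⟨hab, le_rfl⟩).sub (hpt m ⟨ham.le, hmb.le⟩)).div_const _).sub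
      (((hpt m ⟨ham.le, hmb.le⟩).sub (hpt a ⟨le_rfl, hab⟩)).div_const _)
  have hsupp : Function.support (fun s => tent a m b s * w s) ⊆ Icc a b := fun s hs => by
    by_contra h
    exact hs (by simp [tent_of_notMem ham hmb fun h' => h (Ioo_subset_Icc_self h')])
  have h2 := hvague _ (continuous_tent_mul ham hmb hw)
    (HasCompactSupport.of_support_subset_isCompact isCompact_Icc hsupp)
    ((closure_minimal hsupp isClosed_Icc).trans hsub)
  have h3 : Tendsto (fun n => ∫ s, tent a m b s * us n s ∂(κs n) -
      ∫ s, tent a m b s * w s ∂(κs n)) l (nhds 0) := by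
    obtain ⟨C, hC⟩ := hbdd a ha b hb
    have hC0 : 0 ≤ C := measureReal_nonneg.trans (hC 0)
    rw [Metric.tendsto_nhds]
    intro ε hε
    filter_upwards [Metric.tendstoUniformlyOn_iff.1 (hlim a ha b hb) (ε / (C + 1))
      (by positivity)] with n hn
    have hfin := hκs n a ha b hb
    rw [Real.dist_eq, sub_zero, ← integral_sub
      (integrable_tent_mul ham hmb hfin ((hus n).continuousOn.mono hsub))
      (integrable_tent_mul ham hmb hfin hw)]
    simp only [← mul_sub]
    have := abs_integral_tent_mul_le (u := fun s => us n s - w s) (M := ε / (C + 1)) ham hmb hfin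
      fun s hs => by
        have := hn s hs
        rw [dist_comm, Real.dist_eq] at this
        exact this.le
    refine this.trans_lt ?_
    calc ε / (C + 1) * (κs n).real (Icc a b) ≤ ε / (C + 1) * C := by
          gcongr
          exact hC n
      _ < ε / (C + 1) * (C + 1) := by gcongr; linarith
      _ = ε := by field_simp
  have h4 : Tendsto (fun n => 2 * ∫ s, tent a m b s * us n s ∂(κs n)) l
      (nhds (2 * ∫ s, tent a m b s * w s ∂κ)) := by
    simpa using (h3.add h2).const_mul 2
  simp only [← (hus _).slope_sub_slope ha hb ham hmb] at h4
  exact tendsto_nhds_unique h1 h4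

/-- A nonincreasing weak solution vanishing at the right end of the interval lies below the
chord. -/
lemma le_chord (hI : I.OrdConnected) (hu : IsWeakSolKappa I κ u) (hpos : ∀ x ∈ I, 0 ≤ u x)
    (hanti : AntitoneOn u I) {x₀ : ℝ} (hx₀ : x₀ ∈ I) (hnorm : u x₀ = 1) {b : ℝ}
    (hb : ∀ x ∈ I, x < b) (hvan : ∀ ε > 0, ∃ y ∈ I, u y < ε) :
    ∀ x ∈ I, x₀ ≤ x → u x ≤ (b - x) / (b - x₀) := by
  intro x hx hxx
  have hbx := hb x hx
  have hb0 := hb x₀ hx₀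
  refine le_of_forall_pos_le_add fun ε hε => ?_
  have hchord : 0 ≤ (b - x) / (b - x₀) := div_nonneg (by linarith) (by linarith)
  obtain ⟨y, hy, hyε⟩ := hvan ε hε
  rcases le_or_gt y x with hyx | hxy
  · linarith [hanti hy hx hyx]
  rcases hxx.eq_or_lt with rfl | hlt
  · rw [div_self (by linarith), hnorm]
    linarith
  have h := hu.slope_le_slope hx₀ hy hlt hxy fun s hs => hpos s (hI.out hx₀ hy hs)
  have hby := hb y hy
  have p1 : 0 < x - x₀ := by linarith
  have p2 : 0 < y - x := by linarith
  have p3 : 0 < y - x₀ := by linarith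
  have p4 : 0 < b - x₀ := by linarith
  rw [hnorm, div_le_div_iff₀ p1 p2] at h
  have h1 : u x ≤ (y - x) / (y - x₀) + ε := by
    rw [← sub_le_iff_le_add, le_div_iff₀ p3]
    nlinarith
  have h2 : (y - x) / (y - x₀) ≤ (b - x) / (b - x₀) := by
    rw [div_le_div_iff₀ p3 p4]
    nlinarith
  linarith

/-- Uniqueness of the normalized bounded nonnegative weak solution which lies below the chord. -/
lemma eq_of_le_chord (hIo : IsOpen I) (hI : I.OrdConnected)
    (hκ : ∀ x ∈ I, ∀ y ∈ I, κ (Icc x y) < ⊤) (hu : IsWeakSolKappa I κ u)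
    (hv : IsWeakSolKappa I κ v) {x₀ : ℝ} (hx₀ : x₀ ∈ I) (huv : u x₀ = v x₀)
    (hu1 : ∀ x ∈ I, x₀ ≤ x → u x ∈ Icc 0 1) (hv1 : ∀ x ∈ I, x₀ ≤ x → v x ∈ Icc 0 1)
    (huc : BddAbove I → ∀ x ∈ I, x₀ ≤ x → u x ≤ (sSup I - x) / (sSup I - x₀))
    (hvc : BddAbove I → ∀ x ∈ I, x₀ ≤ x → v x ≤ (sSup I - x) / (sSup I - x₀)) :
    ∀ x ∈ I, u x = v x := by
  have key : ∀ ε > 0, ∀ x ∈ I, ∃ y ∈ I, x ≤ y ∧ |u y - v y| ≤ ε * (y - x₀) := by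
    intro ε hε x hx
    by_cases hbd : BddAbove I
    · have hlt : ∀ y ∈ I, y < sSup I := fun y hy => by
        obtain ⟨z, hz, hyz⟩ := hIo.exists_gt_mem hy
        exact hyz.trans_le (le_csSup hbd hz)
      set b := sSup I with hb
      have hb0 : 0 < b - x₀ := sub_pos.2 (hlt x₀ hx₀)
      have hmax : max x (max ((x₀ + b) / 2) (b - ε * (b - x₀) ^ 2 / 2)) < sSup I := by
        refine max_lt (hlt x hx) (max_lt ?_ ?_)
        · linarith
        · have : 0 < ε * (b - x₀) ^ 2 / 2 := by positivity
          linarith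
      obtain ⟨y, hy, hymax⟩ := exists_lt_of_lt_csSup ⟨x, hx⟩ hmax
      simp only [max_lt_iff] at hymax
      obtain ⟨h1, h2, h3⟩ := hymax
      have hxy : x₀ ≤ y := by linarith
      refine ⟨y, hy, h1.le, ?_⟩
      have hle : (b - y) / (b - x₀) ≤ ε * (y - x₀) := by
        rw [div_le_iff₀ hb0]
        nlinarith [mul_pos hε hb0]
      have := huc hbd y hy hxy
      have := hvc hbd y hy hxy
      have := (hu1 y hy hxy).1
      have := (hv1 y hy hxy).1
      rw [abs_le]
      constructor <;> linarith
    · rw [not_bddAbove_iff] at hbd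
      obtain ⟨y, hy, hymax⟩ := hbd (max x (x₀ + 1 / ε))
      simp only [max_lt_iff] at hymax
      have hpos : 0 < 1 / ε := by positivity
      refine ⟨y, hy, hymax.1.le, ?_⟩
      have hxy : x₀ ≤ y := by linarith
      have h1 : 1 ≤ ε * (y - x₀) := by
        rw [← div_le_iff₀' hε]
        linarith
      have := hu1 y hy hxy
      have := hv1 y hy hxy
      rw [abs_le]
      constructor <;> linarith [(hu1 y hy hxy).1, (hu1 y hy hxy).2, (hv1 y hy hxy).1,
        (hv1 y hy hxy).2]
  have h1 := (hu.sub hI hκ hv).nonpos_right hI hx₀ (by simp [huv]) fun ε hε x hx => by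
    obtain ⟨y, hy, hxy, h⟩ := key ε hε x hx
    exact ⟨y, hy, hxy, (le_abs_self _).trans h⟩
  have h2 := (hv.sub hI hκ hu).nonpos_right hI hx₀ (by simp [huv]) fun ε hε x hx => by
    obtain ⟨y, hy, hxy, h⟩ := key ε hε x hx
    exact ⟨y, hy, hxy, (le_abs_self _).trans (by rwa [abs_sub_comm])⟩
  have h3 := (hu.sub hI hκ hv).eq_zero_of_eq_zero_right hIo hI hκ hx₀ fun x hx hxx => by
    linarith [h1 x hx hxx, h2 x hx hxx]
  exact fun x hx => sub_eq_zero.1 (h3 x hx)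

/-- Nonnegative normalized nonincreasing weak solutions are locally bounded, uniformly over a
locally bounded family of measures. -/
lemma exists_forall_le (hIo : IsOpen I) (hI : I.OrdConnected)
    (hκs : ∀ n, ∀ x ∈ I, ∀ y ∈ I, κs n (Icc x y) < ⊤)
    (hbdd : ∀ x ∈ I, ∀ y ∈ I, ∃ C, ∀ n, (κs n).real (Icc x y) ≤ C)
    (hus : ∀ n, IsWeakSolKappa I (κs n) (us n)) (hpos : ∀ n, ∀ x ∈ I, 0 ≤ us n x)
    (hanti : ∀ n, AntitoneOn (us n) I) {x₀ : ℝ} (hx₀ : x₀ ∈ I) (hnorm : ∀ n, us n x₀ = 1)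
    {x : ℝ} (hx : x ∈ I) : ∃ B, ∀ n, us n x ≤ B := by
  rcases le_total x₀ x with hle | hle
  · exact ⟨1, fun n => (hanti n hx₀ hx hle).trans (hnorm n).le⟩
  obtain ⟨c, hc, hxc⟩ := hIo.exists_gt_mem hx₀
  obtain ⟨C, hC⟩ := hbdd x hx c hc
  obtain ⟨h, hh, hhc, hhC⟩ := exists_step (measureReal_nonneg.trans (hC 0)) (sub_pos.2 hxc)
  refine descend_of_step (Q := fun z => ∃ B, ∀ n, us n z ≤ B) hh hle
    ⟨1, fun n => (hnorm n).le⟩ ?_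
  rintro z hxz hz ⟨B, hB⟩
  have hzc : z + h ≤ c := by linarith
  have hy : max x (z - h) ∈ Icc x c :=
    ⟨le_max_left _ _, max_le (by linarith) (by linarith)⟩
  refine ⟨4 * B, fun n => ((hus n).le_four_mul hI (hκs n) (hpos n) (hanti n) (hI.out hx hc hy)
    (hI.out hx hc ⟨by linarith, hzc⟩) (max_lt hxz (by linarith))
    (by linarith [le_max_right x (z - h)]) ((measureReal_mono (Icc_subset_Icc hy.1 hzc)
    (hκs n x hx c hc).ne).trans (hC n)) hhC).trans ?_⟩
  linarith [hB n]

/-- Continuity in the measure of the normalized nonincreasing minimal weak solutions. -/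
theorem tendstoUniformlyOn (hIo : IsOpen I) (hI : I.OrdConnected) {x₀ : ℝ} (hx₀ : x₀ ∈ I)
    (hκs : ∀ n, ∀ x ∈ I, ∀ y ∈ I, κs n (Icc x y) < ⊤)
    (hκ : ∀ x ∈ I, ∀ y ∈ I, κ (Icc x y) < ⊤)
    (hvague : ∀ φ : ℝ → ℝ, Continuous φ → HasCompactSupport φ → tsupport φ ⊆ I →
      Tendsto (fun n => ∫ x, φ x ∂(κs n)) atTop (nhds (∫ x, φ x ∂κ)))
    (hus : ∀ n, IsWeakSolKappa I (κs n) (us n)) (huspos : ∀ n, ∀ x ∈ I, 0 ≤ us n x)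
    (husanti : ∀ n, AntitoneOn (us n) I) (husnorm : ∀ n, us n x₀ = 1)
    (husvan : BddAbove I → ∀ n, ∀ ε > 0, ∃ y ∈ I, us n y < ε)
    (hu : IsWeakSolKappa I κ u) (hupos : ∀ x ∈ I, 0 ≤ u x)
    (huanti : AntitoneOn u I) (hunorm : u x₀ = 1)
    (huvan : BddAbove I → ∀ ε > 0, ∃ y ∈ I, u y < ε)
    {K : Set ℝ} (hKI : K ⊆ I) (hK : IsCompact K) : TendstoUniformlyOn us u atTop K := by
  have hbdd : ∀ x ∈ I, ∀ y ∈ I, ∃ C, ∀ n, (κs n).real (Icc x y) ≤ C := fun x hx y hy =>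
    exists_forall_measureReal_Icc_le hIo hI hκs hvague hx hy
  have hlt : BddAbove I → ∀ y ∈ I, y < sSup I := fun hbd y hy => by
    obtain ⟨z, hz, hyz⟩ := hIo.exists_gt_mem hy
    exact hyz.trans_le (le_csSup hbd hz)
  have hB : ∀ x ∈ I, ∃ B, ∀ n, us n x ≤ B := fun x hx =>
    exists_forall_le hIo hI hκs hbdd hus huspos husanti hx₀ husnorm hx
  have hLip : ∀ a ∈ I, ∃ L, ∀ n, ∀ x ∈ I, ∀ y ∈ I, a ≤ x → a ≤ y →
      |us n x - us n y| ≤ L * |x - y| := by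
    intro a ha
    obtain ⟨a', ha', haa⟩ := hIo.exists_lt_mem ha
    obtain ⟨B, hB⟩ := hB a' ha'
    have hp : 0 < a - a' := sub_pos.2 haa
    have hle : ∀ n, ∀ x ∈ I, ∀ y ∈ I, a ≤ x → x ≤ y →
        |us n x - us n y| ≤ B / (a - a') * |x - y| := by
      intro n x hx y hy hax hxy
      rw [abs_of_nonneg (sub_nonneg.2 (husanti n hx hy hxy)), abs_sub_comm,
        abs_of_nonneg (sub_nonneg.2 hxy)]
      refine ((hus n).sub_le_mul hI (huspos n) ha' haa hy hax hxy).trans ?_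
      have := hB n
      have : 0 ≤ y - x := sub_nonneg.2 hxy
      gcongr
    refine ⟨B / (a - a'), fun n x hx y hy hax hay => ?_⟩
    rcases le_total x y with hxy | hyx
    · exact hle n x hx y hy hax hxy
    · rw [abs_sub_comm, abs_sub_comm x]
      exact hle n y hy x hx hay hyx
  have hunif : ∀ (l : Filter ℕ) [l.NeBot] (w : ℝ → ℝ),
      (∀ x ∈ I, Tendsto (fun n => us n x) l (nhds (w x))) →
      ∀ a ∈ I, ∀ b ∈ I, TendstoUniformlyOn us w l (Icc a b) := by
    intro l _ w hw a ha b hb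
    obtain ⟨L, hL⟩ := hLip a ha
    have hsub : Icc a b ⊆ I := hI.out ha hb
    refine tendstoUniformlyOn_of_lipschitz_of_tendsto isCompact_Icc
      (fun n x hx y hy => hL n x (hsub hx) y (hsub hy) hx.1 hy.1) (fun x hx y hy => ?_)
      fun x hx => hw x (hsub hx)
    exact le_of_tendsto ((hw x (hsub hx)).sub (hw y (hsub hy))).abs
      (.of_forall fun n => hL n x (hsub hx) y (hsub hy) hx.1 hy.1)
  have hpt : ∀ x ∈ I, Tendsto (fun n => us n x) atTop (nhds (u x)) := by
    intro x hx
    rw [tendsto_iff_ultrafilter]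
    intro F hF
    have hex : ∀ y, ∃ c, y ∈ I → Tendsto (fun n => us n y) F (nhds c) := by
      intro y
      by_cases hy : y ∈ I
      · obtain ⟨B, hB⟩ := hB y hy
        obtain ⟨c, -, hc⟩ := (isCompact_Icc (a := 0) (b := B)).ultrafilter_le_nhds
          (F.map fun n => us n y)
          (le_principal_iff.2 (mem_map.2 (univ_mem' fun n => ⟨huspos n y hy, hB n⟩)))
        exact ⟨c, fun _ => hc⟩
      · exact ⟨0, fun h => absurd h hy⟩
    choose w hw using hex
    have hwsol : IsWeakSolKappa I κ w := of_tendsto (l := (F : Filter ℕ)) hIo hI hκs hbdd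
      (fun φ h1 h2 h3 => (hvague φ h1 h2 h3).mono_left hF) hus (hunif F w hw)
    have heq : w x = u x := eq_of_le_chord hIo hI hκ hwsol hu hx₀
      (by
        rw [hunorm]
        exact tendsto_nhds_unique (hw x₀ hx₀) (by simp only [husnorm]; exact tendsto_const_nhds))
      (fun y hy hxy => ⟨ge_of_tendsto (hw y hy) (.of_forall fun n => huspos n y hy),
        le_of_tendsto (hw y hy)
          (.of_forall fun n => (husanti n hx₀ hy hxy).trans (husnorm n).le)⟩)
      (fun y hy hxy => ⟨hupos y hy, (huanti hx₀ hy hxy).trans hunorm.le⟩)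
      (fun hbd y hy hxy => le_of_tendsto (hw y hy) (.of_forall fun n =>
        (hus n).le_chord hI (huspos n) (husanti n) hx₀ (husnorm n) (hlt hbd) (husvan hbd n)
          y hy hxy))
      (fun hbd => hu.le_chord hI hupos huanti hx₀ hunorm (hlt hbd) (huvan hbd)) x hx
    exact heq ▸ hw x hx
  rcases K.eq_empty_or_nonempty with rfl | hne
  · exact tendstoUniformlyOn_empty
  obtain ⟨a, ha⟩ := hK.exists_isLeast hne
  obtain ⟨b, hb⟩ := hK.exists_isGreatest hne
  exact (hunif atTop u hpt a (hKI ha.1) b (hKI hb.1)).mono fun x hx => ⟨ha.2 hx, hb.2 hx⟩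

end IsWeakSolKappa

/-- Integration by parts for a Stieltjes integral against a continuously differentiable
function. -/
lemma setIntegral_mul_intervalIntegral {κ : Measure ℝ} {x y : ℝ} {u p : ℝ → ℝ} (hxy : x ≤ y)
    (hκ : κ (Icc x y) < ⊤) (hu : ContinuousOn u (Icc x y)) (hp : ContinuousOn p (Icc x y)) :
    ∫ s in Ioc x y, u s * (∫ t in x..s, p t) ∂κ =
      ∫ t in x..y, p t * ∫ s in Ioc t y, u s ∂κ := by
  have : IsFiniteMeasure (κ.restrict (Ioc x y)) :=
    ⟨by rw [Measure.restrict_apply_univ]; exact (measure_mono Ioc_subset_Icc_self).trans_lt hκ⟩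
  have hui : Integrable u (κ.restrict (Ioc x y)) :=
    (hu.integrableOn_Icc_of_measure_lt_top hκ).mono_set Ioc_subset_Icc_self
  have hpi : Integrable p (volume.restrict (Ioc x y)) :=
    (hp.integrableOn_Icc).mono_set Ioc_subset_Icc_self
  have hmeas : MeasurableSet {z : ℝ × ℝ | z.2 < z.1} := measurableSet_lt measurable_snd measurable_fst
  have hswap := integral_integral_swap (μ := κ.restrict (Ioc x y)) (ν := volume.restrict (Ioc x y))
    (f := fun s t => {z : ℝ × ℝ | z.2 < z.1}.indicator (fun z => u z.1 * p z.2) (s, t))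
    ((hui.mul_prod hpi).indicator hmeas)
  have hl : ∀ s ∈ Ioc x y, ∫ t in Ioc x y,
      {z : ℝ × ℝ | z.2 < z.1}.indicator (fun z => u z.1 * p z.2) (s, t) =
        u s * ∫ t in x..s, p t := by
    intro s hs
    have h1 : (fun t => {z : ℝ × ℝ | z.2 < z.1}.indicator (fun z => u z.1 * p z.2) (s, t)) =
        (Iio s).indicator fun t => u s * p t := rfl
    have h2 : Ioc x y ∩ Iio s = Ioo x s := by
      ext t
      simp only [mem_inter_iff, mem_Ioc, mem_Iio, mem_Ioo]
      exact ⟨fun h => ⟨h.1.1, h.2⟩, fun h => ⟨⟨h.1, h.2.le.trans hs.2⟩, h.2⟩⟩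
    rw [h1, setIntegral_indicator measurableSet_Iio, h2, integral_const_mul,
      ← integral_Ioc_eq_integral_Ioo, intervalIntegral.integral_of_le hs.1.le]
  have hr : ∀ t ∈ Ioc x y, ∫ s in Ioc x y,
      {z : ℝ × ℝ | z.2 < z.1}.indicator (fun z => u z.1 * p z.2) (s, t) ∂κ =
        p t * ∫ s in Ioc t y, u s ∂κ := by
    intro t ht
    have h1 : (fun s => {z : ℝ × ℝ | z.2 < z.1}.indicator (fun z => u z.1 * p z.2) (s, t)) =
        (Ioi t).indicator fun s => u s * p t := rfl
    have h2 : Ioc x y ∩ Ioi t = Ioc t y := by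
      ext s
      simp only [mem_inter_iff, mem_Ioc, mem_Ioi]
      exact ⟨fun h => ⟨h.2, h.1.2⟩, fun h => ⟨⟨ht.1.trans h.1, h.2⟩, h.1⟩⟩
    rw [h1, setIntegral_indicator measurableSet_Ioi, h2, integral_mul_const, mul_comm]
  rw [setIntegral_congr_fun measurableSet_Ioc hl, setIntegral_congr_fun measurableSet_Ioc hr]
    at hswap
  rw [hswap, intervalIntegral.integral_of_le hxy]

namespace IsSolKappa

variable {I : Set ℝ} {κ : Measure ℝ} {u g : ℝ → ℝ}

lemma continuousOn (hu : IsSolKappa I κ u g) : ContinuousOn u I := hu.1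

lemma continuousWithinAt (hu : IsSolKappa I κ u g) {x : ℝ} (hx : x ∈ I) :
    ContinuousWithinAt g (Ici x) x := hu.2.1 x hx

lemma sub_eq_intervalIntegral (hu : IsSolKappa I κ u g) {x y : ℝ} (hx : x ∈ I) (hy : y ∈ I) :
    u y - u x = ∫ t in x..y, g t := by
  rw [hu.2.2.1 x hx y hy, add_sub_cancel_left]

lemma sub_eq_setIntegral (hu : IsSolKappa I κ u g) {x y : ℝ} (hx : x ∈ I) (hy : y ∈ I)
    (hxy : x ≤ y) : g y - g x = 2 * ∫ t in Ioc x y, u t ∂κ := hu.2.2.2 x hx y hy hxy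

lemma monotoneOn (hI : I.OrdConnected) (hu : IsSolKappa I κ u g) (hpos : ∀ x ∈ I, 0 ≤ u x) :
    MonotoneOn g I := by
  intro x hx y hy hxy
  have h := hu.sub_eq_setIntegral hx hy hxy
  have : 0 ≤ ∫ t in Ioc x y, u t ∂κ := setIntegral_nonneg measurableSet_Ioc fun t ht =>
    hpos t (hI.out hx hy (Ioc_subset_Icc_self ht))
  linarith

lemma intervalIntegrable (hI : I.OrdConnected) (hu : IsSolKappa I κ u g)
    (hpos : ∀ x ∈ I, 0 ≤ u x) {x y : ℝ} (hx : x ∈ I) (hy : y ∈ I) :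
    IntervalIntegrable g volume x y :=
  ((hu.monotoneOn hI hpos).mono (hI.uIcc_subset hx hy)).intervalIntegrable

lemma hasDerivWithinAt (hIo : IsOpen I) (hI : I.OrdConnected) (hu : IsSolKappa I κ u g)
    (hpos : ∀ x ∈ I, 0 ≤ u x) {x : ℝ} (hx : x ∈ I) : HasDerivWithinAt u (g x) (Ioi x) x := by
  have hmeas : StronglyMeasurableAtFilter g (nhdsWithin x (Ioi x)) volume :=
    ⟨I, mem_nhdsWithin_of_mem_nhds (hIo.mem_nhds hx),
      (aemeasurable_restrict_of_monotoneOn hIo.measurableSet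
        (hu.monotoneOn hI hpos)).aestronglyMeasurable⟩
  have h := intervalIntegral.integral_hasDerivWithinAt_right
    (hu.intervalIntegrable hI hpos hx hx) (s := Ici x) (t := Ioi x) hmeas
    ((hu.continuousWithinAt hx).mono Ioi_subset_Ici_self)
  have h' := (h.const_add (u x)).mono Ioi_subset_Ici_self
  refine h'.congr_of_eventuallyEq ?_ (hu.2.2.1 x hx x hx)
  filter_upwards [mem_nhdsWithin_of_mem_nhds (hIo.mem_nhds hx)] with y hy
  exact hu.2.2.1 x hx y hy

/-- Nonnegative solutions are weak solutions. -/
lemma isWeakSolKappa (hI : I.OrdConnected) (hκ : ∀ x ∈ I, ∀ y ∈ I, κ (Icc x y) < ⊤)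
    (hu : IsSolKappa I κ u g) (hpos : ∀ x ∈ I, 0 ≤ u x) : IsWeakSolKappa I κ u where
  continuousOn := hu.continuousOn
  slope_sub_slope a ha b hb m ham hmb := by
    have hm : m ∈ I := hI.out ha hb ⟨ham.le, hmb.le⟩
    have hmoment : ∀ x ∈ I, ∀ y ∈ I, x ≤ y → 2 * ∫ s in Ioc x y, u s * (s - x) ∂κ =
        (y - x) * g y - (u y - u x) := by
      intro x hx y hy hxy
      have hsub := hI.out hx hy
      have h := setIntegral_mul_intervalIntegral hxy (hκ x hx y hy)
        (hu.continuousOn.mono hsub) (continuousOn_const (c := (1 : ℝ)))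
      simp only [intervalIntegral.integral_const, smul_eq_mul, mul_one, one_mul] at h
      rw [h, ← intervalIntegral.integral_const_mul, hu.sub_eq_intervalIntegral hx hy]
      have h2 : ∫ t in x..y, 2 * ∫ s in Ioc t y, u s ∂κ = ∫ t in x..y, (g y - g t) := by
        refine intervalIntegral.integral_congr fun t ht => ?_
        rw [uIcc_of_le hxy] at ht
        exact (hu.sub_eq_setIntegral (hsub ht) hy ht.2).symm
      rw [h2, intervalIntegral.integral_sub intervalIntegrable_const
        (hu.intervalIntegrable hI hpos hx hy), intervalIntegral.integral_const, smul_eq_mul]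
    have h1 : 0 < m - a := sub_pos.2 ham
    have h2 : 0 < b - m := sub_pos.2 hmb
    have hT : IntegrableOn (fun s => tent a m b s * u s) (Icc a b) κ :=
      ((continuous_tent_mul ham hmb
        (hu.continuousOn.mono (hI.out ha hb))).continuousOn.integrableOn_Icc_of_measure_lt_top
        (hκ a ha b hb))
    have hul : IntegrableOn u (Icc m b) κ :=
      (hu.continuousOn.mono (hI.out hm hb)).integrableOn_Icc_of_measure_lt_top (hκ m hm b hb)
    have husl : IntegrableOn (fun s => u s * (s - m)) (Icc m b) κ :=
      ((hu.continuousOn.mono (hI.out hm hb)).mul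
        (by fun_prop)).integrableOn_Icc_of_measure_lt_top (hκ m hm b hb)
    have hsplit : ∫ s, tent a m b s * u s ∂κ =
        ∫ s in Ioc a m, tent a m b s * u s ∂κ + ∫ s in Ioc m b, tent a m b s * u s ∂κ := by
      rw [← setIntegral_union (Ioc_disjoint_Ioc_of_le le_rfl) measurableSet_Ioc
        (hT.mono_set (Ioc_subset_Icc_self.trans (Icc_subset_Icc_right hmb.le)))
        (hT.mono_set (Ioc_subset_Icc_self.trans (Icc_subset_Icc_left ham.le))),
        Ioc_union_Ioc_eq_Ioc ham.le hmb.le]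
      refine (setIntegral_eq_integral_of_forall_compl_eq_zero fun s hs => ?_).symm
      rw [tent_of_notMem ham hmb fun h => hs (Ioo_subset_Ioc_self h), zero_mul]
    have hleft : ∫ s in Ioc a m, tent a m b s * u s ∂κ =
        (∫ s in Ioc a m, u s * (s - a) ∂κ) / (m - a) := by
      rw [← integral_div]
      refine setIntegral_congr_fun measurableSet_Ioc fun s hs => ?_
      rw [tent_of_le ham hmb hs.1.le hs.2]
      ring
    have hright : ∫ s in Ioc m b, tent a m b s * u s ∂κ =
        ((b - m) * ∫ s in Ioc m b, u s ∂κ - ∫ s in Ioc m b, u s * (s - m) ∂κ) / (b - m) := by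
      rw [← integral_const_mul, ← integral_sub
        ((hul.mono_set Ioc_subset_Icc_self).const_mul _) (husl.mono_set Ioc_subset_Icc_self),
        ← integral_div]
      refine setIntegral_congr_fun measurableSet_Ioc fun s hs => ?_
      rw [tent_of_ge ham hmb hs.1.le hs.2]
      ring
    have e1 := hmoment a ha m hm ham.le
    have e2 := hmoment m hm b hb hmb.le
    have e3 := hu.sub_eq_setIntegral hm hb hmb.le
    rw [hsplit, hleft, hright]
    have e1' : ∫ s in Ioc a m, u s * (s - a) ∂κ = ((m - a) * g m - (u m - u a)) / 2 := by linarith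
    have e2' : ∫ s in Ioc m b, u s * (s - m) ∂κ = ((b - m) * g b - (u b - u m)) / 2 := by linarith
    have e3' : ∫ s in Ioc m b, u s ∂κ = (g b - g m) / 2 := by linarith
    rw [e1', e2', e3']
    field_simp
    ring

/-- Reduction of order: solutions obtained from a positive solution. -/
lemma mul_one_sub_intervalIntegral (hIo : IsOpen I) (hI : I.OrdConnected)
    (hκ : ∀ x ∈ I, ∀ y ∈ I, κ (Icc x y) < ⊤)
    (hu : IsSolKappa I κ u g) (hpos : ∀ x ∈ I, 0 < u x) {x₀ : ℝ} (hx₀ : x₀ ∈ I) (c : ℝ) :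
    IsSolKappa I κ (fun x => u x * (1 - c * ∫ t in x₀..x, (u t ^ 2)⁻¹))
      (fun x => g x * (1 - c * ∫ t in x₀..x, (u t ^ 2)⁻¹) - c * (u x)⁻¹) := by
  have hpos' : ∀ x ∈ I, 0 ≤ u x := fun x hx => (hpos x hx).le
  have hne : ∀ x ∈ I, u x ≠ 0 := fun x hx => (hpos x hx).ne'
  have hq : ContinuousOn (fun t => (u t ^ 2)⁻¹) I :=
    (hu.continuousOn.pow 2).inv₀ fun x hx => pow_ne_zero 2 (hne x hx)
  have hqi : ∀ x ∈ I, ∀ y ∈ I, IntervalIntegrable (fun t => (u t ^ 2)⁻¹) volume x y :=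
    fun x hx y hy => (hq.mono (hI.uIcc_subset hx hy)).intervalIntegrable
  set P : ℝ → ℝ := fun x => 1 - c * ∫ t in x₀..x, (u t ^ 2)⁻¹ with hP
  have hPd : ∀ x ∈ I, HasDerivAt P (-(c * (u x ^ 2)⁻¹)) x := by
    intro x hx
    have h := intervalIntegral.integral_hasDerivAt_right (hqi x₀ hx₀ x hx)
      (hq.stronglyMeasurableAtFilter hIo x hx) (hq.continuousAt (hIo.mem_nhds hx))
    exact (h.const_mul c).const_sub 1
  have hPc : ContinuousOn P I := fun x hx => (hPd x hx).continuousAt.continuousWithinAt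
  have hud : ∀ x ∈ I, HasDerivWithinAt u (g x) (Ioi x) x := fun x hx =>
    hu.hasDerivWithinAt hIo hI hpos' hx
  have hmem : ∀ {x y}, x ∈ I → y ∈ I → ∀ s ∈ Ioo (min x y) (max x y), s ∈ I :=
    fun hx hy s hs => hI.uIcc_subset hx hy (Ioo_subset_Icc_self hs)
  have hinv : ContinuousOn (fun x => c * (u x)⁻¹) I :=
    continuousOn_const.mul (hu.continuousOn.inv₀ hne)
  refine ⟨hu.continuousOn.mul hPc, fun x hx => ?_, fun x hx y hy => ?_, fun x hx y hy hxy => ?_⟩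
  · exact ((hu.continuousWithinAt hx).mul (hPd x hx).continuousAt.continuousWithinAt).sub
      (hinv.continuousAt (hIo.mem_nhds hx)).continuousWithinAt
  · have hsub := hI.uIcc_subset hx hy
    have h := intervalIntegral.integral_eq_sub_of_hasDeriv_right (f := fun x => u x * P x)
      (f' := fun x => g x * P x - c * (u x)⁻¹) ((hu.continuousOn.mul hPc).mono hsub)
      (fun s hs => by
        have hs := hmem hx hy s hs
        refine ((hud s hs).mul (hPd s hs).hasDerivWithinAt).congr_deriv ?_
        have := hne s hs
        field_simp
        ring)
      (((hu.intervalIntegrable hI hpos' hx hy).mul_continuousOn (hPc.mono hsub)).sub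
        (hinv.mono hsub).intervalIntegrable)
    rw [h]
    ring
  · have hsub := hI.uIcc_subset hx hy
    have hsub' := hI.out hx hy
    have hp : ContinuousOn (fun t => -(c * (u t ^ 2)⁻¹)) I := (continuousOn_const.mul hq).neg
    have hPint : ∀ s ∈ I, P s = P x + ∫ t in x..s, -(c * (u t ^ 2)⁻¹) := by
      intro s hs
      rw [intervalIntegral.integral_eq_sub_of_hasDerivAt
        (fun t ht => hPd t (hI.uIcc_subset hx hs ht))
        (hp.mono (hI.uIcc_subset hx hs)).intervalIntegrable]
      ring
    have hgint : ∫ t in x..y, -(c * (u t ^ 2)⁻¹) * g t = c * (u y)⁻¹ - c * (u x)⁻¹ := by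
      refine intervalIntegral.integral_eq_sub_of_hasDeriv_right (hinv.mono hsub)
        (fun s hs => ?_) ((hu.intervalIntegrable hI hpos' hx hy).continuousOn_mul (hp.mono hsub))
      have hs := hmem hx hy s hs
      refine (((hud s hs).inv (hne s hs)).const_mul c).congr_deriv ?_
      have := hne s hs
      field_simp
    have hfub := setIntegral_mul_intervalIntegral hxy (hκ x hx y hy)
      (hu.continuousOn.mono hsub') (hp.mono hsub')
    have hui : IntegrableOn u (Ioc x y) κ :=
      ((hu.continuousOn.mono hsub').integrableOn_Icc_of_measure_lt_top (hκ x hx y hy)).mono_set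
        Ioc_subset_Icc_self
    have hupi : IntegrableOn (fun s => u s * ∫ t in x..s, -(c * (u t ^ 2)⁻¹)) (Ioc x y) κ := by
      refine (ContinuousOn.integrableOn_Icc_of_measure_lt_top ?_ (hκ x hx y hy)).mono_set
        Ioc_subset_Icc_self
      refine (hu.continuousOn.mono hsub').mul ((hPc.mono hsub').sub
        (continuousOn_const (c := P x)) |>.congr fun s hs => ?_)
      rw [Pi.sub_apply, hPint s (hsub' hs)]
      ring
    have hsum : ∫ s in Ioc x y, u s * P s ∂κ = P x * ∫ s in Ioc x y, u s ∂κ +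
        ∫ t in x..y, -(c * (u t ^ 2)⁻¹) * ∫ s in Ioc t y, u s ∂κ := by
      rw [← hfub, ← integral_const_mul, ← integral_add (hui.const_mul _) hupi]
      refine setIntegral_congr_fun measurableSet_Ioc fun s hs => ?_
      rw [hPint s (hsub' (Ioc_subset_Icc_self hs))]
      ring
    have htail : 2 * ∫ t in x..y, -(c * (u t ^ 2)⁻¹) * ∫ s in Ioc t y, u s ∂κ =
        g y * (P y - P x) - (c * (u y)⁻¹ - c * (u x)⁻¹) := by
      rw [← hgint, hPint y hy, add_sub_cancel_left, ← intervalIntegral.integral_const_mul,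
        ← intervalIntegral.integral_const_mul, ← intervalIntegral.integral_sub
          ((hp.mono hsub).intervalIntegrable.const_mul _)
          ((hu.intervalIntegrable hI hpos' hx hy).continuousOn_mul (hp.mono hsub))]
      refine intervalIntegral.integral_congr fun t ht => ?_
      rw [uIcc_of_le hxy] at ht
      have := hu.sub_eq_setIntegral (hsub' ht) hy ht.2
      linear_combination (c * (u t ^ 2)⁻¹) * this
    have := hu.sub_eq_setIntegral hx hy hxy
    rw [hsum, mul_add, htail]
    linear_combination P x * this

/-- A positive solution which is minimal to the right of `x₀` vanishes at the right end of a
bounded interval. -/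
lemma exists_lt_of_minimal_right (hIo : IsOpen I) (hI : I.OrdConnected)
    (hκ : ∀ x ∈ I, ∀ y ∈ I, κ (Icc x y) < ⊤) (hu : IsSolKappa I κ u g)
    (hpos : ∀ x ∈ I, 0 < u x) {x₀ : ℝ} (hx₀ : x₀ ∈ I) (hnorm : u x₀ = 1)
    (hmin : ∀ w gw : ℝ → ℝ, IsSolKappa I κ w gw → w x₀ = 1 →
      (∀ x ∈ I ∩ Ici x₀, 0 < w x) → ∀ x ∈ I ∩ Ici x₀, u x ≤ w x)
    (hbd : BddAbove I) {ε : ℝ} (hε : 0 < ε) : ∃ y ∈ I, u y < ε := by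
  by_contra! hle
  obtain ⟨b, hb⟩ := hbd
  have hq : ContinuousOn (fun t => (u t ^ 2)⁻¹) I :=
    (hu.continuousOn.pow 2).inv₀ fun x hx => pow_ne_zero 2 (hpos x hx).ne'
  obtain ⟨y, hy, hxy⟩ := hIo.exists_gt_mem hx₀
  have hb0 : 0 < b - x₀ := sub_pos.2 (hxy.trans_le (hb hy))
  have hS : ∀ x ∈ I, x₀ ≤ x → ∫ t in x₀..x, (u t ^ 2)⁻¹ ≤ (b - x₀) / ε ^ 2 := by
    intro x hx hxx
    calc ∫ t in x₀..x, (u t ^ 2)⁻¹ ≤ ∫ t in x₀..x, (ε ^ 2)⁻¹ := by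
          refine intervalIntegral.integral_mono_on hxx
            (hq.mono (hI.uIcc_subset hx₀ hx)).intervalIntegrable intervalIntegrable_const
            fun t ht => ?_
          have := hle t (hI.out hx₀ hx ht)
          gcongr
      _ = (x - x₀) / ε ^ 2 := by
          rw [intervalIntegral.integral_const, smul_eq_mul, div_eq_mul_inv]
      _ ≤ (b - x₀) / ε ^ 2 := by
          have := hb hx
          gcongr
  set c := ε ^ 2 / (2 * (b - x₀)) with hc
  have hc0 : 0 < c := by positivity
  have hcS : c * ((b - x₀) / ε ^ 2) = 1 / 2 := by
    rw [hc]; field_simp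
  have h := hmin _ _ (hu.mul_one_sub_intervalIntegral hIo hI hκ hpos hx₀ c)
    (by simp [hnorm]) (fun x hx => by
      refine mul_pos (hpos x hx.1) ?_
      have := mul_le_mul_of_nonneg_left (hS x hx.1 hx.2) hc0.le
      linarith) y ⟨hy, hxy.le⟩
  have hSy : 0 < ∫ t in x₀..y, (u t ^ 2)⁻¹ :=
    intervalIntegral.intervalIntegral_pos_of_pos_on
      (hq.mono (hI.uIcc_subset hx₀ hy)).intervalIntegrable
      (fun t ht => by
        have := hpos t (hI.out hx₀ hy (Ioo_subset_Icc_self ht))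
        positivity) hxy
  nlinarith [mul_pos (hpos y hy) (mul_pos hc0 hSy)]

/-- A positive solution which is minimal to the left of `x₀` vanishes at the left end of a
bounded interval. -/
lemma exists_lt_of_minimal_left (hIo : IsOpen I) (hI : I.OrdConnected)
    (hκ : ∀ x ∈ I, ∀ y ∈ I, κ (Icc x y) < ⊤) (hu : IsSolKappa I κ u g)
    (hpos : ∀ x ∈ I, 0 < u x) {x₀ : ℝ} (hx₀ : x₀ ∈ I) (hnorm : u x₀ = 1)
    (hmin : ∀ w gw : ℝ → ℝ, IsSolKappa I κ w gw → w x₀ = 1 →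
      (∀ x ∈ I ∩ Iic x₀, 0 < w x) → ∀ x ∈ I ∩ Iic x₀, u x ≤ w x)
    (hbd : BddBelow I) {ε : ℝ} (hε : 0 < ε) : ∃ y ∈ I, u y < ε := by
  by_contra! hle
  obtain ⟨b, hb⟩ := hbd
  have hq : ContinuousOn (fun t => (u t ^ 2)⁻¹) I :=
    (hu.continuousOn.pow 2).inv₀ fun x hx => pow_ne_zero 2 (hpos x hx).ne'
  obtain ⟨y, hy, hxy⟩ := hIo.exists_lt_mem hx₀
  have hb0 : 0 < x₀ - b := sub_pos.2 ((hb hy).trans_lt hxy)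
  have hS : ∀ x ∈ I, x ≤ x₀ → ∫ t in x..x₀, (u t ^ 2)⁻¹ ≤ (x₀ - b) / ε ^ 2 := by
    intro x hx hxx
    calc ∫ t in x..x₀, (u t ^ 2)⁻¹ ≤ ∫ t in x..x₀, (ε ^ 2)⁻¹ := by
          refine intervalIntegral.integral_mono_on hxx
            (hq.mono (hI.uIcc_subset hx hx₀)).intervalIntegrable intervalIntegrable_const
            fun t ht => ?_
          have := hle t (hI.out hx hx₀ ht)
          gcongr
      _ = (x₀ - x) / ε ^ 2 := by
          rw [intervalIntegral.integral_const, smul_eq_mul, div_eq_mul_inv]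
      _ ≤ (x₀ - b) / ε ^ 2 := by
          have := hb hx
          gcongr
  set c := ε ^ 2 / (2 * (x₀ - b)) with hc
  have hc0 : 0 < c := by positivity
  have hcS : c * ((x₀ - b) / ε ^ 2) = 1 / 2 := by
    rw [hc]; field_simp
  have h := hmin _ _ (hu.mul_one_sub_intervalIntegral hIo hI hκ hpos hx₀ (-c))
    (by simp [hnorm]) (fun x hx => by
      refine mul_pos (hpos x hx.1) ?_
      rw [intervalIntegral.integral_symm]
      have := mul_le_mul_of_nonneg_left (hS x hx.1 hx.2) hc0.le
      linarith) y ⟨hy, hxy.le⟩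
  have hSy : 0 < ∫ t in y..x₀, (u t ^ 2)⁻¹ :=
    intervalIntegral.intervalIntegral_pos_of_pos_on
      (hq.mono (hI.uIcc_subset hy hx₀)).intervalIntegrable
      (fun t ht => by
        have := hpos t (hI.out hy hx₀ (Ioo_subset_Icc_self ht))
        positivity) hxy
  simp only [intervalIntegral.integral_symm y x₀] at h
  nlinarith [mul_pos (hpos y hy) (mul_pos hc0 hSy)]

end IsSolKappa

/-- continuity in `κ` (for vague convergence) of the normalized
minimal positive monotone solutions of `(1/2) u'' = u κ`, uniformly on compact sets. -/
theorem solutions_continuous_in_kappa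
    (I : Set ℝ) (hIopen : IsOpen I) (hIconn : I.OrdConnected)
    (x₀ : ℝ) (hx₀ : x₀ ∈ I)
    (κs : ℕ → Measure ℝ) (κ : Measure ℝ)
    (hκs0 : ∀ n, κs n ≠ 0) (hκ0 : κ ≠ 0)
    (hκsfin : ∀ n, ∀ x ∈ I, ∀ y ∈ I, κs n (Icc x y) < ⊤)
    (hκfin : ∀ x ∈ I, ∀ y ∈ I, κ (Icc x y) < ⊤)
    (hvague : ∀ φ : ℝ → ℝ, Continuous φ → HasCompactSupport φ → tsupport φ ⊆ I →
      Tendsto (fun n => ∫ x, φ x ∂(κs n)) atTop (nhds (∫ x, φ x ∂κ)))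
    -- the non-increasing normalized minimal solutions
    (us : ℕ → ℝ → ℝ) (gs : ℕ → ℝ → ℝ) (u g : ℝ → ℝ)
    (hus : ∀ n, IsSolKappa I (κs n) (us n) (gs n))
    (huspos : ∀ n, ∀ x ∈ I, 0 < us n x)
    (husanti : ∀ n, AntitoneOn (us n) I)
    (husnorm : ∀ n, us n x₀ = 1)
    (husmin : ∀ n, ∀ w gw : ℝ → ℝ, IsSolKappa I (κs n) w gw → w x₀ = 1 →
      (∀ x ∈ I ∩ Ici x₀, 0 < w x) → ∀ x ∈ I ∩ Ici x₀, us n x ≤ w x)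
    (hu : IsSolKappa I κ u g)
    (hupos : ∀ x ∈ I, 0 < u x) (huanti : AntitoneOn u I) (hunorm : u x₀ = 1)
    (humin : ∀ w gw : ℝ → ℝ, IsSolKappa I κ w gw → w x₀ = 1 →
      (∀ x ∈ I ∩ Ici x₀, 0 < w x) → ∀ x ∈ I ∩ Ici x₀, u x ≤ w x)
    -- the non-decreasing normalized minimal solutions
    (vs : ℕ → ℝ → ℝ) (hs : ℕ → ℝ → ℝ) (v h : ℝ → ℝ)
    (hvs : ∀ n, IsSolKappa I (κs n) (vs n) (hs n))
    (hvspos : ∀ n, ∀ x ∈ I, 0 < vs n x)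
    (hvsmono : ∀ n, MonotoneOn (vs n) I)
    (hvsnorm : ∀ n, vs n x₀ = 1)
    (hvsmin : ∀ n, ∀ w gw : ℝ → ℝ, IsSolKappa I (κs n) w gw → w x₀ = 1 →
      (∀ x ∈ I ∩ Iic x₀, 0 < w x) → ∀ x ∈ I ∩ Iic x₀, vs n x ≤ w x)
    (hv : IsSolKappa I κ v h)
    (hvpos : ∀ x ∈ I, 0 < v x) (hvmono : MonotoneOn v I) (hvnorm : v x₀ = 1)
    (hvmin : ∀ w gw : ℝ → ℝ, IsSolKappa I κ w gw → w x₀ = 1 →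
      (∀ x ∈ I ∩ Iic x₀, 0 < w x) → ∀ x ∈ I ∩ Iic x₀, v x ≤ w x) :
    (∀ K : Set ℝ, K ⊆ I → IsCompact K →
      TendstoUniformlyOn (fun n => us n) u atTop K) ∧
    (∀ K : Set ℝ, K ⊆ I → IsCompact K →
      TendstoUniformlyOn (fun n => vs n) v atTop K) := by
  refine ⟨fun K hKI hK => ?_, fun K hKI hK => ?_⟩
  · exact IsWeakSolKappa.tendstoUniformlyOn hIopen hIconn hx₀ hκsfin hκfin hvague
      (fun n => (hus n).isWeakSolKappa hIconn (hκsfin n) fun x hx => (huspos n x hx).le)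
      (fun n x hx => (huspos n x hx).le) husanti husnorm
      (fun hbd n ε hε => (hus n).exists_lt_of_minimal_right hIopen hIconn (hκsfin n) (huspos n)
        hx₀ (husnorm n) (husmin n) hbd hε)
      (hu.isWeakSolKappa hIconn hκfin fun x hx => (hupos x hx).le)
      (fun x hx => (hupos x hx).le) huanti hunorm
      (fun hbd ε hε => hu.exists_lt_of_minimal_right hIopen hIconn hκfin hupos
        hx₀ hunorm humin hbd hε) hKI hK
  have hmap : ∀ (μ : Measure ℝ) (f : ℝ → ℝ), ∫ x, f x ∂(μ.map Neg.neg) = ∫ x, f (-x) ∂μ :=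
    fun μ f => integral_map_equiv (μ := μ) (MeasurableEquiv.neg ℝ) f
  have hfin : ∀ μ : Measure ℝ, (∀ x ∈ I, ∀ y ∈ I, μ (Icc x y) < ⊤) →
      ∀ x ∈ Neg.neg ⁻¹' I, ∀ y ∈ Neg.neg ⁻¹' I, (μ.map Neg.neg) (Icc x y) < ⊤ := by
    intro μ hμ x hx y hy
    rw [Measure.map_apply measurable_neg measurableSet_Icc, neg_preimage, neg_Icc]
    exact hμ _ hy _ hx
  have hbelow : BddAbove (Neg.neg ⁻¹' I) → BddBelow I := fun hbd => by
    rwa [neg_preimage, bddAbove_neg] at hbd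
  have hvan : ∀ f : ℝ → ℝ, (∀ ε > 0, ∃ y ∈ I, f y < ε) →
      ∀ ε > 0, ∃ y ∈ Neg.neg ⁻¹' I, f (-y) < ε := fun f hf ε hε => by
    obtain ⟨y, hy, hyε⟩ := hf ε hε
    exact ⟨-y, by simpa using hy, by simpa using hyε⟩
  have hconn : (Neg.neg ⁻¹' I).OrdConnected :=
    ⟨fun x hx y hy z hz => hIconn.out hy hx ⟨neg_le_neg hz.2, neg_le_neg hz.1⟩⟩
  have key := IsWeakSolKappa.tendstoUniformlyOn (I := Neg.neg ⁻¹' I) (x₀ := -x₀)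
    (κs := fun n => (κs n).map Neg.neg) (κ := κ.map Neg.neg) (us := fun n x => vs n (-x))
    (u := fun x => v (-x)) (K := Neg.neg ⁻¹' K)
    (hIopen.preimage continuous_neg) hconn (by simpa using hx₀)
    (fun n => hfin _ (hκsfin n)) (hfin κ hκfin)
    (fun φ hφ hc hsupp => by
      simp only [hmap]
      refine hvague (fun x => φ (-x)) (hφ.comp continuous_neg)
        (hc.comp_homeomorph (Homeomorph.neg ℝ)) fun x hx => ?_
      have hx' : -x ∈ tsupport φ := tsupport_comp_subset_preimage φ continuous_neg hx
      simpa using hsupp hx')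
    (fun n => ((hvs n).isWeakSolKappa hIconn (hκsfin n) fun x hx => (hvspos n x hx).le).comp_neg)
    (fun n x hx => (hvspos n _ hx).le)
    (fun n x hx y hy hxy => hvsmono n hy hx (neg_le_neg hxy)) (fun n => by simpa using hvsnorm n)
    (fun hbd n => hvan _ fun ε hε => (hvs n).exists_lt_of_minimal_left hIopen hIconn (hκsfin n)
      (hvspos n) hx₀ (hvsnorm n) (hvsmin n) (hbelow hbd) hε)
    (hv.isWeakSolKappa hIconn hκfin fun x hx => (hvpos x hx).le).comp_neg
    (fun x hx => (hvpos _ hx).le)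
    (fun x hx y hy hxy => hvmono hy hx (neg_le_neg hxy)) (by simpa using hvnorm)
    (fun hbd => hvan _ fun ε hε => hv.exists_lt_of_minimal_left hIopen hIconn hκfin
      hvpos hx₀ hvnorm hvmin (hbelow hbd) hε)
    (preimage_mono hKI) ((Homeomorph.neg ℝ).isCompact_preimage.2 hK)
  have := key.comp Neg.neg
  simpa [Function.comp_def, ← preimage_comp] using this
end

section
/- Let I be an open interval of ℝ, let m, w : I → ℝ be continuous and positive, and let ν be a signed Radon measure on I. The following two conditions are equivalent: (i) there exist a continuous positive function u : I → ℝ and a right-continuous function h : I → ℝ such that u(x) = u(x′) + ∫_{x′}^{x} w(t) h(t) dt for all x′, x ∈ I and h(x) − h(x′) = −∫_{(x′,x]} u·m dν for all x′ ≤ x in I (i.e. u is a positive solution of Lu = 0 for L = (1/m) d/dx ((1/w) d/dx) + ν); (ii) for every smooth compactly supported f : I → ℝ, ∫_I f(x)² m(x) ν(dx) ≤ ∫_I f′(x)² / w(x) dx. -/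
open MeasureTheory Set

/-- `u` is a solution of `L u = 0` on `I`, where
`L = (1/m) d/dx ((1/w) d/dx) + ν` and the signed Radon measure `ν` is represented
as the difference `νp - νm`; `h = (1/w) u'` is right-continuous. -/
def IsLHarmonic (I : Set ℝ) (m w : ℝ → ℝ) (νp νm : Measure ℝ) (u h : ℝ → ℝ) : Prop :=
  ContinuousOn u I ∧
  (∀ x ∈ I, ContinuousWithinAt h (Ici x) x) ∧
  (∀ x' ∈ I, ∀ x ∈ I, u x = u x' + ∫ t in x'..x, w t * h t) ∧
  (∀ x' ∈ I, ∀ x ∈ I, x' ≤ x →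
    h x - h x' = -((∫ t in Ioc x' x, u t * m t ∂νp) - ∫ t in Ioc x' x, u t * m t ∂νm))

open Filter Topology

/-- Bounded and almost everywhere strongly measurable real functions on `[a, b]`. -/
def BddMeas (a b : ℝ) (k : ℝ → ℝ) : Prop :=
  AEStronglyMeasurable k (volume.restrict (Icc a b)) ∧ ∃ C, ∀ x ∈ Icc a b, |k x| ≤ C

namespace BddMeas

variable {a b c d : ℝ} {k l : ℝ → ℝ}

theorem of_continuousOn (hk : ContinuousOn k (Icc a b)) : BddMeas a b k :=
  ⟨hk.aestronglyMeasurable measurableSet_Icc, isCompact_Icc.exists_bound_of_continuousOn hk⟩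

theorem add (hk : BddMeas a b k) (hl : BddMeas a b l) : BddMeas a b (fun x => k x + l x) := by
  obtain ⟨hk, C, hC⟩ := hk
  obtain ⟨hl, D, hD⟩ := hl
  exact ⟨hk.add hl, C + D, fun x hx => (abs_add_le _ _).trans (add_le_add (hC x hx) (hD x hx))⟩

theorem mul (hk : BddMeas a b k) (hl : BddMeas a b l) : BddMeas a b (fun x => k x * l x) := by
  obtain ⟨hk, C, hC⟩ := hk
  obtain ⟨hl, D, hD⟩ := hl
  refine ⟨hk.mul hl, C * D, fun x hx => ?_⟩
  rw [abs_mul]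
  exact mul_le_mul (hC x hx) (hD x hx) (abs_nonneg _) ((abs_nonneg _).trans (hC x hx))

theorem const (r : ℝ) : BddMeas a b (fun _ => r) := of_continuousOn continuousOn_const

theorem neg (hk : BddMeas a b k) : BddMeas a b (fun x => -k x) := by
  simpa using (const (-1)).mul hk

theorem sub (hk : BddMeas a b k) (hl : BddMeas a b l) : BddMeas a b (fun x => k x - l x) := by
  simpa [sub_eq_add_neg] using hk.add hl.neg

theorem integrableOn (hk : BddMeas a b k) : IntegrableOn k (Icc a b) := by
  obtain ⟨hk, C, hC⟩ := hk
  refine IntegrableOn.of_bound (C := C) measure_Icc_lt_top hk ?_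
  filter_upwards [ae_restrict_mem measurableSet_Icc] with x hx using hC x hx

theorem intervalIntegrable (hk : BddMeas a b k) (hc : c ∈ Icc a b) (hd : d ∈ Icc a b) :
    IntervalIntegrable k volume c d :=
  (hk.integrableOn.mono_set (uIcc_subset_Icc hc hd)).intervalIntegrable

end BddMeas

section Primitive

variable {μ : Measure ℝ} {a b : ℝ} {q : ℝ → ℝ}

theorem setIntegral_Ioc_eq_indicator {t : ℝ} (ht : t ≤ b) :
    ∫ x in Ioc a t, q x ∂μ = ∫ x in Ioc a b, (Iic t).indicator q x ∂μ := by
  rw [setIntegral_indicator measurableSet_Iic]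
  congr 2
  ext x
  simp only [mem_Ioc, mem_inter_iff, mem_Iic]
  grind

theorem bddMeas_setIntegral_Ioc (hq : IntegrableOn q (Ioc a b) μ) :
    BddMeas a b (fun t => ∫ x in Ioc a t, q x ∂μ) := by
  have key : ∀ p : ℝ → ℝ, IntegrableOn p (Ioc a b) μ → (∀ x, 0 ≤ p x) →
      BddMeas a b (fun t => ∫ x in Ioc a t, p x ∂μ) := by
    intro p hp hp0
    have hmono : MonotoneOn (fun t => ∫ x in Ioc a t, p x ∂μ) (Icc a b) := by
      intro s hs t ht hst
      exact setIntegral_mono_set (hp.mono_set (Ioc_subset_Ioc_right ht.2))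
        (Eventually.of_forall hp0) (Ioc_subset_Ioc_right hst).eventuallyLE
    refine ⟨(hmono.integrableOn_isCompact (μ := volume) isCompact_Icc).aestronglyMeasurable,
      ∫ x in Ioc a b, p x ∂μ, fun t ht => ?_⟩
    rw [abs_of_nonneg (integral_nonneg hp0)]
    exact hmono ht ⟨ht.1.trans ht.2, le_rfl⟩ ht.2
  have h1 := key (fun x => max (q x) 0) hq.pos_part (fun x => le_max_right _ _)
  have h2 := key (fun x => max (-q x) 0) hq.neg_part (fun x => le_max_right _ _)
  have h := h1.sub h2
  have heq : ∀ t ∈ Icc a b, ∫ x in Ioc a t, q x ∂μ =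
      (∫ x in Ioc a t, max (q x) 0 ∂μ) - ∫ x in Ioc a t, max (-q x) 0 ∂μ := by
    intro t ht
    have hq' := hq.mono_set (Ioc_subset_Ioc_right ht.2)
    rw [← integral_sub hq'.pos_part hq'.neg_part]
    congr 1
    ext x
    rcases le_total (q x) 0 with h | h
    · simp [h]
    · simp [h]
  refine ⟨h.1.congr ?_, ?_⟩
  · filter_upwards [ae_restrict_mem measurableSet_Icc] with t ht using (heq t ht).symm
  · obtain ⟨C, hC⟩ := h.2
    exact ⟨C, fun t ht => (congrArg abs (heq t ht)).trans_le (hC t ht)⟩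

theorem continuousWithinAt_setIntegral_Ioc (hq : IntegrableOn q (Ioc a b) μ) {x : ℝ}
    (hx : x < b) :
    ContinuousWithinAt (fun t => ∫ y in Ioc a t, q y ∂μ) (Ici x) x := by
  have h : ContinuousWithinAt (fun t => ∫ y in Ioc a b, (Iic t).indicator q y ∂μ) (Ici x) x := by
    refine continuousWithinAt_of_dominated (bound := fun y => ‖q y‖) ?_ ?_ hq.norm ?_
    · exact Eventually.of_forall fun t => hq.aestronglyMeasurable.indicator measurableSet_Iic
    · exact Eventually.of_forall fun t => Eventually.of_forall fun y =>
        norm_indicator_le_norm_self _ _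
    · refine Eventually.of_forall fun y => ?_
      refine (continuousWithinAt_const (b := (Iic x).indicator q y)).congr_of_eventuallyEq ?_ rfl
      rcases le_or_gt y x with hy | hy
      · filter_upwards [self_mem_nhdsWithin] with t (ht : x ≤ t)
        simp [hy, hy.trans ht]
      · filter_upwards [mem_nhdsWithin_of_mem_nhds (Iio_mem_nhds hy)] with t (ht : t < y)
        simp [hy, ht]
  refine h.congr_of_eventuallyEq ?_ (setIntegral_Ioc_eq_indicator hx.le)
  filter_upwards [mem_nhdsWithin_of_mem_nhds (Iio_mem_nhds hx)] with t ht
  exact setIntegral_Ioc_eq_indicator (le_of_lt ht)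

/-- Integration by parts for `∫ φ q dμ`, where `φ` is a primitive of `φ'`. -/
theorem setIntegral_mul_eq_sub_of_primitive (hμ : μ (Ioc a b) < ⊤) (hab : a ≤ b)
    (hq : IntegrableOn q (Ioc a b) μ)
    {φ φ' : ℝ → ℝ} (hφ' : BddMeas a b φ') (hφ : ∀ x ∈ Ioc a b, ∫ t in x..b, φ' t = φ b - φ x) :
    ∫ x in Ioc a b, φ x * q x ∂μ =
      φ b * (∫ x in Ioc a b, q x ∂μ) - ∫ t in a..b, φ' t * ∫ x in Ioc a t, q x ∂μ := by
  have : IsFiniteMeasure (μ.restrict (Ioc a b)) := ⟨by simpa using hμ⟩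
  have hint' : IntegrableOn φ' (Ioc a b) := hφ'.integrableOn.mono_set Ioc_subset_Icc_self
  let F : ℝ → ℝ → ℝ := fun x t => {p : ℝ × ℝ | p.1 ≤ p.2}.indicator (fun p => q p.1 * φ' p.2) (x, t)
  have hF : Integrable (Function.uncurry F)
      ((μ.restrict (Ioc a b)).prod (volume.restrict (Ioc a b))) :=
    (hq.mul_prod hint').indicator (measurableSet_le measurable_fst measurable_snd)
  have hswap := integral_integral_swap hF
  have h1 : ∀ x ∈ Ioc a b, ∫ t in Ioc a b, F x t = q x * (φ b - φ x) := by
    intro x hx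
    have : ∀ t, F x t = (Ici x).indicator (fun t => q x * φ' t) t := by
      intro t; simp only [F, indicator]; rfl
    simp_rw [this]
    rw [setIntegral_indicator measurableSet_Ici,
      show Ioc a b ∩ Ici x = Icc x b by
        ext y; simp only [mem_inter_iff, mem_Ioc, mem_Ici, mem_Icc]; grind,
      integral_const_mul, integral_Icc_eq_integral_Ioc, ← intervalIntegral.integral_of_le hx.2,
      hφ x hx]
  have h2 : ∀ t ∈ Ioc a b, ∫ x in Ioc a b, F x t ∂μ = φ' t * ∫ x in Ioc a t, q x ∂μ := by
    intro t ht
    rw [setIntegral_Ioc_eq_indicator ht.2, ← integral_const_mul]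
    congr 1
    ext x
    by_cases hxt : x ≤ t <;> simp [F, hxt, mul_comm]
  rw [setIntegral_congr_fun measurableSet_Ioc h1,
    setIntegral_congr_fun measurableSet_Ioc h2] at hswap
  rw [intervalIntegral.integral_of_le hab, ← hswap, ← integral_const_mul, ← integral_sub]
  · congr 1; ext x; ring
  · exact hq.const_mul _
  · refine (hF.integral_prod_left).congr ?_
    filter_upwards [ae_restrict_mem measurableSet_Ioc] with x hx using h1 x hx

end Primitive

/-- The integral of `u * m` over `s` against the signed measure `νp - νm`. -/
noncomputable def signedIntegral (m : ℝ → ℝ) (νp νm : Measure ℝ) (s : Set ℝ) (u : ℝ → ℝ) : ℝ :=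
  (∫ t in s, u t * m t ∂νp) - ∫ t in s, u t * m t ∂νm

/-- The standing assumptions on the coefficients, on a compact interval `[a, b]`. -/
structure RegularOn (m w : ℝ → ℝ) (νp νm : Measure ℝ) (a b : ℝ) : Prop where
  le : a ≤ b
  cont_m : ContinuousOn m (Icc a b)
  cont_w : ContinuousOn w (Icc a b)
  pos_w : ∀ x ∈ Icc a b, 0 < w x
  finite_p : νp (Icc a b) < ⊤
  finite_m : νm (Icc a b) < ⊤

/-- Solutions of `L u = 0` on a compact interval `[a, b]`. -/
structure IsSol (m w : ℝ → ℝ) (νp νm : Measure ℝ) (a b : ℝ) (u h : ℝ → ℝ) : Prop where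
  cont : ContinuousOn u (Icc a b)
  eq_u : ∀ x ∈ Icc a b, u x = u a + ∫ t in a..x, w t * h t
  eq_h : ∀ x ∈ Icc a b, h x = h a - signedIntegral m νp νm (Ioc a x) u

section

variable {m w : ℝ → ℝ} {νp νm : Measure ℝ} {a b c d : ℝ} {u h v k : ℝ → ℝ}

theorem RegularOn.mono (R : RegularOn m w νp νm a b) (hac : a ≤ c) (hcd : c ≤ d) (hdb : d ≤ b) :
    RegularOn m w νp νm c d := by
  have h : Icc c d ⊆ Icc a b := Icc_subset_Icc hac hdb
  exact ⟨hcd, R.cont_m.mono h, R.cont_w.mono h, fun x hx => R.pos_w x (h hx),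
    (measure_mono h).trans_lt R.finite_p, (measure_mono h).trans_lt R.finite_m⟩

theorem RegularOn.integrableOn_p (R : RegularOn m w νp νm a b) (hu : ContinuousOn u (Icc a b)) :
    IntegrableOn (fun t => u t * m t) (Icc a b) νp := by
  have hc := hu.mul R.cont_m
  obtain ⟨C, hC⟩ := isCompact_Icc.exists_bound_of_continuousOn hc
  refine IntegrableOn.of_bound (C := C) R.finite_p (hc.aestronglyMeasurable measurableSet_Icc) ?_
  filter_upwards [ae_restrict_mem measurableSet_Icc] with x hx using hC x hx

theorem RegularOn.integrableOn_m (R : RegularOn m w νp νm a b) (hu : ContinuousOn u (Icc a b)) :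
    IntegrableOn (fun t => u t * m t) (Icc a b) νm :=
  RegularOn.integrableOn_p (νm := νp) ⟨R.le, R.cont_m, R.cont_w, R.pos_w, R.finite_m, R.finite_p⟩ hu

theorem RegularOn.signedIntegral_lincomb (R : RegularOn m w νp νm a b)
    (hu : ContinuousOn u (Icc a b)) (hv : ContinuousOn v (Icc a b)) (p q : ℝ) {s : Set ℝ}
    (hs : s ⊆ Icc a b) :
    signedIntegral m νp νm s (fun x => p * u x + q * v x) =
      p * signedIntegral m νp νm s u + q * signedIntegral m νp νm s v := by
  have hup := (R.integrableOn_p hu).mono_set hs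
  have hum := (R.integrableOn_m hu).mono_set hs
  have hvp := (R.integrableOn_p hv).mono_set hs
  have hvm := (R.integrableOn_m hv).mono_set hs
  simp only [signedIntegral, add_mul, mul_assoc]
  rw [integral_add (hup.const_mul p) (hvp.const_mul q),
    integral_add (hum.const_mul p) (hvm.const_mul q)]
  simp only [integral_const_mul]
  ring

theorem RegularOn.signedIntegral_add_Ioc (R : RegularOn m w νp νm a b)
    (hu : ContinuousOn u (Icc a b)) (hac : a ≤ c) (hcd : c ≤ d) (hdb : d ≤ b) :
    signedIntegral m νp νm (Ioc a d) u =
      signedIntegral m νp νm (Ioc a c) u + signedIntegral m νp νm (Ioc c d) u := by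
  have h1 : Ioc a c ⊆ Icc a b := Ioc_subset_Icc_self.trans (Icc_subset_Icc_right (hcd.trans hdb))
  have h2 : Ioc c d ⊆ Icc a b := Ioc_subset_Icc_self.trans (Icc_subset_Icc hac hdb)
  simp only [signedIntegral]
  rw [← Ioc_union_Ioc_eq_Ioc hac hcd,
    setIntegral_union (Ioc_disjoint_Ioc_of_le le_rfl) measurableSet_Ioc
      ((R.integrableOn_p hu).mono_set h1) ((R.integrableOn_p hu).mono_set h2),
    setIntegral_union (Ioc_disjoint_Ioc_of_le le_rfl) measurableSet_Ioc
      ((R.integrableOn_m hu).mono_set h1) ((R.integrableOn_m hu).mono_set h2)]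
  ring

theorem RegularOn.bddMeas_signedIntegral (R : RegularOn m w νp νm a b)
    (hu : ContinuousOn u (Icc a b)) :
    BddMeas a b (fun x => signedIntegral m νp νm (Ioc a x) u) :=
  (bddMeas_setIntegral_Ioc ((R.integrableOn_p hu).mono_set Ioc_subset_Icc_self)).sub
    (bddMeas_setIntegral_Ioc ((R.integrableOn_m hu).mono_set Ioc_subset_Icc_self))

theorem IsSol.bddMeas (S : IsSol m w νp νm a b u h) (R : RegularOn m w νp νm a b) :
    BddMeas a b h := by
  have hb := (BddMeas.const (a := a) (b := b) (h a)).sub (R.bddMeas_signedIntegral S.cont)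
  refine ⟨hb.1.congr ?_, ?_⟩
  · filter_upwards [ae_restrict_mem measurableSet_Icc] with t ht using (S.eq_h t ht).symm
  · obtain ⟨C, hC⟩ := hb.2
    exact ⟨C, fun t ht => (congrArg abs (S.eq_h t ht)).trans_le (hC t ht)⟩

theorem IsSol.continuousWithinAt (S : IsSol m w νp νm a b u h) (R : RegularOn m w νp νm a b)
    {x : ℝ} (hx : x ∈ Ico a b) : ContinuousWithinAt h (Ici x) x := by
  have hc : ContinuousWithinAt (fun t => h a - signedIntegral m νp νm (Ioc a t) u) (Ici x) x :=
    continuousWithinAt_const.sub ((continuousWithinAt_setIntegral_Ioc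
      ((R.integrableOn_p S.cont).mono_set Ioc_subset_Icc_self) hx.2).sub
      (continuousWithinAt_setIntegral_Ioc
      ((R.integrableOn_m S.cont).mono_set Ioc_subset_Icc_self) hx.2))
  refine hc.congr_of_eventuallyEq ?_ (S.eq_h x ⟨hx.1, hx.2.le⟩)
  filter_upwards [mem_nhdsWithin_of_mem_nhds (Iio_mem_nhds hx.2), self_mem_nhdsWithin] with t ht ht'
  exact S.eq_h t ⟨hx.1.trans ht', le_of_lt ht⟩

theorem IsSol.bddMeas_deriv (S : IsSol m w νp νm a b u h) (R : RegularOn m w νp νm a b) :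
    BddMeas a b (fun t => w t * h t) :=
  (BddMeas.of_continuousOn R.cont_w).mul (S.bddMeas R)

theorem IsSol.hasDerivWithinAt (S : IsSol m w νp νm a b u h) (R : RegularOn m w νp νm a b)
    {x : ℝ} (hx : x ∈ Ioo a b) : HasDerivWithinAt u (w x * h x) (Ioi x) x := by
  have hB := S.bddMeas_deriv R
  have hcw : ContinuousWithinAt (fun t => w t * h t) (Ioi x) x :=
    ((R.cont_w.continuousAt (Icc_mem_nhds hx.1 hx.2)).continuousWithinAt).mul
      ((S.continuousWithinAt R ⟨hx.1.le, hx.2⟩).mono Ioi_subset_Ici_self)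
  have hm : StronglyMeasurableAtFilter (fun t => w t * h t) (𝓝[>] x) volume :=
    ⟨Icc a b, mem_nhdsWithin_of_mem_nhds (Icc_mem_nhds hx.1 hx.2), hB.1⟩
  have hd := (intervalIntegral.integral_hasDerivWithinAt_right (s := Ici x) (t := Ioi x)
    (hB.intervalIntegrable (left_mem_Icc.2 R.le) (Ioo_subset_Icc_self hx)) hm hcw).const_add (u a)
  refine (hd.mono Ioi_subset_Ici_self).congr_of_eventuallyEq ?_ (S.eq_u x (Ioo_subset_Icc_self hx))
  filter_upwards [mem_nhdsWithin_of_mem_nhds (Icc_mem_nhds hx.1 hx.2)] with t ht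
  exact S.eq_u t ht

theorem IsSol.sub_eq_integral (S : IsSol m w νp νm a b u h) (R : RegularOn m w νp νm a b)
    {x y : ℝ} (hx : x ∈ Icc a b) (hy : y ∈ Icc a b) : u y = u x + ∫ t in x..y, w t * h t := by
  have hB := S.bddMeas_deriv R
  have ha := left_mem_Icc.2 R.le
  rw [S.eq_u y hy, S.eq_u x hx, add_assoc, intervalIntegral.integral_add_adjacent_intervals
    (hB.intervalIntegrable ha hx) (hB.intervalIntegrable hx hy)]

theorem IsSol.h_sub_eq (S : IsSol m w νp νm a b u h) (R : RegularOn m w νp νm a b)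
    {x y : ℝ} (hx : a ≤ x) (hxy : x ≤ y) (hy : y ≤ b) :
    h y = h x - signedIntegral m νp νm (Ioc x y) u := by
  rw [S.eq_h y ⟨hx.trans hxy, hy⟩, S.eq_h x ⟨hx, hxy.trans hy⟩,
    R.signedIntegral_add_Ioc S.cont hx hxy hy]
  ring

theorem IsSol.mono (S : IsSol m w νp νm a b u h) (R : RegularOn m w νp νm a b)
    (hac : a ≤ c) (hcd : c ≤ d) (hdb : d ≤ b) : IsSol m w νp νm c d u h where
  cont := S.cont.mono (Icc_subset_Icc hac hdb)
  eq_u _ hx := S.sub_eq_integral R ⟨hac, hcd.trans hdb⟩ ⟨hac.trans hx.1, hx.2.trans hdb⟩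
  eq_h _ hx := S.h_sub_eq R hac hx.1 (hx.2.trans hdb)

theorem IsSol.lincomb (S : IsSol m w νp νm a b u h) (T : IsSol m w νp νm a b v k)
    (R : RegularOn m w νp νm a b) (p q : ℝ) :
    IsSol m w νp νm a b (fun x => p * u x + q * v x) (fun x => p * h x + q * k x) where
  cont := (continuousOn_const.mul S.cont).add (continuousOn_const.mul T.cont)
  eq_u x hx := by
    have ha := left_mem_Icc.2 R.le
    have h1 := (S.bddMeas_deriv R).intervalIntegrable ha hx
    have h2 := (T.bddMeas_deriv R).intervalIntegrable ha hx
    have : ∀ t, w t * (p * h t + q * k t) = p * (w t * h t) + q * (w t * k t) := fun t => by ring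
    simp_rw [this]
    rw [intervalIntegral.integral_add (h1.const_mul p) (h2.const_mul q),
      intervalIntegral.integral_const_mul, intervalIntegral.integral_const_mul,
      S.eq_u x hx, T.eq_u x hx]
    ring
  eq_h x hx := by
    rw [R.signedIntegral_lincomb S.cont T.cont p q
      (Ioc_subset_Icc_self.trans (Icc_subset_Icc_right hx.2)), S.eq_h x hx, T.eq_h x hx]
    ring

/-- Integration by parts against `d h = -u m dν`. -/
theorem IsSol.signedIntegral_mul (S : IsSol m w νp νm a b u h) (R : RegularOn m w νp νm a b)
    {φ φ' : ℝ → ℝ} (hφ : ContinuousOn φ (Icc a b)) (hφ' : BddMeas a b φ')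
    (hd : ∀ x ∈ Ioo a b, HasDerivWithinAt φ (φ' x) (Ioi x) x) :
    signedIntegral m νp νm (Ioc a b) (fun x => φ x * u x) =
      φ a * h a - φ b * h b + ∫ t in a..b, φ' t * h t := by
  have hprim : ∀ x ∈ Icc a b, ∫ t in x..b, φ' t = φ b - φ x := by
    intro x hx
    refine intervalIntegral.integral_eq_sub_of_hasDeriv_right_of_le hx.2
      (hφ.mono (Icc_subset_Icc_left hx.1)) (fun y hy => hd y ⟨hx.1.trans_lt hy.1, hy.2⟩)
      (hφ'.intervalIntegrable hx (right_mem_Icc.2 R.le))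
  have hp := (R.integrableOn_p S.cont).mono_set (Ioc_subset_Icc_self (a := a) (b := b))
  have hm := (R.integrableOn_m S.cont).mono_set (Ioc_subset_Icc_self (a := a) (b := b))
  have e1 := setIntegral_mul_eq_sub_of_primitive
    ((measure_mono Ioc_subset_Icc_self).trans_lt R.finite_p) R.le hp hφ'
    (fun x hx => hprim x (Ioc_subset_Icc_self hx))
  have e2 := setIntegral_mul_eq_sub_of_primitive
    ((measure_mono Ioc_subset_Icc_self).trans_lt R.finite_m) R.le hm hφ'
    (fun x hx => hprim x (Ioc_subset_Icc_self hx))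
  have ha := left_mem_Icc.2 R.le
  have hb := right_mem_Icc.2 R.le
  have i1 := (hφ'.mul (bddMeas_setIntegral_Ioc hp)).intervalIntegrable ha hb
  have i2 := (hφ'.mul (bddMeas_setIntegral_Ioc hm)).intervalIntegrable ha hb
  have e3 : ∫ t in a..b, φ' t * h t = ∫ t in a..b, (φ' t * h a -
      (φ' t * (∫ x in Ioc a t, u x * m x ∂νp) - φ' t * ∫ x in Ioc a t, u x * m x ∂νm)) := by
    refine intervalIntegral.integral_congr fun t ht => ?_
    rw [uIcc_of_le R.le] at ht
    simp only [S.eq_h t ht, signedIntegral]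
    ring
  rw [intervalIntegral.integral_sub ((hφ'.intervalIntegrable ha hb).mul_const _) (i1.sub i2),
    intervalIntegral.integral_sub i1 i2, intervalIntegral.integral_mul_const, hprim a ha] at e3
  have e4 := S.eq_h b hb
  simp only [signedIntegral, mul_assoc] at e1 e2 e4 ⊢
  rw [e3, e1, e2, e4]
  ring

theorem IsSol.wronskian_const (S : IsSol m w νp νm a b u h) (T : IsSol m w νp νm a b v k)
    (R : RegularOn m w νp νm a b) {x y : ℝ} (hx : x ∈ Icc a b) (hy : y ∈ Icc a b) :
    u x * k x - v x * h x = u y * k y - v y * h y := by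
  have key : ∀ z ∈ Icc a b, u z * k z - v z * h z = u a * k a - v a * h a := by
    intro z hz
    have R' := R.mono le_rfl hz.1 hz.2
    have S' := S.mono R le_rfl hz.1 hz.2
    have T' := T.mono R le_rfl hz.1 hz.2
    have e1 := S'.signedIntegral_mul R' T'.cont (T'.bddMeas_deriv R')
      (fun _ hx => T'.hasDerivWithinAt R' hx)
    have e2 := T'.signedIntegral_mul R' S'.cont (S'.bddMeas_deriv R')
      (fun _ hx => S'.hasDerivWithinAt R' hx)
    have e3 : (fun x => v x * u x) = fun x => u x * v x := by ext; ring
    have e4 : ∫ t in a..z, w t * k t * h t = ∫ t in a..z, w t * h t * k t :=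
      intervalIntegral.integral_congr fun t _ => by ring
    rw [e3, e2, e4] at e1
    linarith
  rw [key x hx, key y hy]

end

section

variable {m w : ℝ → ℝ} {νp νm : Measure ℝ} {a b c d : ℝ} {u h v k : ℝ → ℝ}

theorem RegularOn.abs_signedIntegral_le (R : RegularOn m w νp νm a b) {C M : ℝ} {s : Set ℝ}
    (hs : s ⊆ Icc a b) (hC : ∀ x ∈ s, |u x| ≤ C) (hC0 : 0 ≤ C) (hM0 : 0 ≤ M)
    (hM : ∀ x ∈ Icc a b, |m x| ≤ M) :
    |signedIntegral m νp νm s u| ≤ C * M * (νp.real (Icc a b) + νm.real (Icc a b)) := by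
  have hb : ∀ x ∈ s, ‖u x * m x‖ ≤ C * M := fun x hx => by
    rw [Real.norm_eq_abs, abs_mul]
    exact mul_le_mul (hC x hx) (hM x (hs hx)) (abs_nonneg _) hC0
  have h1 := norm_setIntegral_le_of_norm_le_const ((measure_mono hs).trans_lt R.finite_p) hb
  have h2 := norm_setIntegral_le_of_norm_le_const ((measure_mono hs).trans_lt R.finite_m) hb
  have m1 : νp.real s ≤ νp.real (Icc a b) := measureReal_mono hs R.finite_p.ne
  have m2 : νm.real s ≤ νm.real (Icc a b) := measureReal_mono hs R.finite_m.ne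
  have hCM : 0 ≤ C * M := mul_nonneg hC0 hM0
  rw [Real.norm_eq_abs] at h1 h2
  calc |signedIntegral m νp νm s u| ≤ _ := abs_sub _ _
    _ ≤ C * M * νp.real s + C * M * νm.real s := add_le_add h1 h2
    _ ≤ C * M * νp.real (Icc a b) + C * M * νm.real (Icc a b) := by gcongr
    _ = _ := by ring

theorem integral_exp_mul_sub_le {r a x : ℝ} (hr : 0 < r) :
    ∫ t in a..x, Real.exp (r * (t - a)) ≤ Real.exp (r * (x - a)) / r := by
  have hd : ∀ t ∈ uIcc a x, HasDerivAt (fun t => Real.exp (r * (t - a)) / r)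
      (Real.exp (r * (t - a))) t := by
    intro t _
    have := ((((hasDerivAt_id t).sub_const a).const_mul r).exp).div_const r
    rwa [mul_one, mul_div_cancel_right₀ _ hr.ne'] at this
  rw [intervalIntegral.integral_eq_sub_of_hasDerivAt hd
    (Continuous.intervalIntegrable (by fun_prop) _ _)]
  have : 0 < Real.exp (r * (a - a)) / r := by positivity
  linarith

/-- Solutions with prescribed data at the left endpoint, by Picard iteration in a weighted
uniform norm. -/
theorem exists_isSol_left (R : RegularOn m w νp νm a b) (p q : ℝ) :
    ∃ u h, IsSol m w νp νm a b u h ∧ u a = p ∧ h a = q := by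
  obtain ⟨M, hM⟩ := isCompact_Icc.exists_bound_of_continuousOn R.cont_m
  obtain ⟨W, hW⟩ := isCompact_Icc.exists_bound_of_continuousOn R.cont_w
  simp only [Real.norm_eq_abs] at hM hW
  have ha := left_mem_Icc.2 R.le
  have hM0 : 0 ≤ M := (abs_nonneg _).trans (hM a ha)
  have hW0 : 0 ≤ W := (abs_nonneg _).trans (hW a ha)
  set N := νp.real (Icc a b) + νm.real (Icc a b) with hN
  have hN0 : 0 ≤ N := add_nonneg measureReal_nonneg measureReal_nonneg
  set K := W * M * N with hK
  have hK0 : 0 ≤ K := by positivity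
  set r := 2 * K + 1 with hr
  have hr0 : 0 < r := by positivity
  let U : C(Icc a b, ℝ) → ℝ → ℝ := fun v t => Real.exp (r * (t - a)) * v (projIcc a b R.le t)
  have hUc : ∀ v, Continuous (U v) := fun v =>
    (by fun_prop : Continuous fun t => Real.exp (r * (t - a))).mul
      (v.continuous.comp continuous_projIcc)
  let H : C(Icc a b, ℝ) → ℝ → ℝ := fun v t => q - signedIntegral m νp νm (Ioc a t) (U v)
  have hHB : ∀ v, BddMeas a b (fun t => w t * H v t) := fun v =>
    (BddMeas.of_continuousOn R.cont_w).mul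
      ((BddMeas.const q).sub (R.bddMeas_signedIntegral (hUc v).continuousOn))
  let G : C(Icc a b, ℝ) → ℝ → ℝ := fun v x => p + ∫ t in a..x, w t * H v t
  have hGc : ∀ v, ContinuousOn (G v) (Icc a b) := fun v => by
    have := intervalIntegral.continuousOn_primitive_interval (μ := volume) (a := a) (b := b)
      (f := fun t => w t * H v t) (by rw [uIcc_of_le R.le]; exact (hHB v).integrableOn)
    rw [uIcc_of_le R.le] at this
    exact continuousOn_const.add this
  let T : C(Icc a b, ℝ) → C(Icc a b, ℝ) := fun v =>
    ⟨fun x => Real.exp (-(r * (x - a))) * G v x,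
      (by fun_prop : Continuous fun x : Icc a b => Real.exp (-(r * ((x : ℝ) - a)))).mul
        (hGc v).domRestrict⟩
  have hUdiff : ∀ v₁ v₂ t, |U v₁ t - U v₂ t| ≤ Real.exp (r * (t - a)) * dist v₁ v₂ := by
    intro v₁ v₂ t
    simp only [U]
    rw [← mul_sub, abs_mul, Real.abs_exp]
    gcongr
    exact ContinuousMap.dist_apply_le_dist (f := v₁) (g := v₂) _
  have hHdiff : ∀ v₁ v₂, ∀ t ∈ Icc a b,
      |w t * H v₁ t - w t * H v₂ t| ≤ K * dist v₁ v₂ * Real.exp (r * (t - a)) := by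
    intro v₁ v₂ t ht
    have hs : Ioc a t ⊆ Icc a b := Ioc_subset_Icc_self.trans (Icc_subset_Icc_right ht.2)
    have e1 := R.signedIntegral_lincomb (hUc v₁).continuousOn (hUc v₂).continuousOn (-1) 1 hs
    have e2 : H v₁ t - H v₂ t =
        signedIntegral m νp νm (Ioc a t) (fun x => -1 * U v₁ x + 1 * U v₂ x) := by
      rw [e1]; simp only [H]; ring
    rw [← mul_sub, abs_mul, e2]
    have e3 := R.abs_signedIntegral_le (u := fun x => -1 * U v₁ x + 1 * U v₂ x)
      (C := Real.exp (r * (t - a)) * dist v₁ v₂) hs (fun x hx => ?_) (by positivity) hM0 hM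
    · calc |w t| * _ ≤ W * (Real.exp (r * (t - a)) * dist v₁ v₂ * M * N) :=
          mul_le_mul (hW t ht) e3 (abs_nonneg _) hW0
        _ = _ := by rw [hK]; ring
    · rw [show -1 * U v₁ x + 1 * U v₂ x = -(U v₁ x - U v₂ x) by ring, abs_neg]
      refine (hUdiff v₁ v₂ x).trans ?_
      gcongr
      exact hx.2
  have hT : ContractingWith (1 / 2) T := by
    refine ⟨by norm_num, LipschitzWith.of_dist_le_mul fun v₁ v₂ => ?_⟩
    rw [ContinuousMap.dist_le (by positivity)]
    intro x
    have i1 := (hHB v₁).intervalIntegrable ha x.2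
    have i2 := (hHB v₂).intervalIntegrable ha x.2
    have hle : |G v₁ x - G v₂ x| ≤ K * dist v₁ v₂ * (Real.exp (r * (x - a)) / r) := by
      simp only [G]
      rw [add_sub_add_left_eq_sub, ← intervalIntegral.integral_sub i1 i2]
      calc _ ≤ ∫ t in a..(x : ℝ), K * dist v₁ v₂ * Real.exp (r * (t - a)) := by
            exact intervalIntegral.norm_integral_le_of_norm_le (μ := volume)
              (f := fun t => w t * H v₁ t - w t * H v₂ t)
              (g := fun t => K * dist v₁ v₂ * Real.exp (r * (t - a))) x.2.1
              (Eventually.of_forall fun t ht =>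
                hHdiff v₁ v₂ t ⟨ht.1.le, ht.2.trans x.2.2⟩)
              (Continuous.intervalIntegrable (by fun_prop) _ _)
        _ ≤ _ := by
            rw [intervalIntegral.integral_const_mul]
            exact mul_le_mul_of_nonneg_left (integral_exp_mul_sub_le hr0) (by positivity)
    change |Real.exp (-(r * (x - a))) * G v₁ x - Real.exp (-(r * (x - a))) * G v₂ x| ≤ _
    rw [← mul_sub, abs_mul, Real.abs_exp]
    calc _ ≤ Real.exp (-(r * (x - a))) * (K * dist v₁ v₂ * (Real.exp (r * (x - a)) / r)) := by
          gcongr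
      _ = K / r * dist v₁ v₂ := by
          rw [Real.exp_neg]; field_simp
      _ ≤ _ := by
          gcongr
          rw [div_le_iff₀ hr0]
          push_cast
          linarith
  obtain ⟨v, hv, -⟩ := hT.exists_fixedPoint 0 (edist_ne_top _ _)
  have hUG : ∀ x ∈ Icc a b, U v x = G v x := by
    intro x hx
    have h1 : v ⟨x, hx⟩ = Real.exp (-(r * (x - a))) * G v x :=
      (congrArg (fun f : C(Icc a b, ℝ) => f ⟨x, hx⟩) hv).symm
    simp only [U]
    rw [projIcc_of_mem R.le hx, h1, ← mul_assoc, ← Real.exp_add]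
    simp
  have hUa : U v a = p := by rw [hUG a ha]; simp [G]
  have hHa : H v a = q := by simp [H, signedIntegral]
  refine ⟨U v, H v, ⟨(hUc v).continuousOn, fun x hx => ?_, fun x _ => ?_⟩, hUa, hHa⟩
  · rw [hUa, hUG x hx]
  · rw [hHa]

theorem exists_isSol_fundamental (R : RegularOn m w νp νm a b) :
    ∃ u h v k, IsSol m w νp νm a b u h ∧ IsSol m w νp νm a b v k ∧
      ∀ x ∈ Icc a b, u x * k x - v x * h x = 1 := by
  obtain ⟨u, h, S, hu, hh⟩ := exists_isSol_left R 1 0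
  obtain ⟨v, k, T, hv, hk⟩ := exists_isSol_left R 0 1
  refine ⟨u, h, v, k, S, T, fun x hx => ?_⟩
  rw [S.wronskian_const T R hx (left_mem_Icc.2 R.le), hu, hh, hv, hk]
  norm_num

theorem exists_isSol (R : RegularOn m w νp νm a b) {z : ℝ} (hz : z ∈ Icc a b) (p q : ℝ) :
    ∃ u h, IsSol m w νp νm a b u h ∧ u z = p ∧ h z = q := by
  obtain ⟨u, h, v, k, S, T, hW⟩ := exists_isSol_fundamental R
  refine ⟨_, _, S.lincomb T R (p * k z - q * v z) (q * u z - p * h z), ?_, ?_⟩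
  · linear_combination p * hW z hz
  · linear_combination q * hW z hz

theorem IsSol.eq_of_eq_at (S : IsSol m w νp νm a b u h) (T : IsSol m w νp νm a b v k)
    (R : RegularOn m w νp νm a b) {z : ℝ} (hz : z ∈ Icc a b) (huv : u z = v z) (hhk : h z = k z)
    {x : ℝ} (hx : x ∈ Icc a b) : u x = v x ∧ h x = k x := by
  obtain ⟨f, f', g, g', F, G, hW⟩ := exists_isSol_fundamental R
  have e := hW x hx
  have e1 := S.wronskian_const F R hx hz
  have e2 := S.wronskian_const G R hx hz
  have e3 := T.wronskian_const F R hx hz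
  have e4 := T.wronskian_const G R hx hz
  rw [huv, hhk, ← e3] at e1
  rw [huv, hhk, ← e4] at e2
  constructor
  · linear_combination (v x - u x) * e + f x * e2 - g x * e1
  · linear_combination (k x - h x) * e + f' x * e2 - g' x * e1

/-- A solution changes sign at a zero. -/
theorem IsSol.sign_change (S : IsSol m w νp νm a b u h) (T : IsSol m w νp νm a b v k)
    (R : RegularOn m w νp νm a b) {z : ℝ} (hz : z ∈ Ioo a b) (huz : u z = 0)
    (hW : v z * h z = 1) :
    ∃ c ∈ Ico a z, ∃ d ∈ Ioc z b,
      (∀ x ∈ Ioc z d, 0 < u x * v z) ∧ ∀ x ∈ Ico c z, u x * v z < 0 := by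
  have hz' := Ioo_subset_Icc_self hz
  have hvz : v z ≠ 0 := fun h0 => by simp [h0] at hW
  have hvc : ContinuousAt v z := T.cont.continuousAt (Icc_mem_nhds hz.1 hz.2)
  have hev : ∀ᶠ x in 𝓝 z, 0 < v x * v z ∧ x ∈ Ioo a b :=
    ((hvc.mul_const (v z)).eventually (lt_mem_nhds (mul_self_pos.2 hvz))).and
      (Ioo_mem_nhds hz.1 hz.2)
  obtain ⟨ε, hε, hball⟩ := Metric.eventually_nhds_iff_ball.1 hev
  have hI : ∀ x ∈ Icc (z - ε / 2) (z + ε / 2), 0 < v x * v z ∧ x ∈ Ioo a b := fun x hx =>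
    hball x (by rw [Metric.mem_ball, Real.dist_eq, abs_lt]; constructor <;> linarith [hx.1, hx.2])
  have hWx : ∀ x ∈ Icc a b, v x * h x - u x * k x = 1 := fun x hx => by
    rw [T.wronskian_const S R hx hz', huz, hW]; ring
  have hmono : ∀ x ∈ Icc (z - ε / 2) (z + ε / 2), ∀ y ∈ Icc (z - ε / 2) (z + ε / 2), x < y →
      u x / v x < u y / v y := by
    intro x hx y hy hxy
    have hsub : ∀ t ∈ Icc x y, 0 < v t * v z ∧ t ∈ Ioo a b := fun t ht =>
      hI t ⟨hx.1.trans ht.1, ht.2.trans hy.2⟩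
    have hsub' : Icc x y ⊆ Icc a b := fun t ht => Ioo_subset_Icc_self (hsub t ht).2
    have hv0 : ∀ t ∈ Icc x y, v t ≠ 0 := fun t ht h0 => by
      have := (hsub t ht).1; simp [h0] at this
    have hcd : ContinuousOn (fun t => w t / v t ^ 2) (Icc x y) :=
      (R.cont_w.mono hsub').div ((T.cont.mono hsub').pow 2) (fun t ht => pow_ne_zero 2 (hv0 t ht))
    have hint : IntervalIntegrable (fun t => w t / v t ^ 2) volume x y :=
      ContinuousOn.intervalIntegrable (by rwa [uIcc_of_le hxy.le])
    have e := intervalIntegral.integral_eq_sub_of_hasDeriv_right_of_le hxy.le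
      (f := fun t => u t / v t) (f' := fun t => w t / v t ^ 2)
      ((S.cont.mono hsub').div (T.cont.mono hsub') hv0) (fun t ht => ?_) hint
    · have hpos := intervalIntegral.intervalIntegral_pos_of_pos_on hint (fun t ht => ?_) hxy
      · rw [e] at hpos
        exact sub_pos.1 hpos
      · have ht' := Ioo_subset_Icc_self ht
        have := R.pos_w t (hsub' ht')
        have := hv0 t ht'
        positivity
    · have ht' := Ioo_subset_Icc_self ht
      have hd := (S.hasDerivWithinAt R (hsub t ht').2).div (T.hasDerivWithinAt R (hsub t ht').2)
        (hv0 t ht')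
      have e : w t * h t * v t - u t * (w t * k t) = w t := by
        linear_combination w t * hWx t (hsub' ht')
      rwa [e] at hd
  have hzz : z ∈ Icc (z - ε / 2) (z + ε / 2) := ⟨by linarith, by linarith⟩
  have hc := (hI (z - ε / 2) ⟨le_rfl, by linarith⟩).2
  have hd := (hI (z + ε / 2) ⟨by linarith, le_rfl⟩).2
  refine ⟨z - ε / 2, ⟨hc.1.le, by linarith⟩, z + ε / 2, ⟨by linarith, hd.2.le⟩, fun x hx => ?_,
    fun x hx => ?_⟩
  · have hx' : x ∈ Icc (z - ε / 2) (z + ε / 2) := ⟨by linarith [hx.1], hx.2⟩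
    have h1 := hmono z hzz x hx' hx.1
    rw [huz, zero_div] at h1
    have h2 := (hI x hx').1
    have h3 : v x ≠ 0 := fun h0 => by simp [h0] at h2
    have : u x * v z = u x / v x * (v x * v z) := by field_simp
    rw [this]
    exact mul_pos h1 h2
  · have hx' : x ∈ Icc (z - ε / 2) (z + ε / 2) := ⟨hx.1, by linarith [hx.2]⟩
    have h1 := hmono x hx' z hzz hx.2
    rw [huz, zero_div] at h1
    have h2 := (hI x hx').1
    have h3 : v x ≠ 0 := fun h0 => by simp [h0] at h2
    have : u x * v z = u x / v x * (v x * v z) := by field_simp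
    rw [this]
    exact mul_neg_of_neg_of_pos h1 h2

end

section Mollify

open scoped Convolution

variable {c d C : ℝ} {k : ℝ → ℝ}

/-- A bounded function with vanishing integral supported in `[c, d]` is the almost everywhere limit
of bounded smooth functions with vanishing integral and supports in a neighbourhood of `[c, d]`. -/
theorem exists_smooth_tendsto_ae (hk : AEStronglyMeasurable k) (hC : ∀ x, |k x| ≤ C)
    (hsupp : ∀ x, x ∉ Icc c d → k x = 0) (hint : ∫ x, k x = 0) {r : ℝ} (hr : 0 < r) :
    ∃ g : ℕ → ℝ → ℝ, (∀ n, ContDiff ℝ (⊤ : ℕ∞) (g n)) ∧ (∀ n x, |g n x| ≤ C) ∧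
      (∀ n x, x ∉ Icc (c - r) (d + r) → g n x = 0) ∧ (∀ n, ∫ x, g n x = 0) ∧
      ∀ᵐ x, Tendsto (fun n => g n x) atTop (𝓝 (k x)) := by
  have hki : Integrable k := by
    rw [← integrableOn_iff_integrable_of_support_subset (s := Icc c d)]
    · exact IntegrableOn.of_bound (C := C) measure_Icc_lt_top hk.restrict
        (Eventually.of_forall fun x => hC x)
    · intro x hx
      by_contra h
      exact hx (hsupp x h)
  let φ : ℕ → ContDiffBump (0 : ℝ) := fun n =>
    ⟨r / (n + 1) / 2, r / (n + 1), by positivity, half_lt_self (by positivity)⟩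
  have hφr : ∀ n, (φ n).rOut ≤ r := fun n => div_le_self hr.le (by simp)
  have hφ0 : Tendsto (fun n => (φ n).rOut) atTop (𝓝 0) :=
    tendsto_const_div_atTop_nhds_zero_nat r |>.comp (tendsto_add_atTop_nat 1) |>.congr fun n => by
      simp [φ]
  have hsub : ∀ n x t, (φ n).normed volume t ≠ 0 → k (x - t) ≠ 0 → x ∈ Icc (c - r) (d + r) := by
    intro n x t h1 h2
    have ht : t ∈ Metric.ball (0 : ℝ) (φ n).rOut := by
      rw [← (φ n).support_normed_eq (μ := volume)]; exact h1
    have hx : x - t ∈ Icc c d := by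
      by_contra h; exact h2 (hsupp _ h)
    rw [Metric.mem_ball, dist_zero_right, Real.norm_eq_abs] at ht
    have := abs_lt.1 (ht.trans_le (hφr n))
    constructor <;> linarith [hx.1, hx.2]
  refine ⟨fun n => (φ n).normed volume ⋆[ContinuousLinearMap.lsmul ℝ ℝ, volume] k,
    fun n => ?_, fun n x => ?_, fun n x hx => ?_, fun n => ?_, ?_⟩
  · exact (φ n).hasCompactSupport_normed.contDiff_convolution_left _ (φ n).contDiff_normed
      hki.locallyIntegrable
  · beta_reduce
    rw [convolution_def]
    have hle := norm_integral_le_of_norm_le (μ := volume) (f := fun t =>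
      (ContinuousLinearMap.lsmul ℝ ℝ) ((φ n).normed volume t) (k (x - t)))
      (g := fun t => (φ n).normed volume t * C) ((φ n).integrable_normed.mul_const C)
      (Eventually.of_forall fun t => ?_)
    · rw [integral_mul_const, (φ n).integral_normed, one_mul] at hle
      exact hle
    · simp only [ContinuousLinearMap.lsmul_apply, smul_eq_mul, norm_mul, Real.norm_eq_abs]
      rw [abs_of_nonneg ((φ n).nonneg_normed t)]
      exact mul_le_mul_of_nonneg_left (hC _) ((φ n).nonneg_normed t)
  · beta_reduce
    rw [convolution_def]
    refine integral_eq_zero_of_ae (Eventually.of_forall fun t => ?_)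
    simp only [ContinuousLinearMap.lsmul_apply, smul_eq_mul, Pi.zero_apply, mul_eq_zero]
    by_contra! h
    exact hx (hsub n x t h.1 h.2)
  · rw [integral_convolution _ (φ n).integrable_normed hki, hint]
    simp
  · exact ContDiffBump.ae_convolution_tendsto_right_of_locallyIntegrable (K := 2) hφ0
      (Eventually.of_forall fun n => by simp only [φ]; linarith) hki.locallyIntegrable

end Mollify

section

variable {m w : ℝ → ℝ} {νp νm : Measure ℝ} {I : Set ℝ}

/-- The quadratic form inequality on `I` for smooth compactly supported functions. -/
def QuadraticFormNonpos (I : Set ℝ) (m w : ℝ → ℝ) (νp νm : Measure ℝ) : Prop :=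
  ∀ f : ℝ → ℝ, ContDiff ℝ (⊤ : ℕ∞) f → HasCompactSupport f → tsupport f ⊆ I →
    (∫ x in I, (f x) ^ 2 * m x ∂νp) - (∫ x in I, (f x) ^ 2 * m x ∂νm) ≤
      ∫ x in I, (deriv f x) ^ 2 / w x

theorem QuadraticFormNonpos.le_of_primitive_smooth (hQ : QuadraticFormNonpos I m w νp νm)
    (hI : MeasurableSet I) {a b : ℝ} (hab : a ≤ b) (hsub : Icc a b ⊆ I) {g : ℝ → ℝ}
    (hg : ContDiff ℝ (⊤ : ℕ∞) g) (hsupp : ∀ x, x ∉ Icc a b → g x = 0) (hint : ∫ x, g x = 0) :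
    signedIntegral m νp νm (Icc a b) (fun x => (∫ t in a..x, g t) ^ 2) ≤
      ∫ x in Icc a b, g x ^ 2 / w x := by
  set f : ℝ → ℝ := fun x => ∫ t in a..x, g t with hf
  have hgc : Continuous g := hg.continuous
  have hderiv : ∀ x, HasDerivAt f (g x) x := fun x =>
    intervalIntegral.integral_hasDerivAt_right (hgc.intervalIntegrable _ _)
      (hgc.stronglyMeasurableAtFilter _ _) hgc.continuousAt
  have hd : deriv f = g := funext fun x => (hderiv x).deriv
  have hfb : f b = 0 := by
    rw [hf, ← hint]
    simp only
    rw [intervalIntegral.integral_of_le hab, ← integral_Icc_eq_integral_Ioc,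
      setIntegral_eq_integral_of_forall_compl_eq_zero hsupp]
  have hzero : ∀ x, x ∉ Icc a b → f x = 0 := by
    intro x hx
    rcases lt_or_ge x a with h | h
    · refine intervalIntegral.integral_zero_ae ?_
      filter_upwards [Measure.ae_ne volume a] with t ht ht'
      rw [uIoc_of_ge h.le] at ht'
      exact hsupp t fun h' => ht (le_antisymm ht'.2 h'.1)
    · have hbx : b < x := by
        by_contra! h'
        exact hx ⟨h, h'⟩
      have : f x = f b + ∫ t in b..x, g t :=
        (intervalIntegral.integral_add_adjacent_intervals (hgc.intervalIntegrable _ _)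
          (hgc.intervalIntegrable _ _)).symm
      rw [this, hfb, zero_add]
      refine intervalIntegral.integral_zero_ae (Eventually.of_forall fun t ht => ?_)
      rw [uIoc_of_le hbx.le] at ht
      exact hsupp t fun h' => absurd h'.2 (not_le.2 ht.1)
  have hts : tsupport f ⊆ Icc a b := closure_minimal (fun x hx => by
    by_contra h; exact hx (hzero x h)) isClosed_Icc
  have hsm : ContDiff ℝ (⊤ : ℕ∞) f :=
    contDiff_infty_iff_deriv.2 ⟨fun x => (hderiv x).differentiableAt, by rwa [hd]⟩
  have h := hQ f hsm (isCompact_Icc.of_isClosed_subset (isClosed_tsupport f) hts) (hts.trans hsub)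
  rw [hd, setIntegral_eq_of_subset_of_forall_sdiff_eq_zero hI hsub,
    setIntegral_eq_of_subset_of_forall_sdiff_eq_zero hI hsub,
    setIntegral_eq_of_subset_of_forall_sdiff_eq_zero hI hsub] at h
  · exact h
  · intro x hx; simp [hsupp x hx.2]
  · intro x hx; simp [hzero x hx.2]
  · intro x hx; simp [hzero x hx.2]

theorem RegularOn.tendsto_signedIntegral {a b : ℝ} (R : RegularOn m w νp νm a b)
    {F : ℕ → ℝ → ℝ} {G : ℝ → ℝ} {C : ℝ} (hF : ∀ n, ContinuousOn (F n) (Icc a b))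
    (hC : ∀ n, ∀ x ∈ Icc a b, |F n x| ≤ C)
    (hlim : ∀ x ∈ Icc a b, Tendsto (fun n => F n x) atTop (𝓝 (G x))) :
    Tendsto (fun n => signedIntegral m νp νm (Icc a b) (F n)) atTop
      (𝓝 (signedIntegral m νp νm (Icc a b) G)) := by
  have key : ∀ μ : Measure ℝ, μ (Icc a b) < ⊤ → Tendsto (fun n => ∫ x in Icc a b, F n x * m x ∂μ)
      atTop (𝓝 (∫ x in Icc a b, G x * m x ∂μ)) := by
    intro μ hμ
    obtain ⟨M, hM⟩ := isCompact_Icc.exists_bound_of_continuousOn R.cont_m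
    have : IsFiniteMeasure (μ.restrict (Icc a b)) := ⟨by simpa using hμ⟩
    refine tendsto_integral_of_dominated_convergence (fun _ => C * M)
      (fun n => ((hF n).mul R.cont_m).aestronglyMeasurable measurableSet_Icc)
      (integrable_const _) (fun n => ?_) ?_
    · filter_upwards [ae_restrict_mem measurableSet_Icc] with x hx
      rw [norm_mul]
      exact mul_le_mul (hC n x hx) (hM x hx) (norm_nonneg _) ((abs_nonneg _).trans (hC n x hx))
    · filter_upwards [ae_restrict_mem measurableSet_Icc] with x hx
      exact (hlim x hx).mul_const _
  exact (key νp R.finite_p).sub (key νm R.finite_m)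

/-- The quadratic form inequality extends to Lipschitz functions vanishing at both endpoints. -/
theorem QuadraticFormNonpos.le_of_primitive (hQ : QuadraticFormNonpos I m w νp νm)
    (hI : IsOpen I) (hconn : I.OrdConnected)
    (hR : ∀ a ∈ I, ∀ b ∈ I, a ≤ b → RegularOn m w νp νm a b) {c d : ℝ} (hc : c ∈ I) (hd : d ∈ I)
    (hcd : c ≤ d) {k : ℝ → ℝ} (hk : BddMeas c d k) (hint : ∫ x in c..d, k x = 0) :
    signedIntegral m νp νm (Ioc c d) (fun x => (∫ t in c..x, k t) ^ 2) ≤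
      ∫ x in c..d, k x ^ 2 / w x := by
  obtain ⟨r₁, hr₁, hb₁⟩ := Metric.isOpen_iff.1 hI c hc
  obtain ⟨r₂, hr₂, hb₂⟩ := Metric.isOpen_iff.1 hI d hd
  set r := min r₁ r₂ / 2 with hrdef
  have hr : 0 < r := by positivity
  have ha : c - r ∈ I := hb₁ (by
    rw [Metric.mem_ball, Real.dist_eq, abs_lt]
    constructor <;> linarith [min_le_left r₁ r₂])
  have hb : d + r ∈ I := hb₂ (by
    rw [Metric.mem_ball, Real.dist_eq, abs_lt]
    constructor <;> linarith [min_le_right r₁ r₂])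
  set a := c - r with ha_def
  set b := d + r with hb_def
  have hac : a ≤ c := by linarith
  have hdb : d ≤ b := by linarith
  have hab : a ≤ b := by linarith
  have R := hR a ha b hb hab
  have hsub : Icc a b ⊆ I := hconn.out ha hb
  have hcsub : Icc c d ⊆ Icc a b := Icc_subset_Icc hac hdb
  obtain ⟨hkm, C, hC⟩ := hk
  have hC0 : 0 ≤ C := (abs_nonneg _).trans (hC c (left_mem_Icc.2 hcd))
  set k₀ := (Icc c d).indicator k with hk₀
  have hk₀m : AEStronglyMeasurable k₀ volume :=
    (aestronglyMeasurable_indicator_iff measurableSet_Icc).2 hkm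
  have hk₀C : ∀ x, |k₀ x| ≤ C := fun x => by
    by_cases hx : x ∈ Icc c d
    · simpa [hk₀, indicator_of_mem hx] using hC x hx
    · simpa [hk₀, indicator_of_notMem hx] using hC0
  have hk₀s : ∀ x, x ∉ Icc c d → k₀ x = 0 := fun x hx => indicator_of_notMem hx _
  have hk₀i : ∫ x, k₀ x = 0 := by
    rw [integral_indicator measurableSet_Icc, integral_Icc_eq_integral_Ioc,
      ← intervalIntegral.integral_of_le hcd, hint]
  obtain ⟨g, hgs, hgC, hgsupp, hgint, hglim⟩ := exists_smooth_tendsto_ae hk₀m hk₀C hk₀s hk₀i hr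
  have hle : ∀ n, signedIntegral m νp νm (Icc a b) (fun x => (∫ t in a..x, g n t) ^ 2) ≤
      ∫ x in Icc a b, g n x ^ 2 / w x := fun n =>
    hQ.le_of_primitive_smooth hI.measurableSet hab hsub (hgs n) (hgsupp n) (hgint n)
  have hprim : ∀ n, ∀ x ∈ Icc a b, |∫ t in a..x, g n t| ≤ C * (b - a) := by
    intro n x hx
    have := intervalIntegral.norm_integral_le_of_norm_le_const (a := a) (b := x) (f := g n) (C := C)
      (fun t _ => hgC n t)
    rw [abs_of_nonneg (sub_nonneg.2 hx.1)] at this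
    exact this.trans (mul_le_mul_of_nonneg_left (by linarith [hx.2]) hC0)
  have hlim₁ : Tendsto (fun n => signedIntegral m νp νm (Icc a b) fun x => (∫ t in a..x, g n t) ^ 2)
      atTop (𝓝 (signedIntegral m νp νm (Icc a b) fun x => (∫ t in a..x, k₀ t) ^ 2)) := by
    refine R.tendsto_signedIntegral (C := (C * (b - a)) ^ 2) (fun n => ?_) (fun n x hx => ?_)
      fun x hx => ?_
    · exact ((intervalIntegral.continuous_primitive
        (fun _ _ => (hgs n).continuous.intervalIntegrable _ _) a).pow 2).continuousOn
    · rw [abs_pow]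
      exact pow_le_pow_left₀ (abs_nonneg _) (hprim n x hx) 2
    · refine Tendsto.pow ?_ 2
      refine intervalIntegral.tendsto_integral_filter_of_dominated_convergence (fun _ => C)
        (Eventually.of_forall fun n => (hgs n).continuous.aestronglyMeasurable)
        (Eventually.of_forall fun n => Eventually.of_forall fun t _ => hgC n t)
        intervalIntegrable_const ?_
      filter_upwards [hglim] with t ht _ using ht
  have hlim₂ : Tendsto (fun n => ∫ x in Icc a b, g n x ^ 2 / w x) atTop
      (𝓝 (∫ x in Icc a b, k₀ x ^ 2 / w x)) := by
    have hwi : ContinuousOn (fun x => 1 / w x) (Icc a b) :=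
      continuousOn_const.div R.cont_w fun x hx => (R.pos_w x hx).ne'
    refine tendsto_integral_of_dominated_convergence (fun x => C ^ 2 * (1 / w x))
      (fun n => ?_) ?_ (fun n => ?_) ?_
    · exact (((hgs n).continuous.pow 2).continuousOn.div R.cont_w
        fun x hx => (R.pos_w x hx).ne').aestronglyMeasurable measurableSet_Icc
    · exact (continuousOn_const.mul hwi).integrableOn_Icc
    · filter_upwards [ae_restrict_mem measurableSet_Icc] with x hx
      have := R.pos_w x hx
      rw [div_eq_mul_one_div, norm_mul, Real.norm_eq_abs, Real.norm_eq_abs, abs_pow,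
        abs_of_pos (by positivity : 0 < 1 / w x)]
      gcongr
      exact hgC n x
    · filter_upwards [ae_restrict_of_ae hglim] with x hx
      exact (hx.pow 2).div_const _
  have hlim := le_of_tendsto_of_tendsto' hlim₁ hlim₂ hle
  have hint₀ : ∀ x y, IntervalIntegrable k₀ volume x y := fun x y =>
    (intervalIntegrable_const (c := C)).mono_fun hk₀m.restrict <| Eventually.of_forall
      fun t => (hk₀C t).trans (le_abs_self C)
  have hac0 : ∀ x ≤ c, ∫ t in a..x, k₀ t = 0 := by
    intro x hx
    refine intervalIntegral.integral_zero_ae ?_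
    filter_upwards [Measure.ae_ne volume c] with t ht ht'
    refine hk₀s t fun h => ht (le_antisymm (ht'.2.trans (max_le hac hx)) h.1)
  have hF : ∀ x ∈ Icc c d, ∫ t in a..x, k₀ t = ∫ t in c..x, k t := by
    intro x hx
    rw [← intervalIntegral.integral_add_adjacent_intervals (hint₀ a c) (hint₀ c x), hac0 c le_rfl,
      zero_add]
    refine intervalIntegral.integral_congr fun t ht => ?_
    rw [uIcc_of_le hx.1] at ht
    exact indicator_of_mem (show t ∈ Icc c d from ⟨ht.1, ht.2.trans hx.2⟩) k
  have hF0 : ∀ x, x ∉ Ioc c d → ∫ t in a..x, k₀ t = 0 := by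
    intro x hx
    rcases le_or_gt x c with h | h
    · exact hac0 x h
    · have hdx : d < x := by
        by_contra! h'
        exact hx ⟨h, h'⟩
      rw [← intervalIntegral.integral_add_adjacent_intervals (hint₀ a d) (hint₀ d x),
        hF d (right_mem_Icc.2 hcd), hint, zero_add]
      refine intervalIntegral.integral_zero_ae (Eventually.of_forall fun t ht => ?_)
      rw [uIoc_of_le hdx.le] at ht
      exact hk₀s t fun h' => absurd h'.2 (not_le.2 ht.1)
  have e₁ : signedIntegral m νp νm (Icc a b) (fun x => (∫ t in a..x, k₀ t) ^ 2) =
      signedIntegral m νp νm (Ioc c d) (fun x => (∫ t in c..x, k t) ^ 2) := by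
    have key : ∀ μ : Measure ℝ, ∫ x in Icc a b, (∫ t in a..x, k₀ t) ^ 2 * m x ∂μ =
        ∫ x in Ioc c d, (∫ t in c..x, k t) ^ 2 * m x ∂μ := by
      intro μ
      rw [setIntegral_eq_of_subset_of_forall_sdiff_eq_zero measurableSet_Icc
        (Ioc_subset_Icc_self.trans hcsub) fun x hx => by simp [hF0 x hx.2]]
      refine setIntegral_congr_fun measurableSet_Ioc fun x hx => ?_
      rw [hF x (Ioc_subset_Icc_self hx)]
    simp only [signedIntegral, key]
  have e₂ : ∫ x in Icc a b, k₀ x ^ 2 / w x = ∫ x in c..d, k x ^ 2 / w x := by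
    rw [setIntegral_eq_of_subset_of_forall_sdiff_eq_zero measurableSet_Icc hcsub
      fun x hx => by simp [hk₀s x hx.2], intervalIntegral.integral_of_le hcd,
      ← integral_Icc_eq_integral_Ioc]
    refine setIntegral_congr_fun measurableSet_Icc fun x hx => ?_
    simp only [hk₀, indicator_of_mem hx]
  rwa [e₁, e₂] at hlim

end

theorem IsOpen.exists_lt_mem_mem_lt {I : Set ℝ} (hI : IsOpen I) {x : ℝ} (hx : x ∈ I) :
    (∃ y ∈ I, y < x) ∧ ∃ y ∈ I, x < y := by
  obtain ⟨r, hr, hb⟩ := Metric.isOpen_iff.1 hI x hx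
  refine ⟨⟨x - r / 2, hb ?_, by linarith⟩, ⟨x + r / 2, hb ?_, by linarith⟩⟩ <;>
  · rw [Metric.mem_ball, Real.dist_eq, abs_lt]
    constructor <;> linarith

theorem eq_zero_of_forall_mul_le_sq_mul {A B : ℝ} (h : ∀ t : ℝ, t * A ≤ t ^ 2 * B) : A = 0 := by
  by_contra hA
  have hB : 0 < |B| + 1 := by positivity
  have h1 := h (A / (|B| + 1))
  have h2 : (A / (|B| + 1)) ^ 2 * B ≤ (A / (|B| + 1)) ^ 2 * |B| := by gcongr; exact le_abs_self B
  have h3 : A / (|B| + 1) * A = (A / (|B| + 1)) ^ 2 * (|B| + 1) := by field_simp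
  have h4 : 0 < (A / (|B| + 1)) ^ 2 := by positivity
  nlinarith

section

variable {m w : ℝ → ℝ} {νp νm : Measure ℝ} {I : Set ℝ} {u h : ℝ → ℝ}

theorem signedIntegral_eq_of_subset {s t : Set ℝ} (ht : MeasurableSet t) (hst : s ⊆ t)
    (hu : ∀ x ∈ t \ s, u x = 0) : signedIntegral m νp νm t u = signedIntegral m νp νm s u := by
  simp only [signedIntegral]
  rw [setIntegral_eq_of_subset_of_forall_sdiff_eq_zero ht hst fun x hx => by simp [hu x hx],
    setIntegral_eq_of_subset_of_forall_sdiff_eq_zero ht hst fun x hx => by simp [hu x hx]]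

theorem signedIntegral_congr {s : Set ℝ} (hs : MeasurableSet s) {v : ℝ → ℝ}
    (huv : ∀ x ∈ s, u x = v x) : signedIntegral m νp νm s u = signedIntegral m νp νm s v := by
  simp only [signedIntegral]
  have key : ∀ μ : Measure ℝ, ∫ x in s, u x * m x ∂μ = ∫ x in s, v x * m x ∂μ := fun μ =>
    setIntegral_congr_fun hs fun x hx => congrArg (· * m x) (huv x hx)
  rw [key νp, key νm]

/-- Under the quadratic form inequality, a solution with two zeros is trivial. -/
theorem QuadraticFormNonpos.eq_zero_of_two_zeros (hQ : QuadraticFormNonpos I m w νp νm)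
    (hI : IsOpen I) (hconn : I.OrdConnected)
    (hR : ∀ a ∈ I, ∀ b ∈ I, a ≤ b → RegularOn m w νp νm a b) {y z : ℝ} (hy : y ∈ I) (hz : z ∈ I)
    (hyz : y < z) (S : IsSol m w νp νm y z u h) (huy : u y = 0) (huz : u z = 0) : h z = 0 := by
  obtain ⟨-, b, hb, hzb⟩ := hI.exists_lt_mem_mem_lt hz
  have hyb : y < b := hyz.trans hzb
  have R := hR y hy z hz hyz.le
  have R' := hR y hy b hb hyb.le
  have hwi : BddMeas y b (fun x => 1 / w x) :=
    BddMeas.of_continuousOn (continuousOn_const.div R'.cont_w fun x hx => (R'.pos_w x hx).ne')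
  set k₁ := (Icc y z).indicator (fun t => w t * h t) with hk₁
  have hk₁z : ∀ x ∈ Icc y z, k₁ x = w x * h x := fun x hx => indicator_of_mem hx _
  have hk₁0 : ∀ x, x ∉ Icc y z → k₁ x = 0 := fun x hx => indicator_of_notMem hx _
  have hB₁ : BddMeas y b k₁ := by
    obtain ⟨h1, C, hC⟩ := S.bddMeas_deriv R
    refine ⟨((aestronglyMeasurable_indicator_iff measurableSet_Icc).2 h1).restrict, C,
      fun x _ => ?_⟩
    by_cases hx : x ∈ Icc y z
    · rw [hk₁z x hx]; exact hC x hx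
    · rw [hk₁0 x hx, abs_zero]
      exact (abs_nonneg _).trans (hC y (left_mem_Icc.2 hyz.le))
  set g : ℝ → ℝ := fun x => (x - y) * (b - x) with hg
  set g' : ℝ → ℝ := fun x => b + y - 2 * x with hg'
  have hgd : ∀ x, HasDerivAt g (g' x) x := fun x => by
    have := ((hasDerivAt_id x).sub_const y).mul ((hasDerivAt_id x).const_sub b)
    refine this.congr_deriv ?_
    simp only [hg', id]
    ring
  have hgc : Continuous g := by fun_prop
  have hg'c : Continuous g' := by fun_prop
  have hB₂ : ∀ a b, BddMeas a b g' := fun a b => BddMeas.of_continuousOn hg'c.continuousOn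
  have hyI := left_mem_Icc.2 hyb.le
  have hbI := right_mem_Icc.2 hyb.le
  have hFd : ∀ x ∈ Icc y b, ∫ t in y..x, g' t = g x := by
    intro x hx
    rw [intervalIntegral.integral_eq_sub_of_hasDerivAt (fun t _ => hgd t)
      (hg'c.intervalIntegrable _ _)]
    simp [hg]
  have hF₁ : ∀ x ∈ Icc y z, ∫ t in y..x, k₁ t = u x := by
    intro x hx
    rw [S.eq_u x hx, huy, zero_add]
    refine intervalIntegral.integral_congr fun t ht => ?_
    rw [uIcc_of_le hx.1] at ht
    exact hk₁z t ⟨ht.1, ht.2.trans hx.2⟩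
  have hF₁0 : ∀ x ∈ Icc z b, ∫ t in y..x, k₁ t = 0 := by
    intro x hx
    have hx' : x ∈ Icc y b := ⟨hyz.le.trans hx.1, hx.2⟩
    rw [← intervalIntegral.integral_add_adjacent_intervals
      (hB₁.intervalIntegrable hyI ⟨hyz.le, hzb.le⟩)
      (hB₁.intervalIntegrable ⟨hyz.le, hzb.le⟩ hx'), hF₁ z (right_mem_Icc.2 hyz.le), huz, zero_add]
    refine intervalIntegral.integral_zero_ae (Eventually.of_forall fun t ht => ?_)
    rw [uIoc_of_le hx.1] at ht
    exact hk₁0 t fun h' => absurd h'.2 (not_le.2 ht.1)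
  set F : ℝ → ℝ := fun x => ∫ t in y..x, k₁ t with hFdef
  have hFu : ∀ x ∈ Icc y z, F x = u x := hF₁
  have hF0 : ∀ x ∈ Icc z b, F x = 0 := hF₁0
  have hFc : ContinuousOn F (Icc y b) := by
    have := intervalIntegral.continuousOn_primitive_interval (μ := volume) (a := y) (b := b)
      (f := k₁) (by rw [uIcc_of_le hyb.le]; exact hB₁.integrableOn)
    rwa [uIcc_of_le hyb.le] at this
  have hdiff : ∀ x ∈ Ioc y b \ Ioc y z, x ∈ Icc z b := fun x hx =>
    ⟨not_lt.1 fun h' => hx.2 ⟨hx.1.1, h'.le⟩, hx.1.2⟩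
  have hsubIoc : Ioc y z ⊆ Ioc y b := Ioc_subset_Ioc_right hzb.le
  have s₁ : signedIntegral m νp νm (Ioc y b) (fun x => F x * F x) =
      ∫ t in y..z, w t * h t * h t := by
    rw [signedIntegral_eq_of_subset measurableSet_Ioc hsubIoc
      fun x hx => by simp [hF0 x (hdiff x hx)], signedIntegral_congr measurableSet_Ioc
      (v := fun x => u x * u x) fun x hx => by rw [hFu x (Ioc_subset_Icc_self hx)],
      S.signedIntegral_mul R S.cont (S.bddMeas_deriv R) fun x hx => S.hasDerivWithinAt R hx,
      huy, huz]
    ring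
  have s₂ : signedIntegral m νp νm (Ioc y b) (fun x => g x * F x) =
      - (g z * h z) + ∫ t in y..z, g' t * h t := by
    rw [signedIntegral_eq_of_subset measurableSet_Ioc hsubIoc
      fun x hx => by simp [hF0 x (hdiff x hx)], signedIntegral_congr measurableSet_Ioc
      (v := fun x => g x * u x) fun x hx => by rw [hFu x (Ioc_subset_Icc_self hx)],
      S.signedIntegral_mul R hgc.continuousOn (hB₂ y z) fun x _ => (hgd x).hasDerivWithinAt]
    simp [hg]
  have hcut : ∀ f e : ℝ → ℝ, (∀ x ∈ Icc y z, f x = e x) → (∀ x ∈ Icc z b, x ≠ z → f x = 0) →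
      ∫ t in y..b, f t = ∫ t in y..z, e t := by
    intro f e h1 h2
    rw [intervalIntegral.integral_of_le hyb.le, intervalIntegral.integral_of_le hyz.le,
      setIntegral_eq_of_subset_of_forall_sdiff_eq_zero measurableSet_Ioc hsubIoc fun x hx =>
        h2 x (hdiff x hx) fun h' => hx.2 ⟨hx.1.1, h'.le⟩]
    exact setIntegral_congr_fun measurableSet_Ioc fun x hx => h1 x (Ioc_subset_Icc_self hx)
  have i₁ : ∫ t in y..b, k₁ t * k₁ t * (1 / w t) = ∫ t in y..z, w t * h t * h t := by
    refine hcut _ _ (fun x hx => ?_) fun x hx hxz => ?_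
    · have := R.pos_w x hx
      rw [hk₁z x hx]
      field_simp
    · rw [hk₁0 x fun h' => hxz (le_antisymm h'.2 hx.1)]; ring
  have i₂ : ∫ t in y..b, g' t * k₁ t * (1 / w t) = ∫ t in y..z, g' t * h t := by
    refine hcut _ _ (fun x hx => ?_) fun x hx hxz => ?_
    · have := R.pos_w x hx
      rw [hk₁z x hx]
      field_simp
    · rw [hk₁0 x fun h' => hxz (le_antisymm h'.2 hx.1)]; ring
  have hgz : 0 < g z := mul_pos (sub_pos.2 hyz) (sub_pos.2 hzb)
  have key : ∀ t : ℝ, t * (-2 * (g z * h z)) ≤ t ^ 2 *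
      ((∫ x in y..b, g' x * g' x * (1 / w x)) -
        signedIntegral m νp νm (Ioc y b) fun x => g x * g x) := by
    intro t
    have hB : BddMeas y b (fun x => k₁ x + t * g' x) := hB₁.add ((BddMeas.const t).mul (hB₂ y b))
    have hprim : ∀ x ∈ Icc y b, ∫ s in y..x, (k₁ s + t * g' s) = F x + t * g x := by
      intro x hx
      rw [intervalIntegral.integral_add (hB₁.intervalIntegrable hyI hx)
        (((hB₂ y b).intervalIntegrable hyI hx).const_mul t), intervalIntegral.integral_const_mul,
        hFd x hx]
    have hle := hQ.le_of_primitive hI hconn hR hy hb hyb.le hB (by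
      rw [hprim b hbI, hF0 b ⟨hzb.le, le_rfl⟩]; simp [hg])
    have hFF : ContinuousOn (fun x => F x * F x) (Icc y b) := hFc.mul hFc
    have hgF : ContinuousOn (fun x => g x * F x) (Icc y b) := hgc.continuousOn.mul hFc
    have hgg : ContinuousOn (fun x => g x * g x) (Icc y b) := (hgc.mul hgc).continuousOn
    have hgFg : ContinuousOn (fun x => 2 * t * (g x * F x) + t ^ 2 * (g x * g x)) (Icc y b) :=
      (continuousOn_const.mul hgF).add (continuousOn_const.mul hgg)
    have el : signedIntegral m νp νm (Ioc y b) (fun x => (∫ s in y..x, (k₁ s + t * g' s)) ^ 2) =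
        signedIntegral m νp νm (Ioc y b) (fun x => F x * F x) +
        2 * t * signedIntegral m νp νm (Ioc y b) (fun x => g x * F x) +
        t ^ 2 * signedIntegral m νp νm (Ioc y b) (fun x => g x * g x) := by
      have e1 := R'.signedIntegral_lincomb hgF hgg (2 * t) (t ^ 2) Ioc_subset_Icc_self
      have e2 := R'.signedIntegral_lincomb hFF hgFg 1 1 (Ioc_subset_Icc_self (a := y) (b := b))
      rw [e1] at e2
      rw [add_assoc, ← one_mul (signedIntegral m νp νm (Ioc y b) fun x => F x * F x),
        ← one_mul (2 * t * _ + _), ← e2]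
      refine signedIntegral_congr measurableSet_Ioc fun x hx => ?_
      rw [hprim x (Ioc_subset_Icc_self hx)]
      ring
    have er : ∫ x in y..b, (k₁ x + t * g' x) ^ 2 / w x =
        (∫ x in y..b, k₁ x * k₁ x * (1 / w x)) + 2 * t * (∫ x in y..b, g' x * k₁ x * (1 / w x)) +
        t ^ 2 * ∫ x in y..b, g' x * g' x * (1 / w x) := by
      have j1 := ((hB₁.mul hB₁).mul hwi).intervalIntegrable hyI hbI
      have j2 := (((hB₂ y b).mul hB₁).mul hwi).intervalIntegrable hyI hbI
      have j3 := (((hB₂ y b).mul (hB₂ y b)).mul hwi).intervalIntegrable hyI hbI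
      rw [← intervalIntegral.integral_const_mul, ← intervalIntegral.integral_const_mul,
        ← intervalIntegral.integral_add j1 (j2.const_mul _),
        ← intervalIntegral.integral_add (j1.add (j2.const_mul _)) (j3.const_mul _)]
      exact intervalIntegral.integral_congr fun x _ => by ring
    rw [el, er, s₁, s₂, i₁, i₂] at hle
    linarith
  have := eq_zero_of_forall_mul_le_sq_mul key
  simpa [hgz.ne'] using this

/-- A positive solution forces the quadratic form inequality. -/
theorem quadraticFormNonpos_of_pos (hI : IsOpen I) (hconn : I.OrdConnected)
    (hR : ∀ a ∈ I, ∀ b ∈ I, a ≤ b → RegularOn m w νp νm a b)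
    (hu : ∀ x ∈ I, 0 < u x) (hS : ∀ a ∈ I, ∀ b ∈ I, a ≤ b → IsSol m w νp νm a b u h) :
    QuadraticFormNonpos I m w νp νm := by
  intro f hf hfc hfI
  rcases eq_empty_or_nonempty (tsupport f) with hemp | hne
  · rw [tsupport_eq_empty_iff] at hemp
    simp [hemp]
  obtain ⟨⟨a, ha, haf⟩, -⟩ := hI.exists_lt_mem_mem_lt (hfI (hfc.isCompact.sInf_mem hne))
  obtain ⟨-, b, hb, hbf⟩ := hI.exists_lt_mem_mem_lt (hfI (hfc.isCompact.sSup_mem hne))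
  have hsupp : ∀ x ∈ tsupport f, x ∈ Ioo a b := fun x hx =>
    ⟨haf.trans_le (csInf_le hfc.isCompact.bddBelow hx),
      (le_csSup hfc.isCompact.bddAbove hx).trans_lt hbf⟩
  have hab : a ≤ b := by
    obtain ⟨x, hx⟩ := hne
    exact ((hsupp x hx).1.trans (hsupp x hx).2).le
  have hf0 : ∀ x, x ∉ Ioo a b → f x = 0 := fun x hx =>
    image_eq_zero_of_notMem_tsupport fun h' => hx (hsupp x h')
  have hf'0 : ∀ x, x ∉ Ioo a b → deriv f x = 0 := fun x hx =>
    image_eq_zero_of_notMem_tsupport fun h' => hx (hsupp x (tsupport_deriv_subset h'))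
  have R := hR a ha b hb hab
  have S := hS a ha b hb hab
  have hsub : Icc a b ⊆ I := hconn.out ha hb
  have hIoc : Ioc a b ⊆ I := Ioc_subset_Icc_self.trans hsub
  have hu0 : ∀ x ∈ Icc a b, u x ≠ 0 := fun x hx => (hu x (hsub hx)).ne'
  have hfd : ∀ x, HasDerivAt f (deriv f x) x := fun x =>
    (hf.differentiable (by simp)).differentiableAt.hasDerivAt
  have hf' : Continuous (deriv f) := hf.continuous_deriv (by simp)
  have hBf' : BddMeas a b (deriv f) := BddMeas.of_continuousOn hf'.continuousOn
  have hBf : BddMeas a b f := BddMeas.of_continuousOn hf.continuous.continuousOn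
  have hBu : BddMeas a b (fun x => (u x ^ 2)⁻¹) :=
    BddMeas.of_continuousOn ((S.cont.pow 2).inv₀ fun x hx => pow_ne_zero 2 (hu0 x hx))
  have hBw : BddMeas a b (fun x => (w x)⁻¹) :=
    BddMeas.of_continuousOn (R.cont_w.inv₀ fun x hx => (R.pos_w x hx).ne')
  have hφ' : BddMeas a b (fun x => (2 * (f x * deriv f x) * u x - f x * f x * (w x * h x)) *
      (u x ^ 2)⁻¹) :=
    ((((BddMeas.const 2).mul (hBf.mul hBf')).mul (BddMeas.of_continuousOn S.cont)).sub
      ((hBf.mul hBf).mul (S.bddMeas_deriv R))).mul hBu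
  have e := S.signedIntegral_mul R (φ := fun x => f x ^ 2 / u x)
    ((hf.continuous.pow 2).continuousOn.div S.cont hu0) hφ' fun x hx => by
      have := ((hfd x).hasDerivWithinAt (s := Ioi x) |>.pow 2).div (S.hasDerivWithinAt R hx)
        (hu0 x (Ioo_subset_Icc_self hx))
      refine this.congr_deriv ?_
      simp only [Pi.pow_apply]
      push_cast
      ring
  rw [hf0 a fun h' => lt_irrefl _ h'.1, hf0 b fun h' => lt_irrefl _ h'.2,
    signedIntegral_congr measurableSet_Ioc (v := fun x => f x ^ 2) fun x hx => by
      have := hu0 x (Ioc_subset_Icc_self hx)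
      field_simp] at e
  have hI0 : ∀ x ∈ I \ Ioc a b, x ∉ Ioo a b := fun x hx h' => hx.2 (Ioo_subset_Ioc_self h')
  have e₁ := signedIntegral_eq_of_subset (m := m) (νp := νp) (νm := νm) (u := fun x => f x ^ 2)
    hI.measurableSet hIoc fun x hx => by simp [hf0 x (hI0 x hx)]
  have e₂ : ∫ x in I, deriv f x ^ 2 / w x = ∫ x in a..b, deriv f x ^ 2 / w x := by
    rw [intervalIntegral.integral_of_le hab]
    exact setIntegral_eq_of_subset_of_forall_sdiff_eq_zero hI.measurableSet hIoc
      fun x hx => by simp [hf'0 x (hI0 x hx)]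
  change signedIntegral m νp νm I (fun x => f x ^ 2) ≤ _
  rw [e₁, e, e₂]
  simp only [ne_eq, OfNat.ofNat_ne_zero, not_false_eq_true, zero_pow, zero_div, zero_mul, sub_zero,
    zero_add]
  have haI := left_mem_Icc.2 hab
  have hbI := right_mem_Icc.2 hab
  refine intervalIntegral.integral_mono_on hab ((hφ'.mul (S.bddMeas R)).intervalIntegrable haI hbI)
    (((hBf'.mul hBf').mul hBw).intervalIntegrable haI hbI |>.congr fun x _ => by
      ring) fun x hx => ?_
  have h1 := R.pos_w x hx
  have h2 := hu x (hsub hx)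
  have h3 : deriv f x ^ 2 / w x - (2 * (f x * deriv f x) * u x - f x * f x * (w x * h x)) *
      (u x ^ 2)⁻¹ * h x = (deriv f x * u x - f x * (w x * h x)) ^ 2 / (w x * u x ^ 2) := by
    field_simp
    ring
  have h4 : 0 ≤ (deriv f x * u x - f x * (w x * h x)) ^ 2 / (w x * u x ^ 2) := by positivity
  linarith

end

section

variable {m w : ℝ → ℝ} {νp νm : Measure ℝ} {I : Set ℝ} {u h v k : ℝ → ℝ}

theorem IsSol.congr {a b : ℝ} (S : IsSol m w νp νm a b u h) (huv : ∀ x ∈ Icc a b, v x = u x)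
    (hhk : ∀ x ∈ Icc a b, k x = h x) : IsSol m w νp νm a b v k where
  cont := S.cont.congr huv
  eq_u x hx := by
    rw [huv x hx, huv a (left_mem_Icc.2 (hx.1.trans hx.2)), S.eq_u x hx]
    congr 1
    refine intervalIntegral.integral_congr fun t ht => ?_
    rw [uIcc_of_le hx.1] at ht
    simp only [hhk t ⟨ht.1, ht.2.trans hx.2⟩]
  eq_h x hx := by
    rw [hhk x hx, hhk a (left_mem_Icc.2 (hx.1.trans hx.2)), S.eq_h x hx,
      signedIntegral_congr measurableSet_Ioc fun t ht => huv t ⟨ht.1.le, ht.2.trans hx.2⟩]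

/-- `(u, h)` solves the first order system of `L u = 0` on every compact interval of `I`. -/
def IsSolOn (I : Set ℝ) (m w : ℝ → ℝ) (νp νm : Measure ℝ) (u h : ℝ → ℝ) : Prop :=
  ∀ a ∈ I, ∀ b ∈ I, a ≤ b → IsSol m w νp νm a b u h

theorem exists_isSolOn (hconn : I.OrdConnected)
    (hR : ∀ a ∈ I, ∀ b ∈ I, a ≤ b → RegularOn m w νp νm a b) {z : ℝ}
    (hz : z ∈ I) (p q : ℝ) : ∃ u h, IsSolOn I m w νp νm u h ∧ u z = p ∧ h z = q := by
  have hmin : ∀ {x}, x ∈ I → min x z ∈ I := fun {x} hx => by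
    rcases min_choice x z with e | e <;> rwa [e]
  have hmax : ∀ {x}, x ∈ I → max x z ∈ I := fun {x} hx => by
    rcases max_choice x z with e | e <;> rwa [e]
  have hex : ∀ a b, ∃ f : (ℝ → ℝ) × (ℝ → ℝ), a ∈ I → b ∈ I → z ∈ Icc a b →
      IsSol m w νp νm a b f.1 f.2 ∧ f.1 z = p ∧ f.2 z = q := by
    intro a b
    by_cases hab : a ∈ I ∧ b ∈ I ∧ z ∈ Icc a b
    · obtain ⟨u, h, hS⟩ := exists_isSol (hR a hab.1 b hab.2.1 (hab.2.2.1.trans hab.2.2.2))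
        hab.2.2 p q
      exact ⟨(u, h), fun _ _ _ => hS⟩
    · exact ⟨(0, 0), fun h1 h2 h3 => absurd ⟨h1, h2, h3⟩ hab⟩
  choose U hU using hex
  have hzm : ∀ x, z ∈ Icc (min x z) (max x z) := fun x => ⟨min_le_right _ _, le_max_right _ _⟩
  have hxm : ∀ x, x ∈ Icc (min x z) (max x z) := fun x => ⟨min_le_left _ _, le_max_left _ _⟩
  refine ⟨fun x => (U (min x z) (max x z)).1 x, fun x => (U (min x z) (max x z)).2 x, ?_, ?_, ?_⟩
  · have key : ∀ a ∈ I, ∀ b ∈ I, z ∈ Icc a b → ∀ x ∈ Icc a b, x ∈ I →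
        (U (min x z) (max x z)).1 x = (U a b).1 x ∧ (U (min x z) (max x z)).2 x = (U a b).2 x := by
      intro a ha b hb hzab x hx hxI
      have hle : min x z ≤ max x z := (min_le_right _ _).trans (le_max_right _ _)
      obtain ⟨S, hS⟩ := hU _ _ (hmin hxI) (hmax hxI) (hzm x)
      obtain ⟨T, hT⟩ := hU a b ha hb hzab
      exact S.eq_of_eq_at (T.mono (hR a ha b hb (hx.1.trans hx.2)) (le_min hx.1 hzab.1) hle
        (max_le hx.2 hzab.2)) (hR _ (hmin hxI) _ (hmax hxI) hle) (hzm x) (hS.1.trans hT.1.symm)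
        (hS.2.trans hT.2.symm) (hxm x)
    intro a ha b hb hab
    have hle : min a z ≤ max b z := (min_le_right _ _).trans (le_max_right _ _)
    have hz' : z ∈ Icc (min a z) (max b z) := ⟨min_le_right _ _, le_max_right _ _⟩
    have S := (hU _ _ (hmin ha) (hmax hb) hz').1
    have hk := fun x (hx : x ∈ Icc (min a z) (max b z)) =>
      key _ (hmin ha) _ (hmax hb) hz' x hx (hconn.out (hmin ha) (hmax hb) hx)
    exact (S.congr (fun x hx => (hk x hx).1) fun x hx => (hk x hx).2).mono
      (hR _ (hmin ha) _ (hmax hb) hle) (min_le_left _ _) hab (le_max_left _ _)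
  · exact (hU _ _ (hmin hz) (hmax hz) (hzm z)).2.1
  · exact (hU _ _ (hmin hz) (hmax hz) (hzm z)).2.2

theorem IsSolOn.lincomb (hR : ∀ a ∈ I, ∀ b ∈ I, a ≤ b → RegularOn m w νp νm a b)
    (S : IsSolOn I m w νp νm u h) (T : IsSolOn I m w νp νm v k) (p q : ℝ) :
    IsSolOn I m w νp νm (fun x => p * u x + q * v x) (fun x => p * h x + q * k x) :=
  fun a ha b hb hab => (S a ha b hb hab).lincomb (T a ha b hb hab) (hR a ha b hb hab) p q

theorem IsSolOn.continuousOn_uIcc (S : IsSolOn I m w νp νm u h) {x y : ℝ} (hx : x ∈ I)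
    (hy : y ∈ I) : ContinuousOn u (uIcc x y) := by
  rcases le_total x y with hxy | hxy
  · rw [uIcc_of_le hxy]
    exact (S x hx y hy hxy).cont
  · rw [uIcc_of_ge hxy]
    exact (S y hy x hx hxy).cont

theorem IsSolOn.wronskian_const (hR : ∀ a ∈ I, ∀ b ∈ I, a ≤ b → RegularOn m w νp νm a b)
    (S : IsSolOn I m w νp νm u h) (T : IsSolOn I m w νp νm v k) {x y : ℝ} (hx : x ∈ I)
    (hy : y ∈ I) : u x * k x - v x * h x = u y * k y - v y * h y := by
  rcases le_total x y with hxy | hxy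
  · exact (S x hx y hy hxy).wronskian_const (T x hx y hy hxy) (hR x hx y hy hxy)
      (left_mem_Icc.2 hxy) (right_mem_Icc.2 hxy)
  · exact (S y hy x hx hxy).wronskian_const (T y hy x hx hxy) (hR y hy x hx hxy)
      (right_mem_Icc.2 hxy) (left_mem_Icc.2 hxy)

theorem IsLHarmonic.isSolOn (H : IsLHarmonic I m w νp νm u h) (hconn : I.OrdConnected) :
    IsSolOn I m w νp νm u h := fun a ha b hb _ =>
  { cont := H.1.mono (hconn.out ha hb)
    eq_u := fun x hx => H.2.2.1 a ha x (hconn.out ha hb hx)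
    eq_h := fun x hx => by
      have := H.2.2.2 a ha x (hconn.out ha hb hx) hx.1
      rw [signedIntegral]
      linarith }

theorem IsSolOn.isLHarmonic (S : IsSolOn I m w νp νm u h) (hI : IsOpen I)
    (hR : ∀ a ∈ I, ∀ b ∈ I, a ≤ b → RegularOn m w νp νm a b) :
    IsLHarmonic I m w νp νm u h := by
  refine ⟨fun x hx => ?_, fun x hx => ?_, fun x hx y hy => ?_, fun x hx y hy hxy => ?_⟩
  · obtain ⟨⟨a, ha, hax⟩, b, hb, hxb⟩ := hI.exists_lt_mem_mem_lt hx
    exact ((S a ha b hb (hax.trans hxb).le).cont.continuousAt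
      (Icc_mem_nhds hax hxb)).continuousWithinAt
  · obtain ⟨-, b, hb, hxb⟩ := hI.exists_lt_mem_mem_lt hx
    exact (S x hx b hb hxb.le).continuousWithinAt (hR x hx b hb hxb.le) ⟨le_rfl, hxb⟩
  · rcases le_total x y with hxy | hxy
    · exact (S x hx y hy hxy).sub_eq_integral (hR x hx y hy hxy) (left_mem_Icc.2 hxy)
        (right_mem_Icc.2 hxy)
    · exact (S y hy x hx hxy).sub_eq_integral (hR y hy x hx hxy) (right_mem_Icc.2 hxy)
        (left_mem_Icc.2 hxy)
  · have := (S x hx y hy hxy).h_sub_eq (hR x hx y hy hxy) le_rfl hxy le_rfl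
    rw [signedIntegral] at this
    linarith

/-- Under the quadratic form inequality, a nontrivial solution has at most one zero. -/
theorem QuadraticFormNonpos.eq_of_isSolOn_eq_zero (hQ : QuadraticFormNonpos I m w νp νm)
    (hI : IsOpen I) (hconn : I.OrdConnected)
    (hR : ∀ a ∈ I, ∀ b ∈ I, a ≤ b → RegularOn m w νp νm a b)
    (S : IsSolOn I m w νp νm u h) (hW : ∀ x ∈ I, u x * k x - v x * h x ≠ 0) {y z : ℝ} (hy : y ∈ I)
    (hz : z ∈ I) (huy : u y = 0) (huz : u z = 0) : y = z := by
  wlog hyz : y ≤ z generalizing y z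
  · exact (this hz hy huz huy (not_le.1 hyz).le).symm
  refine hyz.eq_or_lt.resolve_right fun hlt => hW z hz ?_
  rw [hQ.eq_zero_of_two_zeros hI hconn hR hy hz hlt (S y hy z hz hyz) huy huz, huz]
  ring

/-- Under the quadratic form inequality, a nontrivial solution keeps its sign on either side of
a zero. -/
theorem QuadraticFormNonpos.mul_pos_of_isSolOn (hQ : QuadraticFormNonpos I m w νp νm)
    (hI : IsOpen I) (hconn : I.OrdConnected)
    (hR : ∀ a ∈ I, ∀ b ∈ I, a ≤ b → RegularOn m w νp νm a b)
    (S : IsSolOn I m w νp νm u h) (hW : ∀ x ∈ I, u x * k x - v x * h x ≠ 0) {x y z : ℝ}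
    (hx : x ∈ I) (hy : y ∈ I) (hz : z ∈ I) (huz : u z = 0) (hzxy : z ∉ uIcc x y) :
    0 < u x * u y := by
  by_contra hneg
  have h0 : (0 : ℝ) ∈ uIcc (u x) (u y) := by
    rw [mem_uIcc]
    rcases mul_nonpos_iff.1 (not_lt.1 hneg) with h' | h'
    · exact Or.inr ⟨h'.2, h'.1⟩
    · exact Or.inl h'
  obtain ⟨t, ht, hut⟩ := intermediate_value_uIcc (S.continuousOn_uIcc hx hy) h0
  have htI : t ∈ I := (hconn.uIcc_subset hx hy) ht
  exact hzxy (hQ.eq_of_isSolOn_eq_zero hI hconn hR S hW hz htI huz hut ▸ ht)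

/-- Under the quadratic form inequality, there is a positive solution. -/
theorem QuadraticFormNonpos.exists_pos_isSolOn (hQ : QuadraticFormNonpos I m w νp νm)
    (hI : IsOpen I) (hconn : I.OrdConnected)
    (hR : ∀ a ∈ I, ∀ b ∈ I, a ≤ b → RegularOn m w νp νm a b) :
    ∃ u h, (∀ x ∈ I, 0 < u x) ∧ IsSolOn I m w νp νm u h := by
  rcases I.eq_empty_or_nonempty with rfl | ⟨z, hz⟩
  · exact ⟨0, 0, by simp, fun a ha => absurd ha (notMem_empty a)⟩
  obtain ⟨A, A', SA, hAz, hA'z⟩ := exists_isSolOn hconn hR hz 1 0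
  obtain ⟨B, B', SB, hBz, hB'z⟩ := exists_isSolOn hconn hR hz 0 1
  have hW : ∀ x ∈ I, A x * B' x - B x * A' x = 1 := fun x hx => by
    rw [SA.wronskian_const hR SB hx hz, hAz, hBz, hA'z, hB'z]
    norm_num
  have hWB : ∀ x ∈ I, B x * A' x - A x * B' x ≠ 0 := fun x hx h0 => by
    linarith [hW x hx]
  obtain ⟨⟨a, ha, haz⟩, b, hb, hzb⟩ := hI.exists_lt_mem_mem_lt hz
  have hab := (haz.trans hzb).le
  obtain ⟨c, hc, d, hd, hpos, hneg⟩ := (SB a ha b hb hab).sign_change (SA a ha b hb hab)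
    (hR a ha b hb hab) ⟨haz, hzb⟩ hBz (by rw [hAz, hB'z, one_mul])
  simp only [hAz, mul_one] at hpos hneg
  have hcI : c ∈ I := hconn.out ha hb ⟨hc.1, hc.2.le.trans hzb.le⟩
  have hdI : d ∈ I := hconn.out ha hb ⟨haz.le.trans hd.1.le, hd.2⟩
  have hBpos : ∀ x ∈ I, z < x → 0 < B x := fun x hx hzx =>
    pos_of_mul_pos_right (hQ.mul_pos_of_isSolOn hI hconn hR SB hWB hdI hx hz hBz fun h' => by
      rcases mem_uIcc.1 h' with h' | h'
      · exact (not_le.2 hd.1) h'.1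
      · exact (not_le.2 hzx) h'.1) (hpos d ⟨hd.1, le_rfl⟩).le
  have hBneg : ∀ x ∈ I, x < z → B x < 0 := fun x hx hzx => by
    have h1 := hQ.mul_pos_of_isSolOn hI hconn hR SB hWB hcI hx hz hBz fun h' => by
      rcases mem_uIcc.1 h' with h' | h'
      · exact (not_le.2 hzx) h'.2
      · exact (not_le.2 hc.2) h'.2
    have h2 := hneg c ⟨le_rfl, hc.2⟩
    nlinarith
  have hcross : ∀ y ∈ I, y < z → ∀ x ∈ I, z < x → -A x / B x ≤ A y / -B y := by
    intro y hy hyz x hx hzx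
    have hBx := hBpos x hx hzx
    have hBy := hBneg y hy hyz
    have h1 := hQ.mul_pos_of_isSolOn hI hconn hR (SA.lincomb hR SB (-B y) (A y)) (v := B) (k := B')
      (fun t ht h0 => hBy.ne (by linear_combination (-B y) * hW t ht - h0)) hz hx hy (by ring)
      fun h' => by
        rw [uIcc_of_le hzx.le] at h'
        exact (not_le.2 hyz) h'.1
    rw [hAz, hBz] at h1
    have h2 : 0 < -B y * A x + A y * B x := pos_of_mul_pos_right h1 (by linarith)
    rw [div_le_div_iff₀ hBx (neg_pos.2 hBy)]
    linarith
  set s := sSup ((fun x => -A x / B x) '' (I ∩ Ioi z)) with hs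
  have hs₁ : ∀ x ∈ I, z < x → -A x / B x ≤ s := fun x hx hzx =>
    le_csSup ⟨A a / -B a, by rintro _ ⟨t, ht, rfl⟩; exact hcross a ha haz t ht.1 ht.2⟩
      ⟨x, ⟨hx, hzx⟩, rfl⟩
  have hs₂ : ∀ y ∈ I, y < z → s ≤ A y / -B y := fun y hy hyz =>
    csSup_le ⟨_, b, ⟨hb, hzb⟩, rfl⟩ (by rintro _ ⟨t, ht, rfl⟩; exact hcross y hy hyz t ht.1 ht.2)
  have SU := SA.lincomb hR SB 1 s
  have hnonneg : ∀ x ∈ I, 0 ≤ 1 * A x + s * B x := by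
    intro x hx
    rcases lt_trichotomy x z with hxz | rfl | hzx
    · have := (le_div_iff₀ (neg_pos.2 (hBneg x hx hxz))).1 (hs₂ x hx hxz)
      linarith
    · rw [hAz, hBz]; norm_num
    · have := (div_le_iff₀ (hBpos x hx hzx)).1 (hs₁ x hx hzx)
      linarith
  refine ⟨_, _, fun x hx => (hnonneg x hx).lt_of_ne' fun h0 => ?_, SU⟩
  obtain ⟨⟨a', ha', hax⟩, b', hb', hxb⟩ := hI.exists_lt_mem_mem_lt hx
  have hab' := (hax.trans hxb).le
  have SV := SA.lincomb hR SB 0 (-1)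
  obtain ⟨c', hc', d', hd', hpos', hneg'⟩ := (SU a' ha' b' hb' hab').sign_change
    (SV a' ha' b' hb' hab') (hR a' ha' b' hb' hab') ⟨hax, hxb⟩ h0 (by
      linear_combination hW x hx - B' x * h0)
  have h1 := hpos' d' ⟨hd'.1, le_rfl⟩
  have h2 := hneg' c' ⟨le_rfl, hc'.2⟩
  have h3 := hnonneg c' (hconn.out ha' hb' ⟨hc'.1, hc'.2.le.trans hxb.le⟩)
  have h4 := hnonneg d' (hconn.out ha' hb' ⟨hax.le.trans hd'.1.le, hd'.2⟩)
  exact absurd (mul_nonneg h3 (pos_of_mul_pos_right h1 h4).le) (not_le.2 h2)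

end

theorem exists_pos_harmonic_iff_quadratic_form_nonpos
    (I : Set ℝ) (hIopen : IsOpen I) (hIconn : I.OrdConnected)
    (m w : ℝ → ℝ)
    (hm : ContinuousOn m I) (hw : ContinuousOn w I)
    (hmpos : ∀ x ∈ I, 0 < m x) (hwpos : ∀ x ∈ I, 0 < w x)
    (νp νm : Measure ℝ)
    (hνp : ∀ x ∈ I, ∀ y ∈ I, νp (Icc x y) < ⊤)
    (hνm : ∀ x ∈ I, ∀ y ∈ I, νm (Icc x y) < ⊤) :
    (∃ u h : ℝ → ℝ, (∀ x ∈ I, 0 < u x) ∧ IsLHarmonic I m w νp νm u h) ↔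
      (∀ f : ℝ → ℝ, ContDiff ℝ (⊤ : ℕ∞) f → HasCompactSupport f → tsupport f ⊆ I →
        (∫ x in I, (f x) ^ 2 * m x ∂νp) - (∫ x in I, (f x) ^ 2 * m x ∂νm) ≤
          ∫ x in I, (deriv f x) ^ 2 / w x) := by
  have hR : ∀ a ∈ I, ∀ b ∈ I, a ≤ b → RegularOn m w νp νm a b := fun a ha b hb hab =>
    { le := hab
      cont_m := hm.mono (hIconn.out ha hb)
      cont_w := hw.mono (hIconn.out ha hb)
      pos_w := fun x hx => hwpos x (hIconn.out ha hb hx)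
      finite_p := hνp a ha b hb
      finite_m := hνm a ha b hb }
  constructor
  · rintro ⟨u, h, hu, H⟩
    exact quadraticFormNonpos_of_pos hIopen hIconn hR hu (H.isSolOn hIconn)
  · intro hQ
    obtain ⟨u, h, hu, S⟩ :=
      QuadraticFormNonpos.exists_pos_isSolOn (m := m) (w := w) hQ hIopen hIconn hR
    exact ⟨u, h, hu, S.isLHarmonic hIopen hR⟩
end

section
/- Let I ⊆ ℝ be an interval and κ a positive Radon measure on I. (a) If sup I = +∞ and u↓ is a solution of (1/2)u″ = uκ on I that is positive and non-increasing, then for every y ∈ I: 2∫_{(y,+∞)} (x − y) u↓(x) κ(dx) = u↓(y) − lim_{x→+∞} u↓(x); in particular the integral on the left-hand side is finite. (b) If inf I = −∞ and u↑ is a solution that is positive and non-decreasing, then for every y ∈ I: 2∫_{(−∞,y)} (y − x) u↑(x) κ(dx) = u↑(y) − lim_{x→−∞} u↑(x). -/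
open MeasureTheory Set Filter

lemma tendsto_lintegral_Ioc_atTop (κ : Measure ℝ) (a : ℝ) (F : ℝ → ENNReal) :
    Tendsto (fun x ↦ ∫⁻ t in Ioc a x, F t ∂κ) atTop (nhds (∫⁻ t in Ioi a, F t ∂κ)) := by
  simp_rw [← withDensity_apply F measurableSet_Ioc, ← withDensity_apply F measurableSet_Ioi,
    ← iUnion_Ioc_right]
  exact tendsto_measure_iUnion_atTop (antitone_const.Ioc monotone_id)

lemma tendsto_lintegral_Ioc_atBot (κ : Measure ℝ) (a : ℝ) (F : ℝ → ENNReal) :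
    Tendsto (fun x ↦ ∫⁻ t in Ioc x a, F t ∂κ) atBot (nhds (∫⁻ t in Iic a, F t ∂κ)) := by
  simp_rw [← withDensity_apply F measurableSet_Ioc, ← withDensity_apply F measurableSet_Iic]
  exact tendsto_measure_Ioc_atBot _ a

/-- The tail of a primitive: if `w` is nonnegative, nonincreasing and has derivative `-h` in the
integrated sense with `h` nonincreasing, then `h` tends to zero and its integral
over the half-line is the total decrease of `w`. -/
lemma tendsto_and_lintegral_of_antitoneOn {w h : ℝ → ℝ} (hh : AntitoneOn h (Ici 0))
    (hw : AntitoneOn w (Ici 0)) (hw0 : ∀ s, 0 ≤ s → 0 ≤ w s)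
    (hwh : ∀ s, 0 ≤ s → w s = w 0 - ∫ r in 0..s, h r) :
    Tendsto h atTop (nhds 0) ∧
      ∃ l, l ≤ w 0 ∧ Tendsto w atTop (nhds l) ∧
        ∫⁻ t in Ioi 0, ENNReal.ofReal (h t) = ENNReal.ofReal (w 0 - l) := by
  have hint : ∀ a b, 0 ≤ a → a ≤ b → IntervalIntegrable h volume a b := fun a b ha hab ↦ by
    refine AntitoneOn.intervalIntegrable (hh.mono ?_)
    rw [uIcc_of_le hab]
    exact fun x hx ↦ ha.trans hx.1
  have hnn : ∀ s, 0 ≤ s → 0 ≤ h s := fun s hs ↦ by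
    have h1 : ∫ r in s..(s + 1), h r = w s - w (s + 1) := by
      rw [hwh s hs, hwh (s + 1) (by linarith),
        ← intervalIntegral.integral_add_adjacent_intervals (hint 0 s le_rfl hs)
          (hint s (s + 1) hs (by linarith))]
      ring
    have h2 : ∫ r in s..(s + 1), h r ≤ ∫ _ in s..(s + 1), h s :=
      intervalIntegral.integral_mono_on (by linarith) (hint s (s + 1) hs (by linarith)) (by simp)
        fun x hx ↦ hh hs (hs.trans hx.1) hx.1
    have h3 := hw (a := s) (b := s + 1) hs (show (0 : ℝ) ≤ s + 1 by linarith) (by linarith)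
    simp only [intervalIntegral.integral_const, smul_eq_mul] at h2
    linarith
  have hbound : ∀ s, 0 < s → h s ≤ w 0 / s := fun s hs ↦ by
    have h2 : ∫ _ in 0..s, h s ≤ ∫ r in 0..s, h r :=
      intervalIntegral.integral_mono_on hs.le (by simp) (hint 0 s le_rfl hs.le)
        fun x hx ↦ hh hx.1 hs.le hx.2
    simp only [intervalIntegral.integral_const, smul_eq_mul] at h2
    rw [le_div_iff₀ hs]
    linarith [hw0 s hs.le, hwh s hs.le]
  have hlim : Tendsto h atTop (nhds 0) :=
    squeeze_zero' ((eventually_ge_atTop 0).mono hnn) ((eventually_gt_atTop 0).mono hbound)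
      (tendsto_const_nhds.div_atTop tendsto_id)
  obtain ⟨l, hl⟩ : ∃ l, Tendsto w atTop (nhds l) := by
    have hanti : Antitone fun s ↦ w (max s 0) := fun a b hab ↦
      hw (le_max_right a 0) (le_max_right b 0) (max_le_max_right 0 hab)
    refine ⟨_, (tendsto_atTop_ciInf hanti ⟨0, ?_⟩).congr' ?_⟩
    · rintro _ ⟨s, rfl⟩
      exact hw0 _ (le_max_right s 0)
    · filter_upwards [eventually_ge_atTop 0] with s hs
      rw [max_eq_left hs]
  refine ⟨hlim, l, ?_, hl, ?_⟩
  · refine le_of_tendsto hl ?_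
    filter_upwards [eventually_ge_atTop 0] with s hs
    exact hw (mem_Ici.2 le_rfl) hs hs
  · refine tendsto_nhds_unique (tendsto_lintegral_Ioc_atTop volume 0 _)
      ((ENNReal.tendsto_ofReal (hl.const_sub (w 0))).congr' ?_)
    filter_upwards [eventually_ge_atTop 0] with s hs
    rw [hwh s hs, sub_sub_cancel, intervalIntegral.integral_of_le hs,
      ofReal_integral_eq_lintegral_ofReal (hint 0 s le_rfl hs).1]
    filter_upwards [ae_restrict_mem measurableSet_Ioc] with r hr
    exact hnn r hr.1.le

lemma integral_mul_of_lintegral_withDensity {κ : Measure ℝ} {S : Set ℝ} {f u : ℝ → ℝ} {C : ℝ}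
    (hS : MeasurableSet S) (hu : AEMeasurable u (κ.restrict S)) (hf : Measurable f)
    (hf0 : ∀ x ∈ S, 0 ≤ f x) (hu0 : ∀ x ∈ S, 0 ≤ u x) (hC : 0 ≤ C)
    (h : ∫⁻ x, ENNReal.ofReal (f x)
      ∂((κ.restrict S).withDensity fun x ↦ ENNReal.ofReal (2 * u x)) = ENNReal.ofReal C) :
    IntegrableOn (fun x ↦ f x * u x) S κ ∧ 2 * ∫ x in S, f x * u x ∂κ = C := by
  have hm : AEStronglyMeasurable (fun x ↦ 2 * (f x * u x)) (κ.restrict S) :=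
    ((hf.aemeasurable.mul hu).const_mul 2).aestronglyMeasurable
  have hnn : 0 ≤ᵐ[κ.restrict S] fun x ↦ 2 * (f x * u x) := by
    filter_upwards [ae_restrict_mem hS] with x hx
    exact mul_nonneg zero_le_two (mul_nonneg (hf0 x hx) (hu0 x hx))
  have hl : ∫⁻ x in S, ENNReal.ofReal (2 * (f x * u x)) ∂κ = ENNReal.ofReal C := by
    rw [← h, lintegral_withDensity_eq_lintegral_mul₀ (hu.const_mul 2).ennreal_ofReal
      hf.aemeasurable.ennreal_ofReal]
    refine setLIntegral_congr_fun hS fun x hx ↦ ?_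
    rw [Pi.mul_apply, ← ENNReal.ofReal_mul (mul_nonneg zero_le_two (hu0 x hx))]
    congr 1
    ring
  refine ⟨?_, ?_⟩
  · have hi : Integrable (fun x ↦ 2 * (f x * u x)) (κ.restrict S) :=
      ⟨hm, (hasFiniteIntegral_iff_ofReal hnn).2 (hl ▸ ENNReal.ofReal_lt_top)⟩
    simpa [IntegrableOn] using hi.const_mul (1 / 2)
  · rw [← integral_const_mul, integral_eq_lintegral_of_nonneg_ae hnn hm, hl,
      ENNReal.toReal_ofReal hC]

namespace IsSolKappa

variable {I : Set ℝ} {κ : Measure ℝ} {u g : ℝ → ℝ}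

lemma lintegral_Ioc (hsol : IsSolKappa I κ u g) (hI : I.OrdConnected)
    (hκ : ∀ x ∈ I, ∀ y ∈ I, κ (Icc x y) < ⊤) (hu : ∀ x ∈ I, 0 < u x) {a b : ℝ}
    (ha : a ∈ I) (hb : b ∈ I) (hab : a ≤ b) :
    ∫⁻ x in Ioc a b, ENNReal.ofReal (2 * u x) ∂κ = ENNReal.ofReal (g b - g a) := by
  have hsub : Icc a b ⊆ I := hI.out ha hb
  have hc : ContinuousOn u (Icc a b) := hsol.1.mono hsub
  obtain ⟨M, hM⟩ := isCompact_Icc.exists_bound_of_continuousOn hc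
  have hint : IntegrableOn u (Ioc a b) κ := by
    refine IntegrableOn.mono_set (t := Icc a b) ?_ Ioc_subset_Icc_self
    refine IntegrableOn.of_bound (hκ a ha b hb)
      (hc.aestronglyMeasurable measurableSet_Icc) M ?_
    filter_upwards [ae_restrict_mem measurableSet_Icc] with x hx using hM x hx
  rw [hsol.2.2.2 a ha b hb hab, ← integral_const_mul, ofReal_integral_eq_lintegral_ofReal
    (hint.const_mul 2)]
  filter_upwards [ae_restrict_mem measurableSet_Ioc] with x hx
  exact mul_nonneg zero_le_two (hu x (hsub (Ioc_subset_Icc_self hx))).le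

lemma monotoneOn_deriv (hsol : IsSolKappa I κ u g) (hI : I.OrdConnected)
    (hu : ∀ x ∈ I, 0 < u x) : MonotoneOn g I := fun a ha b hb hab ↦ by
  rw [← sub_nonneg, hsol.2.2.2 a ha b hb hab]
  exact mul_nonneg zero_le_two (setIntegral_nonneg measurableSet_Ioc
    fun x hx ↦ (hu x (hI.out ha hb (Ioc_subset_Icc_self hx))).le)

end IsSolKappa

/-- integral identities for the positive monotone solutions of
`(1/2) u'' = u κ` on an interval unbounded above (part (a)) or below (part (b)). -/
theorem integral_identity_monotone_solutions
    (I : Set ℝ) (hIconn : I.OrdConnected)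
    (κ : Measure ℝ)
    (hκfin : ∀ x ∈ I, ∀ y ∈ I, κ (Icc x y) < ⊤) :
    (∀ udown gdown : ℝ → ℝ, IsSolKappa I κ udown gdown →
      (∀ x ∈ I, 0 < udown x) → AntitoneOn udown I →
      (∀ x : ℝ, ∃ y ∈ I, x < y) →
      ∀ y ∈ I,
        IntegrableOn (fun x => (x - y) * udown x) (Ioi y) κ ∧
        ∃ l : ℝ, Tendsto udown atTop (nhds l) ∧
          2 * (∫ x in Ioi y, (x - y) * udown x ∂κ) = udown y - l) ∧
    (∀ uup gup : ℝ → ℝ, IsSolKappa I κ uup gup →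
      (∀ x ∈ I, 0 < uup x) → MonotoneOn uup I →
      (∀ x : ℝ, ∃ y ∈ I, y < x) →
      ∀ y ∈ I,
        IntegrableOn (fun x => (y - x) * uup x) (Iio y) κ ∧
        ∃ l : ℝ, Tendsto uup atBot (nhds l) ∧
          2 * (∫ x in Iio y, (y - x) * uup x ∂κ) = uup y - l) := by
  refine ⟨fun u g hsol hu hmono hsup y hy ↦ ?_, fun u g hsol hu hmono hinf y hy ↦ ?_⟩
  · have hI : Ici y ⊆ I := fun x hx ↦ by
      obtain ⟨z, hz, hxz⟩ := hsup x
      exact hIconn.out hy hz ⟨hx, hxz.le⟩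
    have hyI : ∀ s, 0 ≤ s → y + s ∈ I := fun s hs ↦ hI (by simpa using hs)
    have hg := hsol.monotoneOn_deriv hIconn hu
    obtain ⟨hlim, l, hl, hul, hint⟩ := tendsto_and_lintegral_of_antitoneOn
      (w := fun s ↦ u (y + s)) (h := fun s ↦ -g (y + s))
      (fun a ha b hb hab ↦ neg_le_neg (hg (hyI a ha) (hyI b hb) (by linarith)))
      (fun a ha b hb hab ↦ hmono (hyI a ha) (hyI b hb) (by linarith))
      (fun s hs ↦ (hu _ (hyI s hs)).le)
      (fun s hs ↦ by
        rw [hsol.2.2.1 (y + 0) (hyI 0 le_rfl) (y + s) (hyI s hs), intervalIntegral.integral_neg,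
          intervalIntegral.integral_comp_add_left g y, sub_neg_eq_add])
    have hg0 : Tendsto g atTop (nhds 0) := by
      have := (hlim.comp (tendsto_atTop_add_const_right atTop (-y) tendsto_id)).neg
      simpa [Function.comp_def] using this
    have hul' : Tendsto u atTop (nhds l) := by
      have := hul.comp (tendsto_atTop_add_const_right atTop (-y) tendsto_id)
      simpa [Function.comp_def] using this
    rw [add_zero] at hl hint
    have htail : ∀ a ∈ I, ∫⁻ x in Ioi a, ENNReal.ofReal (2 * u x) ∂κ = ENNReal.ofReal (-g a) := by
      intro a ha
      refine tendsto_nhds_unique (tendsto_lintegral_Ioc_atTop κ a _) ?_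
      rw [← zero_sub]
      refine (ENNReal.tendsto_ofReal (hg0.sub_const (g a))).congr' ?_
      filter_upwards [eventually_ge_atTop a, eventually_ge_atTop y] with x hx hxy
      exact (hsol.lintegral_Ioc hIconn hκfin hu ha (hI hxy) hx).symm
    have key := integral_mul_of_lintegral_withDensity (κ := κ) (S := Ioi y) (u := u)
      (f := fun x ↦ x - y) (C := u y - l) measurableSet_Ioi
      ((hsol.1.mono (Ioi_subset_Ici_self.trans hI)).aemeasurable measurableSet_Ioi) (by fun_prop)
      (fun x hx ↦ sub_nonneg.2 (le_of_lt hx))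
      (fun x hx ↦ (hu x (hI (Ioi_subset_Ici_self hx))).le) (sub_nonneg.2 hl) (by
        rw [lintegral_eq_lintegral_meas_lt _ ?_ (by fun_prop), ← hint]
        · refine setLIntegral_congr_fun measurableSet_Ioi fun t (ht : 0 < t) ↦ ?_
          have hset : {x : ℝ | t < x - y} = Ioi (y + t) := by
            ext x
            simp [lt_sub_iff_add_lt']
          have hsub : Ioi (y + t) ⊆ Ioi y := Ioi_subset_Ioi (by linarith)
          rw [hset, withDensity_apply _ measurableSet_Ioi,
            Measure.restrict_restrict measurableSet_Ioi, inter_eq_left.2 hsub,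
            htail _ (hyI t ht.le)]
        · refine (withDensity_absolutelyContinuous _ _).ae_le ?_
          filter_upwards [ae_restrict_mem measurableSet_Ioi] with x hx
          exact sub_nonneg.2 (le_of_lt hx))
    exact ⟨key.1, l, hul', key.2⟩
  · have hI : Iic y ⊆ I := fun x hx ↦ by
      obtain ⟨z, hz, hxz⟩ := hinf x
      exact hIconn.out hz hy ⟨hxz.le, hx⟩
    have hyI : ∀ s, 0 ≤ s → y - s ∈ I := fun s hs ↦ hI (by simpa using hs)
    have hg := hsol.monotoneOn_deriv hIconn hu
    obtain ⟨hlim, l, hl, hul, hint⟩ := tendsto_and_lintegral_of_antitoneOn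
      (w := fun s ↦ u (y - s)) (h := fun s ↦ g (y - s))
      (fun a ha b hb hab ↦ hg (hyI b hb) (hyI a ha) (by linarith))
      (fun a ha b hb hab ↦ hmono (hyI b hb) (hyI a ha) (by linarith))
      (fun s hs ↦ (hu _ (hyI s hs)).le)
      (fun s hs ↦ by
        rw [hsol.2.2.1 (y - s) (hyI s hs) (y - 0) (hyI 0 le_rfl),
          intervalIntegral.integral_comp_sub_left g y, add_sub_cancel_right])
    have hg0 : Tendsto g atBot (nhds 0) := by
      have := hlim.comp (tendsto_atTop_add_const_left atBot y tendsto_neg_atBot_atTop)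
      simpa [Function.comp_def] using this
    have hul' : Tendsto u atBot (nhds l) := by
      have := hul.comp (tendsto_atTop_add_const_left atBot y tendsto_neg_atBot_atTop)
      simpa [Function.comp_def] using this
    rw [sub_zero] at hl hint
    have htail : ∀ a ∈ I, ∫⁻ x in Iic a, ENNReal.ofReal (2 * u x) ∂κ = ENNReal.ofReal (g a) := by
      intro a ha
      refine tendsto_nhds_unique (tendsto_lintegral_Ioc_atBot κ a _) ?_
      rw [← sub_zero (g a)]
      refine (ENNReal.tendsto_ofReal (hg0.const_sub (g a))).congr' ?_
      filter_upwards [eventually_le_atBot a, eventually_le_atBot y] with x hx hxy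
      exact (hsol.lintegral_Ioc hIconn hκfin hu (hI hxy) ha hx).symm
    have key := integral_mul_of_lintegral_withDensity (κ := κ) (S := Iio y) (u := u)
      (f := fun x ↦ y - x) (C := u y - l) measurableSet_Iio
      ((hsol.1.mono (Iio_subset_Iic_self.trans hI)).aemeasurable measurableSet_Iio) (by fun_prop)
      (fun x hx ↦ sub_nonneg.2 (le_of_lt hx))
      (fun x hx ↦ (hu x (hI (Iio_subset_Iic_self hx))).le) (sub_nonneg.2 hl) (by
        rw [lintegral_eq_lintegral_meas_le _ ?_ (by fun_prop), ← hint]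
        · refine setLIntegral_congr_fun measurableSet_Ioi fun t (ht : 0 < t) ↦ ?_
          have hset : {x : ℝ | t ≤ y - x} = Iic (y - t) := by
            ext x
            simp [le_sub_comm]
          have hsub : Iic (y - t) ⊆ Iio y := Iic_subset_Iio.2 (by linarith)
          rw [hset, withDensity_apply _ measurableSet_Iic,
            Measure.restrict_restrict measurableSet_Iic, inter_eq_left.2 hsub,
            htail _ (hyI t ht.le)]
        · refine (withDensity_absolutelyContinuous _ _).ae_le ?_
          filter_upwards [ae_restrict_mem measurableSet_Iio] with x hx
          exact sub_nonneg.2 (le_of_lt hx))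
    exact ⟨key.1, l, hul', key.2⟩
end

section
/- Let κ be a nonzero positive Radon measure on ℝ, and let u↑, u↓ be solutions of (1/2)u″ = uκ on ℝ, u↑ positive non-decreasing with right-derivative g↑ and u↓ positive non-increasing with right-derivative g↓, normalized so that u↓(x)·g↑(x) − u↑(x)·g↓(x) = 2 for all x ∈ ℝ. Let b < a be reals with κ({a}) = κ({b}) = 0. Then ∫∫_{b ≤ y < ỹ ≤ a} ( u↓(y)u↑(ỹ) − u↑(y)u↓(ỹ) ) κ(dy) κ(dỹ) = (1/4)·( g↑(b)·g↓(a) − g↓(b)·g↑(a) ) − κ([b, a]). -/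
open MeasureTheory Set

/-- `u` is a solution of `(1/2) u'' = u κ` on `ℝ`, where `κ` is a positive Radon
measure, and `g` is the right-continuous right-derivative of `u`. -/
def IsSolKappaR (κ : Measure ℝ) (u g : ℝ → ℝ) : Prop :=
  Continuous u ∧
  (∀ x : ℝ, ContinuousWithinAt g (Ici x) x) ∧
  (∀ x' x : ℝ, u x = u x' + ∫ t in x'..x, g t) ∧
  (∀ x' x : ℝ, x' ≤ x → g x - g x' = 2 * ∫ t in Ioc x' x, u t ∂κ)

/-- The increment of the derivative of a solution recovers the integral of the solution. -/
lemma IsSolKappaR.setIntegral_Ioc {κ : Measure ℝ} {u g : ℝ → ℝ} (h : IsSolKappaR κ u g)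
    {x' x : ℝ} (hx : x' ≤ x) : ∫ t in Ioc x' x, u t ∂κ = (g x - g x') / 2 := by
  linarith [h.2.2.2 x' x hx]

lemma IsSolKappaR.integrableOn_Ioc {κ : Measure ℝ} [IsLocallyFiniteMeasure κ] {u g : ℝ → ℝ}
    (h : IsSolKappaR κ u g) (x' x : ℝ) : IntegrableOn u (Ioc x' x) κ :=
  h.1.integrableOn_Ioc

/-- A linear combination of two solutions integrates to the same combination of the increments
of their derivatives. -/
lemma IsSolKappaR.setIntegral_Ioc_sub {κ : Measure ℝ} [IsLocallyFiniteMeasure κ]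
    {u g v k : ℝ → ℝ} (hu : IsSolKappaR κ u g) (hv : IsSolKappaR κ v k) (p q : ℝ)
    {x' x : ℝ} (hx : x' ≤ x) :
    ∫ t in Ioc x' x, (u t * p - v t * q) ∂κ = ((g x - g x') * p - (k x - k x') * q) / 2 := by
  rw [integral_sub ((hu.integrableOn_Ioc x' x).mul_const p)
    ((hv.integrableOn_Ioc x' x).mul_const q), integral_mul_const, integral_mul_const,
    hu.setIntegral_Ioc hx, hv.setIntegral_Ioc hx]
  ring

/-- a double-integral identity for the normalized pair `u↑`, `u↓` of
solutions of `(1/2) u'' = u κ` on `ℝ`. -/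
theorem double_integral_identity
    (κ : Measure ℝ) [IsLocallyFiniteMeasure κ] (hκ0 : κ ≠ 0)
    (uup udown gup gdown : ℝ → ℝ)
    (hup : IsSolKappaR κ uup gup) (hdown : IsSolKappaR κ udown gdown)
    (huppos : ∀ x, 0 < uup x) (hupmono : Monotone uup)
    (hdownpos : ∀ x, 0 < udown x) (hdownanti : Antitone udown)
    (hW : ∀ x, udown x * gup x - uup x * gdown x = 2)
    (b a : ℝ) (hba : b < a) (ha : κ {a} = 0) (hb : κ {b} = 0) :
    (∫ z in Ioc b a, (∫ y in Ico b z, (udown y * uup z - uup y * udown z) ∂κ) ∂κ)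
      = 1 / 4 * (gup b * gdown a - gdown b * gup a) - (κ (Icc b a)).toReal := by
  have inner : ∀ z ∈ Ioc b a, ∫ y in Ico b z, (udown y * uup z - uup y * udown z) ∂κ
      = (udown z * (gup b / 2) - uup z * (gdown b / 2)) - 1 := by
    intro z hz
    have hIcc : ∫ y in Icc b z, (udown y * uup z - uup y * udown z) ∂κ
        = ∫ y in Ico b z, (udown y * uup z - uup y * udown z) ∂κ := by
      refine setIntegral_eq_of_subset_of_forall_sdiff_eq_zero measurableSet_Icc
        Ico_subset_Icc_self fun y hy => ?_
      have hyz : y = z := le_antisymm hy.1.2 (not_lt.mp fun h => hy.2 ⟨hy.1.1, h⟩)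
      rw [hyz]
      ring
    rw [← hIcc, integral_Icc_eq_integral_Ioc' hb, hdown.setIntegral_Ioc_sub hup _ _ hz.1.le]
    linear_combination (-1 / 2) * hW z
  have hmass : κ (Icc b a) = κ (Ioc b a) := measure_congr (Ioc_ae_eq_Icc' hb).symm
  have hint : IntegrableOn (fun z => udown z * (gup b / 2) - uup z * (gdown b / 2)) (Ioc b a) κ :=
    ((hdown.integrableOn_Ioc b a).mul_const _).sub ((hup.integrableOn_Ioc b a).mul_const _)
  rw [setIntegral_congr_fun measurableSet_Ioc inner,
    integral_sub hint (integrableOn_const measure_Ioc_lt_top.ne),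
    hdown.setIntegral_Ioc_sub hup _ _ hba.le, setIntegral_const, hmass, Measure.real,
    smul_eq_mul]
  ring
end

section
/- Let u, v : ℝ → ℝ be arbitrary functions, let n ≥ 1, and let a₁ ≤ b₁ ≤ a₂ ≤ b₂ ≤ … ≤ aₙ ≤ bₙ be real numbers. Define G(x, y) := u(min(x,y))·v(max(x,y)) and let M be the n×n real matrix with entries M_{ij} = G(a_i, b_j), 1 ≤ i, j ≤ n. Then det M = u(a₁)·v(bₙ)·∏_{r=1}^{n−1} ( v(b_r)·u(a_{r+1}) − u(b_r)·v(a_{r+1}) ). -/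
open Set

/-- A matrix with first row `t` whose other rows are those of the kernel matrix
`p i * t j` (for `i ≤ j`), `s j * q i` (for `j < i`). -/
theorem det_kernel_normalized_first_row {R : Type*} [CommRing R] (n : ℕ)
    (p q s t : Fin (n + 1) → R) :
    (Matrix.of fun i j : Fin (n + 1) =>
        if i = 0 then t j else if i ≤ j then p i * t j else s j * q i).det
      = t (Fin.last n) *
        ∏ r : Fin n, (t r.castSucc * p r.succ - s r.castSucc * q r.succ) := by
  induction n with
  | zero => simp
  | succ n ih =>
    rw [← Matrix.det_updateRow_add_smul_self _ (show (1 : Fin (n + 2)) ≠ 0 by simp) (-p 1),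
      Matrix.det_succ_row _ 1, Finset.sum_eq_single 0]
    · have hminor := ih (fun i => p i.succ) (fun i => q i.succ) (fun i => s i.succ)
        (fun i => t i.succ)
      rw [Fin.prod_univ_succ]
      convert congrArg (fun x => (t 0 * p 1 - s 0 * q 1) * x) hminor using 1
      · congr 1
        · simp
          ring
        · congr 1
          ext i j
          refine Fin.cases ?_ (fun k => ?_) i
          · simp [Matrix.updateRow_apply]
          · have hk : (1 : Fin (n + 2)).succAbove k.succ = k.succ.succ := by simp
            have hk1 : (k.succ.succ : Fin (n + 2)) ≠ 1 := by simp [Fin.ext_iff]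
            simp only [Matrix.submatrix_apply, hk, Matrix.updateRow_ne hk1]
            simp
      · simp only [Fin.succ_castSucc, Fin.succ_last, Fin.castSucc_zero, Fin.succ_zero_eq_one]
        ring
    · intro j _ hj
      have h : (1 : Fin (n + 2)) ≤ j := Fin.one_le_of_ne_zero hj
      simp [h]
    · simp

/-- The determinant of the matrix with entries `p i * t j` for `i ≤ j` and `s j * q i` for
`j < i`. -/
theorem det_kernel {R : Type*} [CommRing R] (n : ℕ) (p q s t : Fin (n + 1) → R) :
    (Matrix.of fun i j : Fin (n + 1) => if i ≤ j then p i * t j else s j * q i).det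
      = p 0 * t (Fin.last n) *
        ∏ r : Fin n, (t r.castSucc * p r.succ - s r.castSucc * q r.succ) := by
  rw [mul_assoc, ← det_kernel_normalized_first_row]
  set N := Matrix.of fun i j : Fin (n + 1) =>
    if i = 0 then t j else if i ≤ j then p i * t j else s j * q i with hN
  have hdet := Matrix.det_updateRow_smul N 0 (p 0) (N 0)
  rw [Matrix.updateRow_eq_self] at hdet
  rw [← hdet]
  congr 1
  ext i j
  by_cases hi : i = 0
  · subst hi
    simp [hN]
  · simp [hN, hi]

/-- factorization of the determinant of a matrix built from a kernel of
the form `G(x,y) = u(x ∧ y) · v(x ∨ y)` evaluated at interlaced points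
`a₁ ≤ b₁ ≤ a₂ ≤ b₂ ≤ … ≤ aₙ ≤ bₙ`. -/
theorem det_interlaced_kernel_factorization
    (u v : ℝ → ℝ) (n : ℕ) (a b : Fin (n + 1) → ℝ)
    (hab : ∀ i, a i ≤ b i)
    (hba : ∀ i j : Fin (n + 1), i < j → b i ≤ a j) :
    (Matrix.of fun i j : Fin (n + 1) =>
        u (min (a i) (b j)) * v (max (a i) (b j))).det
      = u (a 0) * v (b (Fin.last n)) *
        ∏ r : Fin n,
          (v (b r.castSucc) * u (a r.succ) - u (b r.castSucc) * v (a r.succ)) := by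
  rw [← det_kernel n (fun i => u (a i)) (fun i => v (a i)) (fun i => u (b i)) (fun i => v (b i))]
  congr 1
  ext i j
  simp only [Matrix.of_apply]
  split_ifs with h
  · have hle : a i ≤ b j := by
      rcases h.eq_or_lt with rfl | h
      · exact hab i
      · exact (hab i).trans ((hba i j h).trans (hab j))
    rw [min_eq_left hle, max_eq_right hle]
  · have hle := hba j i (not_le.mp h)
    rw [min_eq_right hle, max_eq_left hle]
end
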